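/- arXiv:2605.20705 — 2 statements merged into one kernel-verified Lean document; each statement's English description precedes it below -/
import Mathlib

section
/- Fix an integer s > 2. For every real ε > 0 there exists n₀ such that for all integers n ≥ n₀ the following holds: if P is a finite set of n points in ℝ² and C is a family of n pseudo-segments such that there do not exist an s-element subset S of P and an injective map φ from the 2-element subsets of S to C with every 2-element subset T of S satisfying T ⊆ φ(T), then I(P,C) < ε · n^(4/3). -/
open scoped Classical

/-- A simple curve: the image of an injective continuous map from [0,1] into ℝ². -/
def IsSimpleCurve (γ : Set (ℝ × ℝ)) : Prop :=
  ∃ f : Set.Icc (0:ℝ) 1 → ℝ × ℝ, Continuous f ∧ Function.Injective f ∧ γ = Set.range f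

/-- A k-intersecting family of simple curves: every member is a simple curve and
any two distinct members intersect in at most k points. -/
def KIntersecting (C : Finset (Set (ℝ × ℝ))) (k : ℕ) : Prop :=
  (∀ γ ∈ C, IsSimpleCurve γ) ∧
  ∀ γ ∈ C, ∀ γ' ∈ C, γ ≠ γ' → (γ ∩ γ').Finite ∧ (γ ∩ γ').ncard ≤ k

/-- The number of incidences between a finite point set P and a finite family of curves C. -/
noncomputable def incidences (P : Finset (ℝ × ℝ)) (C : Finset (Set (ℝ × ℝ))) : ℕ :=
  ∑ γ ∈ C, (P.filter (fun p => p ∈ γ)).card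

/-- (P,C) contains a complete s-point (k+1)-configuration: there are s points of P and an
injective assignment of a distinct curve of C to each (k+1)-element subset, containing it. -/
def ContainsConfig (P : Finset (ℝ × ℝ)) (C : Finset (Set (ℝ × ℝ))) (s k : ℕ) : Prop :=
  ∃ S : Finset (ℝ × ℝ), S ⊆ P ∧ S.card = s ∧
    ∃ φ : Finset (ℝ × ℝ) → Set (ℝ × ℝ),
      Set.InjOn φ ↑(S.powersetCard (k+1)) ∧
      ∀ T ∈ S.powersetCard (k+1), φ T ∈ C ∧ (↑T : Set (ℝ × ℝ)) ⊆ φ T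



/-- Two continuous logarithms of the same path have the same increment. -/
lemma log_incr_unique (M N : ℝ → ℂ) (hM : Continuous M) (hN : Continuous N) (c : ℂ)
    (h : ∀ t, Complex.exp (M t) = c * Complex.exp (N t)) (hc : c ≠ 0) :
    M 1 - M 0 = N 1 - N 0 := by
  have key : ∀ t, Complex.exp (M t - N t) = c := by
    intro t
    rw [Complex.exp_sub, h t, mul_div_assoc, div_self (Complex.exp_ne_zero _), mul_one]
  have hcov := Complex.isCoveringMapOn_exp
  have hu := hcov.existsUnique_continuousMap_lifts (f := ContinuousMap.const ℝ c) (a₀ := 0)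
    (e₀ := M 0 - N 0) (key 0) (fun _ => hc)
  have h1 := hu.unique (y₁ := ⟨fun t => M t - N t, hM.sub hN⟩)
    (y₂ := ContinuousMap.const ℝ (M 0 - N 0)) ⟨rfl, funext key⟩ ⟨rfl, funext fun _ => key 0⟩
  have h2 := congrArg (fun F : C(ℝ, ℂ) => F 1) h1
  simp only [ContinuousMap.coe_mk, ContinuousMap.const_apply] at h2
  linear_combination h2

lemma exists_log_square (g : ℝ × ℝ → ℂ) (hg : Continuous g) (h0 : ∀ x, g x ≠ 0) :
    ∃ L : ℝ × ℝ → ℂ, Continuous L ∧ ∀ x, Complex.exp (L x) = g x := by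
  have hcov := Complex.isCoveringMapOn_exp
  obtain ⟨e, he⟩ : ∃ e, Complex.exp e = g (0,0) := ⟨Complex.log (g (0,0)), Complex.exp_log (h0 _)⟩
  obtain ⟨F, hF, -⟩ := hcov.existsUnique_continuousMap_lifts (f := ⟨g, hg⟩) (a₀ := (0,0)) (e₀ := e) he
     (by intro x; exact h0 x)
  exact ⟨F, F.continuous, fun x => congrFun hF.2 x⟩

/-- The increment of the logarithm of `e t - p`, for a path `e` avoiding `p`. -/
lemma exists_incr (e : ℝ → ℂ) (p : ℂ) (he : Continuous e) (h : ∀ t, e t ≠ p) :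
    ∃ θ : ℂ, ∀ (M : ℝ → ℂ) (c : ℂ), Continuous M → c ≠ 0 →
      (∀ t, Complex.exp (M t) = c * (e t - p)) → M 1 - M 0 = θ := by
  obtain ⟨L, hL, hLe⟩ := exists_log_square (fun x => e x.1 - p) (by fun_prop)
    (fun x => sub_ne_zero.2 (h _))
  refine ⟨L (1, 0) - L (0, 0), fun M c hM hc hMe => ?_⟩
  exact log_incr_unique M (fun t => L (t, 0)) hM (by fun_prop) c (fun t => by rw [hMe, hLe]) hc

/-- `K₅` cannot be drawn in the plane with independent edges disjoint. -/
theorem K5_nonplanar (v : Fin 5 → ℂ) (e : Fin 5 → Fin 5 → ℝ → ℂ)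
    (hc : ∀ i j, i < j → Continuous (e i j))
    (h0 : ∀ i j, i < j → e i j 0 = v i) (h1 : ∀ i j, i < j → e i j 1 = v j)
    (hd : ∀ i j k l, i < j → k < l → i ≠ k → i ≠ l → j ≠ k → j ≠ l →
      ∀ x y, e i j x ≠ e k l y) : False := by
  -- vertices avoid edges
  have hve : ∀ c a b, a < b → c ≠ a → c ≠ b → ∀ t, e a b t ≠ v c := by
    intro c a b hab hca hcb t
    obtain ⟨d, hd1, hd2, hd3⟩ : ∃ d : Fin 5, d ≠ a ∧ d ≠ b ∧ d ≠ c := by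
      revert a b c; decide
    rcases lt_or_gt_of_ne hd3 with hlt | hlt
    · rw [← h1 d c hlt]
      exact hd a b d c hab hlt hd1.symm hca.symm hd2.symm hcb.symm t 1
    · rw [← h0 c d hlt]
      exact hd a b c d hab hlt hca.symm hd1.symm hcb.symm hd2.symm t 0
  have hvv : ∀ a b, a ≠ b → v a ≠ v b := by
    intro a b hab
    obtain ⟨d, hd1, hd2⟩ : ∃ d : Fin 5, d ≠ a ∧ d ≠ b := by
      revert a b; decide
    rcases lt_or_gt_of_ne hd1 with hlt | hlt
    · rw [← h1 d a hlt]; exact hve b d a hlt hd2.symm hab.symm 1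
    · rw [← h0 a d hlt]; exact hve b a d hlt hab.symm hd2.symm 0
  -- increments
  have hθ : ∀ c a b : Fin 5, ∃ θ : ℂ, a < b → c ≠ a → c ≠ b →
      ∀ (M : ℝ → ℂ) (z : ℂ), Continuous M → z ≠ 0 →
      (∀ t, Complex.exp (M t) = z * (e a b t - v c)) → M 1 - M 0 = θ := by
    intro c a b
    by_cases hh : a < b ∧ c ≠ a ∧ c ≠ b
    · obtain ⟨θ, h⟩ := exists_incr (e a b) (v c) (hc a b hh.1) (hve c a b hh.1 hh.2.1 hh.2.2)
      exact ⟨θ, fun _ _ _ => h⟩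
    · exact ⟨0, fun h1 h2 h3 => absurd ⟨h1, h2, h3⟩ hh⟩
  choose θ hθ using hθ
  -- chosen logarithms of vertex differences
  obtain ⟨l, hl, hls⟩ : ∃ l : Fin 5 → Fin 5 → ℂ,
      (∀ i j, i ≠ j → Complex.exp (l i j) = v i - v j) ∧
      (∀ i j, i < j → l j i = l i j + Real.pi * Complex.I) := by
    refine ⟨fun i j => if i < j then Complex.log (v i - v j) else
      Complex.log (v j - v i) + Real.pi * Complex.I, ?_, ?_⟩
    · intro i j hij
      dsimp only
      split_ifs with h
      · exact Complex.exp_log (sub_ne_zero.2 (hvv i j hij))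
      · rw [Complex.exp_add, Complex.exp_log (sub_ne_zero.2 (hvv j i hij.symm)),
          Complex.exp_pi_mul_I]; ring
    · intro i j hij
      simp [hij, hij.le, not_lt.2 hij.le]
  have hk : ∀ c a b : Fin 5, ∃ k : ℤ, a < b → c ≠ a → c ≠ b →
      θ c a b = l b c - l a c + k * (2 * Real.pi * Complex.I) := by
    intro c a b
    by_cases hh : a < b ∧ c ≠ a ∧ c ≠ b
    · obtain ⟨hab, hca, hcb⟩ := hh
      obtain ⟨L, hL, hLe⟩ := exists_log_square (fun x => e a b x.1 - v c)
        (by have := hc a b hab; fun_prop) (fun x => sub_ne_zero.2 (hve c a b hab hca hcb _))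
      have h2 := hθ c a b hab hca hcb (fun t => L (t, 0)) 1 (by fun_prop) one_ne_zero
        (fun t => by rw [hLe, one_mul])
      have h3 : Complex.exp (θ c a b) = Complex.exp (l b c - l a c) := by
        rw [← h2, Complex.exp_sub, Complex.exp_sub, hLe, hLe, hl b c hcb.symm, hl a c hca.symm]
        simp only [h0 a b hab, h1 a b hab]
      obtain ⟨n, hn⟩ := Complex.exp_eq_exp_iff_exists_int.1 h3
      exact ⟨n, fun _ _ _ => hn⟩
    · exact ⟨0, fun h1 h2 h3 => absurd ⟨h1, h2, h3⟩ hh⟩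
  choose k hk using hk
  -- the square relation
  have hsq : ∀ a b c d : Fin 5, a < b → c < d → a ≠ c → a ≠ d → b ≠ c → b ≠ d →
      θ c a b + θ b c d - θ d a b - θ a c d = 0 := by
    intro a b c d hab hcd hac had hbc hbd
    have hcab := hc a b hab
    have hccd := hc c d hcd
    obtain ⟨L, hL, hLe⟩ := exists_log_square (fun x => e a b x.1 - e c d x.2)
      (by fun_prop) (fun x => sub_ne_zero.2 (hd a b c d hab hcd hac had hbc hbd _ _))
    have e1 := hθ c a b hab hac.symm hbc.symm (fun t => L (t, 0)) 1 (by fun_prop) one_ne_zero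
      (fun t => by rw [hLe, one_mul]; simp only [h0 c d hcd])
    have e2 := hθ d a b hab had.symm hbd.symm (fun t => L (t, 1)) 1 (by fun_prop) one_ne_zero
      (fun t => by rw [hLe, one_mul]; simp only [h1 c d hcd])
    have e3 := hθ a c d hcd hac had (fun t => L (0, t)) (-1) (by fun_prop) (by norm_num)
      (fun t => by rw [hLe]; simp only [h0 a b hab]; ring)
    have e4 := hθ b c d hcd hbc hbd (fun t => L (1, t)) (-1) (by fun_prop) (by norm_num)
      (fun t => by rw [hLe]; simp only [h1 a b hab]; ring)
    rw [← e1, ← e2, ← e3, ← e4]; ring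
  -- integer relation
  let σ : Fin 5 → Fin 5 → ℤ := fun x y => if y < x then 1 else -1
  have hσ : ∀ x y, x ≠ y → l x y - l y x = σ x y * (Real.pi * Complex.I) := by
    intro x y hxy
    rcases lt_or_gt_of_ne hxy with h | h
    · rw [hls x y h]; simp [σ, not_lt.2 h.le]
    · rw [hls y x h]; simp [σ, h]
  have hinter : ∀ a b c d : Fin 5, a < b → c < d → a ≠ c → a ≠ d → b ≠ c → b ≠ d →
      σ b c + σ c a + σ d b + σ a d + 2 * (k c a b + k b c d - k d a b - k a c d) = 0 := by
    intro a b c d hab hcd hac had hbc hbd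
    have h := hsq a b c d hab hcd hac had hbc hbd
    rw [hk c a b hab hac.symm hbc.symm, hk d a b hab had.symm hbd.symm, hk a c d hcd hac had,
      hk b c d hcd hbc hbd] at h
    have h1 := hσ b c hbc
    have h2 := hσ c a hac.symm
    have h3 := hσ d b hbd.symm
    have h4 := hσ a d had
    have hpi : (Real.pi * Complex.I : ℂ) ≠ 0 :=
      mul_ne_zero (by exact_mod_cast Real.pi_ne_zero) Complex.I_ne_zero
    have : ((σ b c + σ c a + σ d b + σ a d + 2 * (k c a b + k b c d - k d a b - k a c d) : ℤ) : ℂ)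
        * (Real.pi * Complex.I) = 0 := by
      push_cast
      linear_combination h - h1 - h2 - h3 - h4
    rcases mul_eq_zero.1 this with h | h
    · exact_mod_cast h
    · exact absurd h hpi
  have q : ∀ a b c d : Fin 5, (a < b ∧ c < d ∧ a ≠ c ∧ a ≠ d ∧ b ≠ c ∧ b ≠ d) →
      σ b c + σ c a + σ d b + σ a d + 2 * (k c a b + k b c d - k d a b - k a c d) = 0 :=
    fun a b c d ⟨h1, h2, h3, h4, h5, h6⟩ => hinter a b c d h1 h2 h3 h4 h5 h6
  have p1 := q 0 1 2 3 (by decide)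
  have p2 := q 0 2 1 3 (by decide)
  have p3 := q 0 3 1 2 (by decide)
  have p4 := q 0 1 2 4 (by decide)
  have p5 := q 0 2 1 4 (by decide)
  have p6 := q 0 4 1 2 (by decide)
  have p7 := q 0 1 3 4 (by decide)
  have p8 := q 0 3 1 4 (by decide)
  have p9 := q 0 4 1 3 (by decide)
  have p10 := q 0 2 3 4 (by decide)
  have p11 := q 0 3 2 4 (by decide)
  have p12 := q 0 4 2 3 (by decide)
  have p13 := q 1 2 3 4 (by decide)
  have p14 := q 1 3 2 4 (by decide)
  have p15 := q 1 4 2 3 (by decide)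
  have s1 : ∀ x y, y < x → σ x y = 1 := fun x y h => if_pos h
  have s2 : ∀ x y, x < y → σ x y = -1 := fun x y h => if_neg (not_lt.2 h.le)
  clear_value σ
  have t : σ 0 1 = -1 ∧ σ 0 2 = -1 ∧ σ 0 3 = -1 ∧ σ 0 4 = -1 ∧ σ 1 2 = -1 ∧ σ 1 3 = -1 ∧
    σ 1 4 = -1 ∧ σ 2 3 = -1 ∧ σ 2 4 = -1 ∧ σ 3 4 = -1 := by
    refine ⟨?_, ?_, ?_, ?_, ?_, ?_, ?_, ?_, ?_, ?_⟩ <;> exact s2 _ _ (by decide)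
  have t' : σ 1 0 = 1 ∧ σ 2 0 = 1 ∧ σ 3 0 = 1 ∧ σ 4 0 = 1 ∧ σ 2 1 = 1 ∧ σ 3 1 = 1 ∧
    σ 4 1 = 1 ∧ σ 3 2 = 1 ∧ σ 4 2 = 1 ∧ σ 4 3 = 1 := by
    refine ⟨?_, ?_, ?_, ?_, ?_, ?_, ?_, ?_, ?_, ?_⟩ <;> exact s1 _ _ (by decide)
  obtain ⟨t1, t2, t3, t4, t5, t6, t7, t8, t9, t10⟩ := t
  obtain ⟨u1, u2, u3, u4, u5, u6, u7, u8, u9, u10⟩ := t'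
  simp only [t1, t2, t3, t4, t5, t6, t7, t8, t9, t10, u1, u2, u3, u4, u5, u6, u7, u8, u9, u10] at *
  omega


section Separator

variable {V : Type*}

/-- Connected finite vertex sets. -/
def ConnS (adj : V → V → Prop) (T : Finset V) : Prop :=
  T.Nonempty ∧ ∀ S ⊆ T, S.Nonempty → (∀ u ∈ S, ∀ v ∈ T, adj u v → v ∈ S) → S = T

/-- No `K₅` minor. -/
def NoK5 (adj : V → V → Prop) : Prop :=
  ¬ ∃ C : Fin 5 → Finset V, (∀ i, ConnS adj (C i)) ∧ (∀ i j, i ≠ j → Disjoint (C i) (C j)) ∧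
    (∀ i j, i ≠ j → ∃ a ∈ C i, ∃ b ∈ C j, adj a b)

variable {adj : V → V → Prop}

lemma ConnS.singleton (v : V) : ConnS adj {v} := by
  refine ⟨Finset.singleton_nonempty v, fun S hS hne _ => ?_⟩
  rcases Finset.subset_singleton_iff.1 hS with h | h
  · simp [h] at hne
  · exact h

lemma ConnS.subset_of_closed {K B : Finset V} (hK : ConnS adj K) (hne : (K ∩ B).Nonempty)
    (hc : ∀ u ∈ K, u ∈ B → ∀ v ∈ K, adj u v → v ∈ B) : K ⊆ B := by
  have := hK.2 (K ∩ B) Finset.inter_subset_left hne (by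
    intro u hu v hv huv
    rw [Finset.mem_inter] at hu ⊢
    exact ⟨hv, hc u hu.1 hu.2 v hv huv⟩)
  exact Finset.inter_eq_left.1 this

lemma ConnS.union (hs : ∀ u v, adj u v → adj v u) {A B : Finset V} (hA : ConnS adj A)
    (hB : ConnS adj B) (h : ∃ a ∈ A, ∃ b ∈ B, adj a b ∨ a = b) : ConnS adj (A ∪ B) := by
  obtain ⟨a, ha, b, hb, hab⟩ := h
  refine ⟨hA.1.mono Finset.subset_union_left, fun S hS hne hcl => ?_⟩
  have hAS : (A ∩ S).Nonempty → A ⊆ S := fun h => hA.subset_of_closed h (fun u _ hu v hv huv =>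
    hcl u hu v (Finset.mem_union_left _ hv) huv)
  have hBS : (B ∩ S).Nonempty → B ⊆ S := fun h => hB.subset_of_closed h (fun u _ hu v hv huv =>
    hcl u hu v (Finset.mem_union_right _ hv) huv)
  have hab' : a ∈ S → b ∈ S := fun h => by
    rcases hab with hab | hab
    · exact hcl a h b (Finset.mem_union_right _ hb) hab
    · exact hab ▸ h
  have hba' : b ∈ S → a ∈ S := fun h => by
    rcases hab with hab | hab
    · exact hcl b h a (Finset.mem_union_left _ ha) (hs _ _ hab)
    · exact hab ▸ h
  obtain ⟨x, hx⟩ := hne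
  refine Finset.Subset.antisymm hS ?_
  rcases Finset.mem_union.1 (hS hx) with h | h
  · have h1 := hAS ⟨x, Finset.mem_inter.2 ⟨h, hx⟩⟩
    exact Finset.union_subset h1 (hBS ⟨b, Finset.mem_inter.2 ⟨hb, hab' (h1 ha)⟩⟩)
  · have h1 := hBS ⟨x, Finset.mem_inter.2 ⟨h, hx⟩⟩
    exact Finset.union_subset (hAS ⟨a, Finset.mem_inter.2 ⟨ha, hba' (h1 hb)⟩⟩) h1

lemma ConnS.exists_max (hs : ∀ u v, adj u v → adj v u) {K F : Finset V} (hK : ConnS adj K)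
    (hKF : K ⊆ F) :
    ∃ M, ConnS adj M ∧ K ⊆ M ∧ M ⊆ F ∧ ∀ u ∈ M, ∀ v ∈ F, adj u v → v ∈ M := by
  obtain ⟨M, hM, hmax⟩ := Finset.exists_max_image
    (F.powerset.filter (fun M => ConnS adj M ∧ K ⊆ M)) Finset.card
    ⟨K, by simp [hKF, hK]⟩
  simp only [Finset.mem_filter, Finset.mem_powerset] at hM hmax
  refine ⟨M, hM.2.1, hM.2.2, hM.1, fun u hu v hv huv => ?_⟩
  by_contra hvM
  have h1 := hmax (M ∪ {v}) ⟨Finset.union_subset hM.1 (by simpa using hv),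
    hM.2.1.union hs (ConnS.singleton v) ⟨u, hu, v, by simp, Or.inl huv⟩,
    hM.2.2.trans Finset.subset_union_left⟩
  rw [Finset.card_union_of_disjoint (by simpa using hvM)] at h1
  simp at h1

/-- Either there is a cheap connected set meeting all `A j`, or a cheap cut. -/
lemma cut_lemma [Fintype V] (hs : ∀ u v, adj u v → adj v u) (c : V → ℕ) (r : ℕ) (hr : 0 < r)
    (hD : 6 * ∑ v, c v ^ 2 ≤ r ^ 2) (B : Finset V) (A : Fin 5 → Finset V) (J : Finset (Fin 5)) :
    (∃ T ⊆ B, ConnS adj T ∧ (∀ j ∈ J, (T ∩ A j).Nonempty) ∧ ∑ v ∈ T, c v ≤ r) ∨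
    (∃ Z ⊆ B, ∑ v ∈ Z, c v ≤ r ∧
      ∀ K ⊆ B, Disjoint K Z → ConnS adj K → ∃ j ∈ J, Disjoint K (A j)) := by
  let R : ℕ → V → ℕ → Prop := fun i v x => ∃ T ⊆ B, ConnS adj T ∧ v ∈ T ∧
    (∀ j ∈ J, (j : ℕ) < i → (T ∩ A j).Nonempty) ∧ ∑ v ∈ T, c v ≤ x
  have hRmono : ∀ i v x y, x ≤ y → R i v x → R i v y := by
    rintro i v x y hxy ⟨T, h1, h2, h3, h4, h5⟩
    exact ⟨T, h1, h2, h3, h4, h5.trans hxy⟩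
  by_cases hT : ∃ v, R 5 v r
  · obtain ⟨v, T, h1, h2, h3, h4, h5⟩ := hT
    exact Or.inl ⟨T, h1, h2, fun j hj => h4 j hj j.2, h5⟩
  right
  push Not at hT
  let Z : ℕ → Finset V := fun τ => B.filter (fun v => ∃ i ∈ Finset.range 6, R i v (τ + c v) ∧ ¬ R i v τ)
  have hcount : ∀ i v, ((Finset.range r).filter (fun τ => R i v (τ + c v) ∧ ¬ R i v τ)).card ≤ c v := by
    intro i v
    by_cases hex : ∃ x, R i v x
    · have hsub : (Finset.range r).filter (fun τ => R i v (τ + c v) ∧ ¬ R i v τ) ⊆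
          Finset.Ico (Nat.find hex - c v) (Nat.find hex) := by
        intro τ hτ
        simp only [Finset.mem_filter] at hτ
        have h1 := Nat.find_min' hex hτ.2.1
        have h2 : τ < Nat.find hex := by
          by_contra h
          exact hτ.2.2 (hRmono i v _ _ (not_lt.1 h) (Nat.find_spec hex))
        simp only [Finset.mem_Ico]; omega
      refine (Finset.card_le_card hsub).trans ?_
      rw [Nat.card_Ico]; omega
    · rw [Finset.filter_false_of_mem]
      · simp
      · intro τ _ h; exact hex ⟨_, h.1⟩
  have hsum : ∑ τ ∈ Finset.range r, ∑ v ∈ Z τ, c v ≤ r * r := by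
    calc ∑ τ ∈ Finset.range r, ∑ v ∈ Z τ, c v
        ≤ ∑ τ ∈ Finset.range r, ∑ v : V, ∑ i ∈ Finset.range 6,
            (if R i v (τ + c v) ∧ ¬ R i v τ then c v else 0) := by
          refine Finset.sum_le_sum fun τ _ => ?_
          rw [Finset.sum_filter]
          refine (Finset.sum_le_univ_sum_of_nonneg (fun _ => Nat.zero_le _)).trans ?_
          refine Finset.sum_le_sum fun v _ => ?_
          split_ifs with h
          · obtain ⟨i, hi, h⟩ := h
            calc c v = (if R i v (τ + c v) ∧ ¬ R i v τ then c v else 0) := by rw [if_pos h]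
              _ ≤ _ := Finset.single_le_sum
                (f := fun i => (if R i v (τ + c v) ∧ ¬ R i v τ then c v else 0))
                (fun _ _ => Nat.zero_le _) hi
          · exact Nat.zero_le _
      _ = ∑ v : V, ∑ i ∈ Finset.range 6, ∑ τ ∈ Finset.range r,
            (if R i v (τ + c v) ∧ ¬ R i v τ then c v else 0) := by
          rw [Finset.sum_comm]
          exact Finset.sum_congr rfl fun v _ => Finset.sum_comm
      _ ≤ ∑ v : V, ∑ i ∈ Finset.range 6, c v ^ 2 := by
          refine Finset.sum_le_sum fun v _ => Finset.sum_le_sum fun i _ => ?_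
          rw [← Finset.sum_filter, Finset.sum_const, smul_eq_mul, sq]
          exact Nat.mul_le_mul_right _ (hcount i v)
      _ = 6 * ∑ v, c v ^ 2 := by
          rw [Finset.mul_sum]; simp
      _ ≤ r * r := by rw [← sq]; exact hD
  obtain ⟨τ, hτ, hτr⟩ : ∃ τ ∈ Finset.range r, ∑ v ∈ Z τ, c v ≤ r := by
    apply Finset.exists_le_of_sum_le (by simpa using hr.ne')
    simpa using hsum
  refine ⟨Z τ, Finset.filter_subset _ _, hτr, fun K hKB hKZ hK => ?_⟩
  by_contra hcon
  push Not at hcon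
  have hstep : ∀ i ∈ Finset.range 6, ∀ v ∈ K, R i v (τ + c v) → R i v τ := by
    intro i hi v hv h
    by_contra h'
    exact Finset.disjoint_left.1 hKZ hv (Finset.mem_filter.2 ⟨hKB hv, i, hi, h, h'⟩)
  have main : ∀ i ≤ 5, ∀ v ∈ K, R i v τ := by
    intro i
    induction i with
    | zero =>
      intro _ v hv
      apply hstep 0 (by simp) v hv
      exact ⟨{v}, by simpa using hKB hv, ConnS.singleton v, by simp, by simp, by simp⟩
    | succ i ih =>
      intro hi
      have ih := ih (by omega)
      have hcl : K ⊆ K.filter (fun v => R (i+1) v τ) := by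
        apply hK.subset_of_closed
        · have hi5 : i < 5 := by omega
          obtain ⟨v, hv⟩ : ∃ v, v ∈ K ∧ ((⟨i, hi5⟩ : Fin 5) ∈ J → v ∈ A ⟨i, hi5⟩) := by
            by_cases hiJ : (⟨i, hi5⟩ : Fin 5) ∈ J
            · obtain ⟨v, hv1, hv2⟩ := Finset.not_disjoint_iff.1 (hcon _ hiJ)
              exact ⟨v, hv1, fun _ => hv2⟩
            · obtain ⟨v, hv⟩ := hK.1
              exact ⟨v, hv, fun h => absurd h hiJ⟩
          refine ⟨v, Finset.mem_inter.2 ⟨hv.1, Finset.mem_filter.2 ⟨hv.1, ?_⟩⟩⟩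
          obtain ⟨T, h1, h2, h3, h4, h5⟩ := ih v hv.1
          refine ⟨T, h1, h2, h3, fun j hj hji => ?_, h5⟩
          rcases Nat.lt_succ_iff_lt_or_eq.1 hji with h | h
          · exact h4 j hj h
          · have hj' : j = ⟨i, hi5⟩ := Fin.ext h
            exact ⟨v, Finset.mem_inter.2 ⟨h3, hj' ▸ hv.2 (hj' ▸ hj)⟩⟩
        · intro u hu huS v hv huv
          refine Finset.mem_filter.2 ⟨hv, hstep _ (by simp; omega) v hv ?_⟩
          obtain ⟨T, h1, h2, h3, h4, h5⟩ := (Finset.mem_filter.1 huS).2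
          refine ⟨T ∪ {v}, Finset.union_subset h1 (by simpa using hKB hv),
            h2.union hs (ConnS.singleton v) ⟨u, h3, v, by simp, Or.inl huv⟩, by simp,
            fun j hj hji => (h4 j hj hji).mono
              (Finset.inter_subset_inter_right Finset.subset_union_left), ?_⟩
          have := Finset.sum_union_inter (s₁ := T) (s₂ := {v}) (f := c)
          simp only [Finset.sum_singleton] at this
          omega
      intro v hv
      exact (Finset.mem_filter.1 (hcl hv)).2
  obtain ⟨v, hv⟩ := hK.1
  exact hT v (hRmono 5 v τ r (by simp at hτ; omega) (main 5 le_rfl v hv))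

end Separator


section Separator2

variable {V : Type*} [Fintype V] {adj : V → V → Prop}

/-- The state in the Alon, Seymour, Thomas argument. -/
structure SepState (adj : V → V → Prop) (c w : V → ℕ) (r : ℕ) (J : Finset (Fin 5))
    (C X : Fin 5 → Finset V) (B : Finset V) : Prop where
  conn : ∀ i ∈ J, ConnS adj (C i)
  disj : ∀ i ∈ J, ∀ j ∈ J, i ≠ j → Disjoint (C i) (C j)
  nbr : ∀ i ∈ J, ∀ j ∈ J, i ≠ j → ∃ a ∈ C i, ∃ b ∈ C j, adj a b
  Xsub : ∀ i ∈ J, X i ⊆ C i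
  cost : ∀ i ∈ J, ∑ v ∈ X i, c v ≤ r
  Bconn : ConnS adj B
  heavy : ∑ v, w v < 2 * ∑ v ∈ B, w v
  BC : ∀ i ∈ J, Disjoint (C i) B
  bdry : ∀ u ∈ B, ∀ v, v ∉ B → adj u v → ∃ i ∈ J, v ∈ X i

lemma sum_biUnion_le_nat {ι α : Type*} (J : Finset ι) (X : ι → Finset α) (c : α → ℕ) :
    ∑ v ∈ J.biUnion X, c v ≤ ∑ i ∈ J, ∑ v ∈ X i, c v := by
  induction J using Finset.induction_on with
  | empty => simp
  | insert a J ha ih =>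
    rw [Finset.biUnion_insert, Finset.sum_insert ha]
    have := Finset.sum_union_inter (s₁ := X a) (s₂ := J.biUnion X) (f := c)
    omega

lemma heavy_meet (w : V → ℕ) {B B' : Finset V} (h : ∑ v, w v < 2 * ∑ v ∈ B, w v)
    (h' : ∑ v, w v < 2 * ∑ v ∈ B', w v) : (B' ∩ B).Nonempty := by
  by_contra hne
  rw [Finset.not_nonempty_iff_eq_empty, ← Finset.disjoint_iff_inter_eq_empty] at hne
  have h1 := Finset.sum_union hne (f := w)
  have h2 : ∑ v ∈ B' ∪ B, w v ≤ ∑ v, w v :=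
    Finset.sum_le_univ_sum_of_nonneg (fun _ => Nat.zero_le _)
  omega

lemma sep_contra (hs : ∀ u v, adj u v → adj v u) (hno : NoK5 adj) (c w : V → ℕ) (r : ℕ)
    (hr : 0 < r) (hD : 6 * ∑ v, c v ^ 2 ≤ r ^ 2)
    (hbad : ∀ X : Finset V, ∑ v ∈ X, c v ≤ 6 * r →
      ∃ K, ConnS adj K ∧ Disjoint K X ∧ ∑ v, w v < 2 * ∑ v ∈ K, w v) :
    ∀ N, ∀ J C X B, SepState adj c w r J C X B → 6 * B.card + J.card ≤ N → False := by
  -- maximal heavy connected sets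
  have hbad' : ∀ X : Finset V, ∑ v ∈ X, c v ≤ 6 * r →
      ∃ K, ConnS adj K ∧ Disjoint K X ∧ ∑ v, w v < 2 * ∑ v ∈ K, w v ∧
        ∀ u ∈ K, ∀ v, v ∉ K → adj u v → v ∈ X := by
    intro X hX
    obtain ⟨K, h1, h2, h3⟩ := hbad X hX
    obtain ⟨M, g1, g2, g3, g4⟩ := h1.exists_max hs (F := Xᶜ)
      (fun x hx => Finset.mem_compl.2 (Finset.disjoint_left.1 h2 hx))
    refine ⟨M, g1, ?_, ?_, ?_⟩
    · rw [Finset.disjoint_left]; intro x hx; exact Finset.mem_compl.1 (g3 hx)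
    · have := Finset.sum_le_sum_of_subset (f := w) g2
      omega
    · intro u hu v hv huv
      by_contra hvX
      exact hv (g4 u hu v (Finset.mem_compl.2 hvX) huv)
  intro N
  induction N using Nat.strong_induction_on with
  | _ N ih =>
  intro J C X B st hN
  by_cases hA : ∃ i ∈ J, ∀ a ∈ C i, ∀ b ∈ B, ¬ adj b a
  · -- drop `C i`
    obtain ⟨i, hi, hia⟩ := hA
    have hcard : (J.erase i).card + 1 = J.card := Finset.card_erase_add_one hi
    refine ih (6 * B.card + (J.erase i).card) (by omega) (J.erase i) C X B ?_ le_rfl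
    have hsub : ∀ j ∈ J.erase i, j ∈ J := fun j hj => Finset.mem_of_mem_erase hj
    refine ⟨fun j hj => st.conn j (hsub j hj),
      fun j hj k hk => st.disj j (hsub j hj) k (hsub k hk),
      fun j hj k hk => st.nbr j (hsub j hj) k (hsub k hk), fun j hj => st.Xsub j (hsub j hj),
      fun j hj => st.cost j (hsub j hj), st.Bconn, st.heavy, fun j hj => st.BC j (hsub j hj), ?_⟩
    intro u hu v hv huv
    obtain ⟨j, hj, hvj⟩ := st.bdry u hu v hv huv
    refine ⟨j, Finset.mem_erase.2 ⟨?_, hj⟩, hvj⟩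
    rintro rfl
    exact hia v (st.Xsub j hj hvj) u hu huv
  push Not at hA
  have hXcost : ∑ v ∈ J.biUnion X, c v ≤ 5 * r := by
    calc ∑ v ∈ J.biUnion X, c v ≤ ∑ i ∈ J, ∑ v ∈ X i, c v := by
          exact sum_biUnion_le_nat J X c
      _ ≤ ∑ i ∈ J, r := Finset.sum_le_sum st.cost
      _ = J.card * r := by simp
      _ ≤ 5 * r := Nat.mul_le_mul_right _ (by simpa using Finset.card_le_univ J)
  have hXB : ∀ i ∈ J, ∀ v ∈ X i, v ∉ B := fun i hi v hv =>
    Finset.disjoint_left.1 (st.BC i hi) (st.Xsub i hi hv)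
  -- heavy sets avoiding a superset of the boundary are inside B
  have hinside : ∀ K, ConnS adj K → Disjoint K (J.biUnion X) →
      ∑ v, w v < 2 * ∑ v ∈ K, w v → K ⊆ B := by
    intro K hK hKX hKw
    refine hK.subset_of_closed (heavy_meet w st.heavy hKw) ?_
    intro u _ huB v hv huv
    by_contra hvB
    obtain ⟨i, hi, hvi⟩ := st.bdry u huB v hvB huv
    exact Finset.disjoint_left.1 hKX hv (Finset.mem_biUnion.2 ⟨i, hi, hvi⟩)
  rcases cut_lemma hs c r hr hD B (fun i => B.filter (fun b => ∃ a ∈ C i, adj b a)) J with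
    ⟨T, hTB, hT, hTA, hTc⟩ | ⟨Z, hZB, hZc, hZ⟩
  · -- add T
    have hTadj : ∀ i ∈ J, ∃ t ∈ T, ∃ a ∈ C i, adj t a := by
      intro i hi
      obtain ⟨t, ht⟩ := hTA i hi
      obtain ⟨ht1, ht2⟩ := Finset.mem_inter.1 ht
      exact ⟨t, ht1, (Finset.mem_filter.1 ht2).2⟩
    obtain ⟨i, hi⟩ : ∃ i, i ∉ J := by
      by_contra hall
      push Not at hall
      exact hno ⟨C, fun i => st.conn i (hall i), fun i j => st.disj i (hall i) j (hall j),
        fun i j => st.nbr i (hall i) j (hall j)⟩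
    obtain ⟨B', h1, h2, h3, h4⟩ := hbad' (J.biUnion X ∪ T) (by
      have := Finset.sum_union_inter (s₁ := J.biUnion X) (s₂ := T) (f := c)
      omega)
    rw [Finset.disjoint_union_right] at h2
    have hB'B := hinside B' h1 h2.1 h3
    obtain ⟨t, ht⟩ := hT.1
    have hlt : B'.card < B.card := Finset.card_lt_card ⟨hB'B, fun h =>
      Finset.disjoint_left.1 h2.2 (h (hTB ht)) ht⟩
    have hJc : (insert i J).card ≤ 5 := by simpa using Finset.card_le_univ (insert i J)
    have hne : ∀ j ∈ J, j ≠ i := fun j hj h => hi (h ▸ hj)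
    refine ih (6 * B'.card + (insert i J).card) (by omega) (insert i J)
      (Function.update C i T) (Function.update X i T) B' ?_ le_rfl
    have hup : ∀ j ∈ J, Function.update C i T j = C j := fun j hj =>
      Function.update_of_ne (hne j hj) _ _
    have hupX : ∀ j ∈ J, Function.update X i T j = X j := fun j hj =>
      Function.update_of_ne (hne j hj) _ _
    have hTC : ∀ j ∈ J, Disjoint (C j) T := fun j hj => Finset.disjoint_of_subset_right hTB (st.BC j hj)
    constructor
    · intro j hj
      rcases Finset.mem_insert.1 hj with rfl | hj
      · simpa using hT
      · rw [hup j hj]; exact st.conn j hj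
    · intro j hj k hk hjk
      rcases Finset.mem_insert.1 hj with rfl | hj' <;> rcases Finset.mem_insert.1 hk with rfl | hk
      · exact absurd rfl hjk
      · rw [hup k hk, Function.update_self]; exact (hTC k hk).symm
      · rw [hup j hj', Function.update_self]; exact hTC j hj'
      · rw [hup j hj', hup k hk]; exact st.disj j hj' k hk hjk
    · intro j hj k hk hjk
      rcases Finset.mem_insert.1 hj with rfl | hj' <;> rcases Finset.mem_insert.1 hk with rfl | hk
      · exact absurd rfl hjk
      · rw [hup k hk, Function.update_self]; exact hTadj k hk
      · rw [hup j hj', Function.update_self]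
        obtain ⟨t, ht, a, ha, hta⟩ := hTadj j hj'
        exact ⟨a, ha, t, ht, hs _ _ hta⟩
      · rw [hup j hj', hup k hk]; exact st.nbr j hj' k hk hjk
    · intro j hj
      rcases Finset.mem_insert.1 hj with rfl | hj
      · simp
      · rw [hup j hj, hupX j hj]; exact st.Xsub j hj
    · intro j hj
      rcases Finset.mem_insert.1 hj with rfl | hj
      · simpa using hTc
      · rw [hupX j hj]; exact st.cost j hj
    · exact h1
    · exact h3
    · intro j hj
      rcases Finset.mem_insert.1 hj with rfl | hj
      · simpa using h2.2.symm
      · rw [hup j hj]; exact Finset.disjoint_of_subset_right hB'B (st.BC j hj)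
    · intro u hu v hv huv
      rcases Finset.mem_union.1 (h4 u hu v hv huv) with h | h
      · obtain ⟨j, hj, hvj⟩ := Finset.mem_biUnion.1 h
        exact ⟨j, Finset.mem_insert_of_mem hj, by rw [hupX j hj]; exact hvj⟩
      · exact ⟨i, Finset.mem_insert_self _ _, by simpa using h⟩
  · -- cut
    obtain ⟨B2, h1, h2, h3, h4⟩ := hbad' (J.biUnion X ∪ Z) (by
      have := Finset.sum_union_inter (s₁ := J.biUnion X) (s₂ := Z) (f := c)
      omega)
    rw [Finset.disjoint_union_right] at h2
    have hB2B := hinside B2 h1 h2.1 h3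
    obtain ⟨i, hi, hiA⟩ := hZ B2 hB2B h2.2 h1
    have hB2C : ∀ u ∈ B2, ∀ a ∈ C i, ¬ adj u a := fun u hu a ha hua =>
      Finset.disjoint_left.1 hiA hu (Finset.mem_filter.2 ⟨hB2B hu, a, ha, hua⟩)
    obtain ⟨E, hE, hCE, hEF, hEmax⟩ := (st.conn i hi).exists_max hs
      (F := C i ∪ (B \ B2)) Finset.subset_union_left
    have hB2E : Disjoint B2 E := by
      rw [Finset.disjoint_left]
      intro u hu huE
      rcases Finset.mem_union.1 (hEF huE) with h | h
      · exact Finset.disjoint_left.1 (st.BC i hi) h (hB2B hu)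
      · exact (Finset.mem_sdiff.1 h).2 hu
    obtain ⟨B', g1, g2, g3, g4⟩ := h1.exists_max hs (F := B \ E) (fun u hu =>
      Finset.mem_sdiff.2 ⟨hB2B hu, Finset.disjoint_left.1 hB2E hu⟩)
    have hB'B : B' ⊆ B := g3.trans Finset.sdiff_subset
    obtain ⟨a, ha, b, hb, hba⟩ := hA i hi
    have hbB2 : b ∉ B2 := fun h => hB2C b h a ha hba
    have hbE : b ∈ E := hEmax a (hCE ha) b
      (Finset.mem_union_right _ (Finset.mem_sdiff.2 ⟨hb, hbB2⟩)) (hs _ _ hba)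
    have hlt : B'.card < B.card := Finset.card_lt_card ⟨hB'B, fun h =>
      (Finset.mem_sdiff.1 (g3 (h hb))).2 hbE⟩
    refine ih (6 * B'.card + J.card) (by omega) J
      (Function.update C i E) (Function.update X i (E ∩ Z)) B' ?_ le_rfl
    have hup : ∀ j, j ≠ i → Function.update C i E j = C j := fun j hj =>
      Function.update_of_ne hj _ _
    have hupX : ∀ j, j ≠ i → Function.update X i (E ∩ Z) j = X j := fun j hj =>
      Function.update_of_ne hj _ _
    have hEC : ∀ j ∈ J, j ≠ i → Disjoint (C j) E := by
      intro j hj hji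
      refine Finset.disjoint_of_subset_right hEF ?_
      rw [Finset.disjoint_union_right]
      exact ⟨st.disj j hj i hi hji, Finset.disjoint_of_subset_right Finset.sdiff_subset (st.BC j hj)⟩
    constructor
    · intro j hj
      by_cases hji : j = i
      · subst hji; simpa using hE
      · rw [hup j hji]; exact st.conn j hj
    · intro j hj k hk hjk
      by_cases hji : j = i
      · subst hji
        rw [hup k hjk.symm, Function.update_self]; exact (hEC k hk hjk.symm).symm
      · by_cases hki : k = i
        · subst hki
          rw [hup j hji, Function.update_self]; exact hEC j hj hji
        · rw [hup j hji, hup k hki]; exact st.disj j hj k hk hjk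
    · intro j hj k hk hjk
      obtain ⟨x, hx, y, hy, hxy⟩ := st.nbr j hj k hk hjk
      refine ⟨x, ?_, y, ?_, hxy⟩
      · by_cases hji : j = i
        · subst hji; simpa using hCE hx
        · rw [hup j hji]; exact hx
      · by_cases hji : k = i
        · subst hji; simpa using hCE hy
        · rw [hup k hji]; exact hy
    · intro j hj
      by_cases hji : j = i
      · subst hji; simp
      · rw [hup j hji, hupX j hji]; exact st.Xsub j hj
    · intro j hj
      by_cases hji : j = i
      · subst hji
        rw [Function.update_self]
        exact (Finset.sum_le_sum_of_subset Finset.inter_subset_right).trans hZc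
      · rw [hupX j hji]; exact st.cost j hj
    · exact g1
    · have := Finset.sum_le_sum_of_subset (f := w) g2
      omega
    · intro j hj
      by_cases hji : j = i
      · subst hji
        rw [Function.update_self, Finset.disjoint_right]
        intro u hu; exact (Finset.mem_sdiff.1 (g3 hu)).2
      · rw [hup j hji]; exact Finset.disjoint_of_subset_right hB'B (st.BC j hj)
    · intro u hu v hv huv
      have huBE := Finset.mem_sdiff.1 (g3 hu)
      -- u outside B2 is not adjacent to E
      have huE : u ∉ B2 → ∀ x ∈ E, ¬ adj u x := fun hu2 x hx hux =>
        huBE.2 (hEmax x hx u (Finset.mem_union_right _ (Finset.mem_sdiff.2 ⟨huBE.1, hu2⟩)) (hs _ _ hux))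
      by_cases hvB : v ∈ B
      · have hvE : v ∈ E := by
          by_contra hvE
          exact hv (g4 u hu v (Finset.mem_sdiff.2 ⟨hvB, hvE⟩) huv)
        refine ⟨i, hi, ?_⟩
        rw [Function.update_self]
        refine Finset.mem_inter.2 ⟨hvE, ?_⟩
        by_cases hu2 : u ∈ B2
        · rcases Finset.mem_union.1 (h4 u hu2 v (fun h => Finset.disjoint_left.1 hB2E h hvE) huv)
            with h | h
          · obtain ⟨j, hj, hvj⟩ := Finset.mem_biUnion.1 h
            exact absurd hvB (hXB j hj v hvj)
          · exact h
        · exact absurd huv (huE hu2 v hvE)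
      · obtain ⟨j, hj, hvj⟩ := st.bdry u huBE.1 v hvB huv
        by_cases hji : j = i
        · subst hji
          have hvC := st.Xsub j hj hvj
          by_cases hu2 : u ∈ B2
          · exact absurd huv (hB2C u hu2 v hvC)
          · exact absurd huv (huE hu2 v (hCE hvC))
        · exact ⟨j, hj, by rw [hupX j hji]; exact hvj⟩

/-- Weighted separator theorem for graphs without a `K₅` minor. -/
theorem separator (hs : ∀ u v, adj u v → adj v u) (hno : NoK5 adj) (c w : V → ℕ) (r : ℕ)
    (hr : 0 < r) (hD : 6 * ∑ v, c v ^ 2 ≤ r ^ 2) :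
    ∃ X : Finset V, ∑ v ∈ X, c v ≤ 6 * r ∧
      ∀ K, ConnS adj K → Disjoint K X → 2 * ∑ v ∈ K, w v ≤ ∑ v, w v := by
  by_contra hcon
  push Not at hcon
  obtain ⟨K, h1, -, h3⟩ := hcon ∅ (by simp)
  obtain ⟨M, g1, g2, -, g4⟩ := h1.exists_max hs (Finset.subset_univ K)
  refine sep_contra hs hno c w r hr hD hcon (6 * M.card) ∅ (fun _ => ∅) (fun _ => ∅) M
    ⟨by simp, by simp, by simp, by simp, by simp, g1, ?_, by simp, ?_⟩ (by simp)
  · have := Finset.sum_le_sum_of_subset (f := w) g2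
    omega
  · intro u hu v hv huv
    exact absurd (g4 u hu v (Finset.mem_univ _) huv) hv

end Separator2


section Division

variable {V : Type*} {adj : V → V → Prop}

/-- The connected components of the induced graph on `F`. -/
def IsComp (adj : V → V → Prop) (F M : Finset V) : Prop :=
  ConnS adj M ∧ M ⊆ F ∧ ∀ u ∈ M, ∀ v ∈ F, adj u v → v ∈ M

/-- The finset of components. -/
noncomputable def comps (adj : V → V → Prop) (F : Finset V) : Finset (Finset V) :=
  F.powerset.filter (IsComp adj F)

lemma mem_comps {F M : Finset V} : M ∈ comps adj F ↔ IsComp adj F M := by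
  unfold comps
  rw [Finset.mem_filter, Finset.mem_powerset]
  exact ⟨fun h => h.2, fun h => ⟨h.2.1, h⟩⟩

lemma comps_disj {F M M' : Finset V} (h : M ∈ comps adj F) (h' : M' ∈ comps adj F)
    (hne : M ≠ M') : Disjoint M M' := by
  rw [mem_comps] at h h'
  by_contra hd
  rw [Finset.disjoint_iff_inter_eq_empty, ← ne_eq, ← Finset.nonempty_iff_ne_empty] at hd
  apply hne
  apply Finset.Subset.antisymm
  · exact h.1.subset_of_closed hd (fun u _ hu v hv huv => h'.2.2 u hu v (h.2.1 hv) huv)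
  · exact h'.1.subset_of_closed (by rwa [Finset.inter_comm])
      (fun u _ hu v hv huv => h.2.2 u hu v (h'.2.1 hv) huv)

lemma exists_comp (hs : ∀ u v, adj u v → adj v u) {K F : Finset V} (hK : ConnS adj K)
    (hKF : K ⊆ F) : ∃ M ∈ comps adj F, K ⊆ M := by
  obtain ⟨M, h1, h2, h3, h4⟩ := ConnS.exists_max hs hK hKF
  exact ⟨M, mem_comps.2 ⟨h1, h3, h4⟩, h2⟩

lemma comps_sum_le {F : Finset V} (T : Finset (Finset V)) (hT : T ⊆ comps adj F) (f : V → ℕ) :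
    ∑ K ∈ T, ∑ v ∈ K, f v ≤ ∑ v ∈ F, f v := by
  rw [← Finset.sum_biUnion (fun a ha b hb hab => comps_disj (hT ha) (hT hb) hab)]
  apply Finset.sum_le_sum_of_subset
  intro v hv
  rw [Finset.mem_biUnion] at hv
  obtain ⟨K, hK, hv⟩ := hv
  exact (mem_comps.1 (hT hK)).2.1 hv

variable [Fintype V]

lemma sep_on (hs : ∀ u v, adj u v → adj v u) (hno : NoK5 adj) (c w : V → ℕ) (A : Finset V) :
    ∃ X : Finset V, X ⊆ A ∧ ((∑ v ∈ X, c v : ℕ) : ℝ) ≤ 21 * √((∑ v ∈ A, c v ^ 2 : ℕ) : ℝ) ∧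
      ∀ K, ConnS adj K → K ⊆ A → Disjoint K X → 2 * ∑ v ∈ K, w v ≤ ∑ v ∈ A, w v := by
  set D : ℕ := ∑ v ∈ A, c v ^ 2 with hD
  rcases Nat.eq_zero_or_pos D with h0 | hpos
  · refine ⟨A, le_rfl, ?_, ?_⟩
    · have : ∑ v ∈ A, c v = 0 := by
        apply Finset.sum_eq_zero
        intro v hv
        have := (Finset.sum_eq_zero_iff.1 h0) v hv
        exact pow_eq_zero_iff (two_ne_zero) |>.1 this
      rw [this]; simp
    · intro K hK hKA hd
      obtain ⟨x, hx⟩ := hK.1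
      exact absurd (hKA hx) (Finset.disjoint_left.1 hd hx)
  · set r : ℕ := ⌈√(6 * (D:ℝ))⌉₊ with hr
    have hD1 : (1:ℝ) ≤ D := by exact_mod_cast hpos
    have hle : √(6 * (D:ℝ)) ≤ r := Nat.le_ceil _
    have hlt : (r:ℝ) < √(6 * (D:ℝ)) + 1 := Nat.ceil_lt_add_one (Real.sqrt_nonneg _)
    have hsp : 0 < √(6 * (D:ℝ)) := Real.sqrt_pos.2 (by linarith)
    have hr0 : 0 < r := by
      have : (0:ℝ) < r := by linarith
      exact_mod_cast this
    have hsq : 6 * D ≤ r ^ 2 := by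
      have : 6 * (D:ℝ) ≤ (r:ℝ)^2 := by
        calc 6 * (D:ℝ) = √(6 * (D:ℝ)) ^ 2 := (Real.sq_sqrt (by linarith)).symm
          _ ≤ _ := by gcongr
      exact_mod_cast this
    have e1 : ∀ (f : V → ℕ) (T : Finset V), ∑ v ∈ T, (if v ∈ A then f v else 0)
        = ∑ v ∈ T ∩ A, f v := by
      intro f T
      rw [← Finset.sum_filter, Finset.filter_mem_eq_inter]
    obtain ⟨X, hX1, hX2⟩ := separator hs hno (fun v => if v ∈ A then c v else 0)
      (fun v => if v ∈ A then w v else 0) r hr0 (by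
        have : ∀ v, (if v ∈ A then c v else 0) ^ 2 = if v ∈ A then c v ^ 2 else 0 := by
          intro v; split_ifs <;> simp
        simp only [this]
        rw [e1, Finset.univ_inter]
        exact hsq)
    rw [e1] at hX1
    refine ⟨X ∩ A, Finset.inter_subset_right, ?_, ?_⟩
    · have h1 : ((∑ v ∈ X ∩ A, c v : ℕ) : ℝ) ≤ 6 * r := by exact_mod_cast hX1
      have h2 : √(6 * (D:ℝ)) ≤ 2.45 * √(D:ℝ) := by
        rw [Real.sqrt_le_left (by positivity), mul_pow, Real.sq_sqrt (by linarith)]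
        nlinarith
      have h3 : 1 ≤ √(D:ℝ) := Real.one_le_sqrt.2 hD1
      linarith
    · intro K hK hKA hd
      have hd' : Disjoint K X := by
        rw [Finset.disjoint_left] at hd ⊢
        intro a ha hx
        exact hd ha (Finset.mem_inter.2 ⟨hx, hKA ha⟩)
      have := hX2 K hK hd'
      rw [e1, e1, Finset.univ_inter, Finset.inter_eq_left.2 hKA] at this
      exact this

theorem division (hs : ∀ u v, adj u v → adj v u) (hno : NoK5 adj) (c w : V → ℕ) (j : ℕ) :
    ∃ X : Finset V, ((∑ v ∈ X, c v : ℕ) : ℝ) ≤ 100 * √(2 ^ j * ((∑ v, c v ^ 2 : ℕ) : ℝ)) ∧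
      ∀ K, ConnS adj K → Disjoint K X → 2 ^ j * ∑ v ∈ K, w v ≤ ∑ v, w v := by
  induction j with
  | zero =>
    refine ⟨∅, by simp, ?_⟩
    intro K _ _
    simp only [pow_zero, one_mul]
    exact Finset.sum_le_sum_of_subset (Finset.subset_univ _)
  | succ j ih =>
    obtain ⟨X, hX1, hX2⟩ := ih
    choose Y hY1 hY2 hY3 using fun A => sep_on hs hno c w A
    set T := (comps adj Xᶜ).filter (fun K => ∑ v, w v < 2 ^ (j+1) * ∑ v ∈ K, w v) with hT
    have hTs : T ⊆ comps adj Xᶜ := Finset.filter_subset _ _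
    set W := ∑ v, w v with hW
    have hcard : T.card ≤ 2 ^ (j+1) := by
      by_contra hcon
      push Not at hcon
      have h1 : T.card * W ≤ ∑ K ∈ T, 2 ^ (j+1) * ∑ v ∈ K, w v := by
        rw [← smul_eq_mul, ← Finset.sum_const]
        exact Finset.sum_le_sum (fun K hK => (Finset.mem_filter.1 hK).2.le)
      rw [← Finset.mul_sum] at h1
      have h2 := comps_sum_le T hTs w
      have h3 : ∑ v ∈ Xᶜ, w v ≤ W := Finset.sum_le_sum_of_subset (Finset.subset_univ _)
      have h4 : T.card * W ≤ 2 ^ (j+1) * W := h1.trans (by gcongr; exact h2.trans h3)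
      have hWpos : W = 0 := by
        by_contra h
        exact absurd (Nat.le_of_mul_le_mul_right h4 (Nat.pos_of_ne_zero h)) (by omega)
      have hne : T.Nonempty := Finset.card_pos.1 (lt_of_le_of_lt (Nat.zero_le _) hcon)
      obtain ⟨K, hK⟩ := hne
      have h5 := (Finset.mem_filter.1 hK).2
      have h6 : ∑ v ∈ K, w v ≤ W := Finset.sum_le_sum_of_subset (Finset.subset_univ _)
      have : ∑ v ∈ K, w v = 0 := by omega
      rw [this] at h5
      simp at h5
    refine ⟨X ∪ T.biUnion Y, ?_, ?_⟩
    · set D : ℕ := ∑ v, c v ^ 2 with hD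
      have h1 : ∑ v ∈ X ∪ T.biUnion Y, c v ≤ ∑ v ∈ X, c v + ∑ K ∈ T, ∑ v ∈ Y K, c v := by
        have := Finset.sum_union_inter (s₁ := X) (s₂ := T.biUnion Y) (f := c)
        have h2 := sum_biUnion_le_nat T Y c
        omega
      have h1' : ((∑ v ∈ X ∪ T.biUnion Y, c v : ℕ) : ℝ) ≤ ((∑ v ∈ X, c v : ℕ):ℝ)
          + ∑ K ∈ T, ((∑ v ∈ Y K, c v : ℕ):ℝ) := by exact_mod_cast h1
      have h2 : ∑ K ∈ T, ((∑ v ∈ Y K, c v : ℕ):ℝ) ≤ 21 * ∑ K ∈ T, √((∑ v ∈ K, c v ^ 2 : ℕ) : ℝ) := by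
        rw [Finset.mul_sum]
        exact Finset.sum_le_sum (fun K _ => hY2 K)
      have h3 : ∑ K ∈ T, √((∑ v ∈ K, c v ^ 2 : ℕ) : ℝ) ≤ √(2 ^ (j+1) * (D:ℝ)) := by
        apply Real.le_sqrt_of_sq_le
        refine (sq_sum_le_card_mul_sum_sq).trans ?_
        have : ∀ K ∈ T, √((∑ v ∈ K, c v ^ 2 : ℕ) : ℝ) ^ 2 = ((∑ v ∈ K, c v ^ 2 : ℕ) : ℝ) :=
          fun K _ => Real.sq_sqrt (Nat.cast_nonneg _)
        rw [Finset.sum_congr rfl this]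
        have h4 := comps_sum_le T hTs (fun v => c v ^ 2)
        have h5 : ∑ v ∈ Xᶜ, c v ^ 2 ≤ D := Finset.sum_le_sum_of_subset (Finset.subset_univ _)
        have h6 : T.card * ∑ K ∈ T, ∑ v ∈ K, c v ^ 2 ≤ 2 ^ (j+1) * D :=
          Nat.mul_le_mul hcard (h4.trans h5)
        exact_mod_cast h6
      have h7 : √(2 ^ (j+1) * (D:ℝ)) = √2 * √(2 ^ j * (D:ℝ)) := by
        rw [← Real.sqrt_mul (by norm_num)]
        congr 1; ring
      have h8 : 1.4 ≤ √(2:ℝ) := by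
        apply Real.le_sqrt_of_sq_le; norm_num
      have h9 := Real.sqrt_nonneg (2 ^ j * (D:ℝ))
      have h10 : 100 * √(2 ^ j * (D:ℝ)) + 21 * √(2 ^ (j+1) * (D:ℝ)) ≤ 100 * √(2 ^ (j+1) * (D:ℝ)) := by
        rw [h7]; nlinarith
      linarith
    · intro K hK hd
      have hdX : K ⊆ Xᶜ := by
        intro v hv
        rw [Finset.mem_compl]
        intro hx
        exact Finset.disjoint_left.1 hd hv (Finset.mem_union_left _ hx)
      obtain ⟨M, hM, hKM⟩ := exists_comp hs hK hdX
      have hKM' : ∑ v ∈ K, w v ≤ ∑ v ∈ M, w v := Finset.sum_le_sum_of_subset hKM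
      by_cases hMT : M ∈ T
      · have h1 := hY3 M K hK hKM (by
          rw [Finset.disjoint_left] at hd ⊢
          intro a ha hx
          exact hd ha (Finset.mem_union_right _ (Finset.mem_biUnion.2 ⟨M, hMT, hx⟩)))
        have h2 := hX2 M (mem_comps.1 hM).1 (by
          rw [Finset.disjoint_left]
          intro a ha hx
          exact (Finset.mem_compl.1 ((mem_comps.1 hM).2.1 ha)) hx)
        calc 2 ^ (j+1) * ∑ v ∈ K, w v = 2 ^ j * (2 * ∑ v ∈ K, w v) := by ring
          _ ≤ 2 ^ j * ∑ v ∈ M, w v := by gcongr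
          _ ≤ _ := h2
      · have : ¬ (W < 2 ^ (j+1) * ∑ v ∈ M, w v) := fun h => hMT (Finset.mem_filter.2 ⟨hM, h⟩)
        push Not at this
        exact le_trans (by gcongr) this

end Division


section Regularity

lemma density_le_of_filter {α : Type*} (G : SimpleGraph α) (A W : Finset α) (θ : ℝ)
    (hθ : 0 ≤ θ)
    (h : ∀ y ∈ A, ((W.filter (G.Adj y)).card : ℝ) ≤ θ * W.card) :
    ((G.edgeDensity A W : ℚ) : ℝ) ≤ θ := by
  rw [← SimpleGraph.card_interedges_div_card]
  push_cast
  apply div_le_of_le_mul₀ (by positivity) hθ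
  have : (G.interedges A W).card = ∑ y ∈ A, (W.filter (G.Adj y)).card := by
    rw [SimpleGraph.interedges_def, Finset.card_filter, Finset.sum_product]
    apply Finset.sum_congr rfl
    intro y _
    rw [Finset.card_filter]
  rw [this]
  push_cast
  calc ∑ y ∈ A, ((W.filter (G.Adj y)).card : ℝ) ≤ ∑ y ∈ A, θ * W.card :=
        Finset.sum_le_sum h
    _ = _ := by rw [Finset.sum_const, nsmul_eq_mul]; ring

lemma greedy_embed {α : Type*} [Nonempty α] (G : SimpleGraph α) (s : ℕ) (d η : ℝ)
    (hd : 0 < d) (hd1 : d ≤ 1) (hη : η = (d/2)^s / (2*s)) (V : ℕ → Finset α)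
    (bad : α → α → Finset α) (hbad : ∀ a b, (bad a b).card ≤ s)
    (hV : ∀ i < s, 2 * (s:ℝ)^3 < (d/2)^s * (V i).card)
    (hu : ∀ i < s, ∀ j < s, i ≠ j → G.IsUniform η (V i) (V j))
    (hden : ∀ i < s, ∀ j < s, i ≠ j → d ≤ ((G.edgeDensity (V i) (V j) : ℚ) : ℝ)) :
    ∀ m ≤ s, ∃ (x : ℕ → α) (W : ℕ → Finset α),
      (∀ i < m, ∀ j < i, G.Adj (x j) (x i)) ∧
      (∀ k < m, ∀ i < k, ∀ j < k, x k ∉ bad (x i) (x j)) ∧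
      (∀ j, m ≤ j → j < s → W j ⊆ V j ∧ (d/2)^m * (V j).card ≤ ((W j).card : ℝ) ∧
        ∀ i < m, ∀ y ∈ W j, G.Adj (x i) y) := by
  intro m
  induction m with
  | zero =>
    intro _
    refine ⟨fun _ => Classical.arbitrary α, V, by simp, by simp, ?_⟩
    intro j _ _
    simp
  | succ m ih =>
    intro hm
    obtain ⟨x, W, h1, h2, h3⟩ := ih (by omega)
    have hs : (1:ℝ) ≤ s := by exact_mod_cast (by omega : 1 ≤ s)
    set β := (d/2)^s with hβ
    have hβpos : 0 < β := by positivity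
    have hβm : ∀ k ≤ s, β ≤ (d/2)^k := fun k hk =>
      pow_le_pow_of_le_one (by linarith) (by linarith) hk
    have hηpos : 0 < η := by rw [hη]; positivity
    have hηβ : η ≤ β / 2 := by
      rw [hη]
      apply div_le_div_of_nonneg_left hβpos.le (by norm_num) (by linarith)
    have hsη : s * η = β / 2 := by
      rw [hη]; field_simp
    have hηd : η ≤ d / 2 := by
      have := hβm 1 (by omega)
      rw [pow_one] at this
      linarith
    obtain ⟨hWV, hWc, hWa⟩ := h3 m le_rfl (by omega)
    set At : ℕ → Finset α := fun j => (W m).filter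
      (fun y => (((W j).filter (G.Adj y)).card : ℝ) < (d/2) * (W j).card) with hAt
    have hAtc : ∀ j, m < j → j < s → ((At j).card : ℝ) < η * (V m).card := by
      intro j hmj hjs
      by_contra hcon
      push Not at hcon
      obtain ⟨g1, g2, g3⟩ := h3 j hmj.le hjs
      have hV0 : (0:ℝ) ≤ (V j).card := Nat.cast_nonneg _
      have := hu m (by omega) j hjs hmj.ne ((Finset.filter_subset _ _).trans hWV) g1
        (by rw [mul_comm]; exact hcon) (by
          have := hβm m (by omega)
          calc ((V j).card : ℝ) * η ≤ (V j).card * (d/2)^m := by gcongr; linarith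
            _ = (d/2)^m * (V j).card := mul_comm _ _
            _ ≤ _ := g2)
      have e := density_le_of_filter G (At j) (W j) (d/2) (by linarith) (by
        intro y hy
        exact (Finset.mem_filter.1 hy).2.le)
      have e2 := hden m (by omega) j hjs hmj.ne
      rw [abs_lt] at this
      linarith [this.1]
    set U := (Finset.Ioo m s).biUnion At ∪
      (Finset.range m ×ˢ Finset.range m).biUnion (fun p => bad (x p.1) (x p.2)) with hU
    have hUc : (U.card : ℝ) < (W m).card := by
      have a1 : (((Finset.Ioo m s).biUnion At).card : ℝ) ≤ s * (η * (V m).card) := by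
        calc (((Finset.Ioo m s).biUnion At).card : ℝ) ≤ ∑ j ∈ Finset.Ioo m s, ((At j).card : ℝ) := by
              exact_mod_cast Finset.card_biUnion_le
          _ ≤ ∑ j ∈ Finset.Ioo m s, η * (V m).card := by
              apply Finset.sum_le_sum
              intro j hj
              rw [Finset.mem_Ioo] at hj
              exact (hAtc j hj.1 hj.2).le
          _ = ((Finset.Ioo m s).card : ℝ) * (η * (V m).card) := by
              rw [Finset.sum_const, nsmul_eq_mul]
          _ ≤ _ := by
              gcongr
              rw [Nat.card_Ioo]; omega
      have a2 : (((Finset.range m ×ˢ Finset.range m).biUnion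
          (fun p => bad (x p.1) (x p.2))).card : ℝ) ≤ (s:ℝ)^3 := by
        have b1 := Finset.card_biUnion_le_card_mul (Finset.range m ×ˢ Finset.range m)
          (fun p => bad (x p.1) (x p.2)) s (fun p _ => hbad _ _)
        rw [Finset.card_product, Finset.card_range] at b1
        have b2 : m * m * s ≤ s ^ 3 := by
          have : m ≤ s := by omega
          calc m * m * s ≤ s * s * s := by gcongr
            _ = s ^ 3 := by ring
        exact_mod_cast b1.trans b2
      have a3 : (U.card : ℝ) ≤ s * (η * (V m).card) + (s:ℝ)^3 := by
        have : (U.card : ℝ) ≤ (((Finset.Ioo m s).biUnion At).card : ℝ) +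
          (((Finset.range m ×ˢ Finset.range m).biUnion (fun p => bad (x p.1) (x p.2))).card : ℝ) := by
          exact_mod_cast Finset.card_union_le _ _
        linarith
      rw [← mul_assoc, hsη] at a3
      have a4 := hV m (by omega)
      have a5 : β * (V m).card ≤ (W m).card := by
        refine le_trans ?_ hWc
        gcongr
        exact hβm m (by omega)
      linarith
    obtain ⟨y, hyW, hyU⟩ := Finset.exists_mem_notMem_of_card_lt_card (by exact_mod_cast hUc :
      U.card < (W m).card)
    rw [hU, Finset.mem_union, not_or] at hyU
    obtain ⟨hy1, hy2⟩ := hyU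
    have hx : ∀ i, i < m → Function.update x m y i = x i := fun i hi =>
      Function.update_of_ne hi.ne _ _
    have hxm : Function.update x m y m = y := Function.update_self _ _ _
    refine ⟨Function.update x m y, fun j => (W j).filter (G.Adj y), ?_, ?_, ?_⟩
    · intro i hi j hj
      rcases Nat.lt_succ_iff_lt_or_eq.1 hi with h | h
      · rw [hx i h, hx j (by omega)]; exact h1 i h j hj
      · subst h
        rw [hxm, hx j hj]
        exact hWa j hj y hyW
    · intro k hk i hi j hj
      rcases Nat.lt_succ_iff_lt_or_eq.1 hk with h | h
      · rw [hx k h, hx i (by omega), hx j (by omega)]; exact h2 k h i hi j hj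
      · subst h
        rw [hxm, hx i hi, hx j hj]
        intro hb
        apply hy2
        rw [Finset.mem_biUnion]
        exact ⟨(i, j), by simp [hi, hj], hb⟩
    · intro j hmj hjs
      obtain ⟨g1, g2, g3⟩ := h3 j (by omega) hjs
      refine ⟨(Finset.filter_subset _ _).trans g1, ?_, ?_⟩
      · have : ¬ (((W j).filter (G.Adj y)).card : ℝ) < (d/2) * (W j).card := by
          intro hlt
          apply hy1
          rw [Finset.mem_biUnion]
          exact ⟨j, Finset.mem_Ioo.2 ⟨by omega, hjs⟩, Finset.mem_filter.2 ⟨hyW, hlt⟩⟩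
        push Not at this
        refine le_trans ?_ this
        rw [pow_succ, mul_comm _ (d/2), mul_assoc]
        gcongr
      · intro i hi z hz
        rw [Finset.mem_filter] at hz
        rcases Nat.lt_succ_iff_lt_or_eq.1 hi with h | h
        · rw [hx i h]; exact g3 i h z hz.1
        · subst h; rw [hxm]; exact hz.2

end Regularity


section Regularity2

theorem blocks_embed (s : ℕ) (hs : 2 ≤ s) (δ : ℝ) (hδ : 0 < δ) :
    ∃ N0 : ℕ, ∀ (α : Type) [Fintype α] (BB : Finset (Finset α)),
      (∀ B ∈ BB, B.card = s) →
      (∀ B ∈ BB, ∀ B' ∈ BB, ∀ a b, a ≠ b → a ∈ B → b ∈ B → a ∈ B' → b ∈ B' → B = B') →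
      N0 ≤ Fintype.card α → δ * (Fintype.card α : ℝ) ^ 2 ≤ BB.card →
      ∃ S : Finset α, S.card = s ∧
        (∀ a ∈ S, ∀ b ∈ S, a ≠ b → ∃ B ∈ BB, a ∈ B ∧ b ∈ B) ∧
        (∀ B ∈ BB, ∀ a ∈ S, ∀ b ∈ S, ∀ c ∈ S, a ≠ b → a ≠ c → b ≠ c →
          a ∈ B → b ∈ B → c ∉ B) := by
  set d : ℝ := min 1 (δ / 16) with hd
  have hd0 : 0 < d := lt_min one_pos (by linarith)
  have hd1 : d ≤ 1 := min_le_left _ _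
  have hdδ : d ≤ δ / 16 := min_le_right _ _
  set η : ℝ := (d/2)^s / (2*s) with hη
  have hs1 : (2:ℝ) ≤ s := by exact_mod_cast hs
  have hβ0 : 0 < (d/2)^s := by positivity
  have hη0 : 0 < η := by rw [hη]; positivity
  have hβd : (d/2)^s ≤ d/2 := by
    calc (d/2)^s ≤ (d/2)^1 := pow_le_pow_of_le_one (by linarith) (by linarith) (by omega)
      _ = _ := pow_one _
  have hηd : η ≤ d := by
    rw [hη]
    apply div_le_of_le_mul₀ (by positivity) hd0.le
    nlinarith
  set l : ℕ := ⌈4 / δ⌉₊ with hl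
  set b : ℕ := SzemerediRegularity.bound η l with hb
  have hb0 : 0 < b := SzemerediRegularity.bound_pos _ _
  set M : ℝ := 2 * (s:ℝ)^3 / (d/2)^s + 1 with hM
  refine ⟨max (max l 1) ⌈2 * b * M⌉₊, ?_⟩
  intro α _ BB hcard hlin hN hmany
  have hN1 : l ≤ Fintype.card α := le_trans (le_trans (le_max_left _ _) (le_max_left _ _)) hN
  have hN2 : 1 ≤ Fintype.card α := le_trans (le_trans (le_max_right _ _) (le_max_left _ _)) hN
  have hN3 : 2 * b * M ≤ Fintype.card α :=
    (Nat.le_ceil _).trans (by exact_mod_cast le_trans (le_max_right _ _) hN)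
  have : Nonempty α := Fintype.card_pos_iff.1 hN2
  obtain ⟨G, hadj⟩ : ∃ G : SimpleGraph α,
      ∀ x y, G.Adj x y ↔ x ≠ y ∧ ∃ B ∈ BB, x ∈ B ∧ y ∈ B := by
    refine ⟨SimpleGraph.fromRel (fun x y => ∃ B ∈ BB, x ∈ B ∧ y ∈ B), ?_⟩
    intro x y
    rw [SimpleGraph.fromRel_adj]
    constructor
    · rintro ⟨h, ⟨B, hB, h1, h2⟩ | ⟨B, hB, h1, h2⟩⟩
      · exact ⟨h, B, hB, h1, h2⟩
      · exact ⟨h, B, hB, h2, h1⟩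
    · rintro ⟨h, h'⟩
      exact ⟨h, Or.inl h'⟩
  obtain ⟨P, hP1, hP2, hP3, hP4⟩ := szemeredi_regularity G hη0 hN1
  set A1 := (P.nonUniforms G η).biUnion (fun (U, V) => U ×ˢ V) with hA1
  set A2 := P.parts.biUnion Finset.offDiag with hA2
  set A3 := (P.sparsePairs G d).biUnion (fun (U, V) => G.interedges U V) with hA3
  have hA1c : (A1.card : ℝ) < 4 * η * (Fintype.card α : ℝ)^2 :=
    hP1.sum_nonUniforms_lt Finset.univ_nonempty hη0 hP4
  have hA2c : (A2.card : ℝ) ≤ δ / 2 * (Fintype.card α : ℝ)^2 :=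
    hP1.card_biUnion_offDiag_le hδ ((Nat.le_ceil _).trans (by exact_mod_cast hP2))
  have hA3c : (A3.card : ℝ) ≤ 4 * d * (Fintype.card α : ℝ)^2 :=
    hP1.card_interedges_sparsePairs_le hd0.le
  have hAc : ((A1 ∪ A2 ∪ A3).card : ℝ) < δ * (Fintype.card α : ℝ)^2 := by
    have u1 : ((A1 ∪ A2 ∪ A3).card : ℝ) ≤ A1.card + A2.card + A3.card := by
      have := Finset.card_union_le (A1 ∪ A2) A3
      have := Finset.card_union_le A1 A2
      norm_cast; omega
    have : 0 ≤ (Fintype.card α : ℝ)^2 := sq_nonneg _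
    nlinarith
  have key : ∃ B ∈ BB, ∀ x ∈ B, ∀ y ∈ B, x ≠ y → (x, y) ∉ A1 ∪ A2 ∪ A3 := by
    by_contra hcon
    push Not at hcon
    choose! f h1 g h2 h3 h4 using hcon
    have : BB.card ≤ (A1 ∪ A2 ∪ A3).card := by
      apply Finset.card_le_card_of_injOn (fun B => (f B, g B)) (fun B hB => h4 B hB)
      intro B hB B' hB' heq
      simp only [Prod.mk.injEq] at heq
      exact hlin B hB B' hB' (f B) (g B) (h3 B hB) (h1 B hB) (h2 B hB)
        (heq.1 ▸ h1 B' hB') (heq.2 ▸ h2 B' hB')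
    have : (BB.card : ℝ) ≤ ((A1 ∪ A2 ∪ A3).card : ℝ) := by exact_mod_cast this
    linarith
  obtain ⟨B, hB, hgood⟩ := key
  have e : Fin s ≃ B := (Fintype.equivFinOfCardEq (by rw [Fintype.card_coe, hcard B hB])).symm
  set v : ℕ → α := fun i => if h : i < s then (e ⟨i, h⟩ : α) else Classical.arbitrary α with hv
  have hvB : ∀ i < s, v i ∈ B := by
    intro i hi
    simp only [hv, dif_pos hi]
    exact (e _).2
  have hvne : ∀ i < s, ∀ j < s, i ≠ j → v i ≠ v j := by
    intro i hi j hj hij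
    simp only [hv, dif_pos hi, dif_pos hj]
    intro h
    have := e.injective (Subtype.ext h)
    simp only [Fin.mk.injEq] at this
    exact hij this
  have hpm : ∀ i, P.part (v i) ∈ P.parts := fun i => P.part_mem.2 (Finset.mem_univ _)
  have hvp : ∀ i, v i ∈ P.part (v i) := fun i => P.mem_part (Finset.mem_univ _)
  have hfacts : ∀ i < s, ∀ j < s, i ≠ j → G.IsUniform η (P.part (v i)) (P.part (v j)) ∧
      d ≤ ((G.edgeDensity (P.part (v i)) (P.part (v j)) : ℚ) : ℝ) := by
    intro i hi j hj hij
    have hg := hgood _ (hvB i hi) _ (hvB j hj) (hvne i hi j hj hij)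
    rw [Finset.mem_union, Finset.mem_union, not_or, not_or] at hg
    obtain ⟨⟨g1, g2⟩, g3⟩ := hg
    have hne : P.part (v i) ≠ P.part (v j) := by
      intro heq
      apply g2
      rw [hA2, Finset.mem_biUnion]
      exact ⟨P.part (v i), hpm i, Finset.mem_offDiag.2 ⟨hvp i, heq ▸ hvp j, hvne i hi j hj hij⟩⟩
    constructor
    · by_contra hnu
      apply g1
      rw [hA1, Finset.mem_biUnion]
      exact ⟨(P.part (v i), P.part (v j)), (P.mk_mem_nonUniforms G).2 ⟨hpm i, hpm j, hne, hnu⟩,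
        Finset.mem_product.2 ⟨hvp i, hvp j⟩⟩
    · by_contra hnd
      push Not at hnd
      apply g3
      rw [hA3, Finset.mem_biUnion]
      refine ⟨(P.part (v i), P.part (v j)), (P.mk_mem_sparsePairs G _ _ _).2 ⟨hpm i, hpm j, hne, hnd⟩,
        ?_⟩
      exact (G.mk_mem_interedges_iff).2 ⟨hvp i, hvp j, (hadj _ _).2
        ⟨hvne i hi j hj hij, B, hB, hvB i hi, hvB j hj⟩⟩
  have hsize : ∀ i, M ≤ ((P.part (v i)).card : ℝ) := by
    intro i
    have h1 : Fintype.card α / P.parts.card ≤ (P.part (v i)).card := by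
      have := hP1.average_le_card_part (hpm i)
      rwa [Finset.card_univ] at this
    have hpp : 0 < P.parts.card := Finset.card_pos.2 ⟨_, hpm i⟩
    have h2 : P.parts.card ≤ Fintype.card α := by
      have := P.card_parts_le_card
      rwa [Finset.card_univ] at this
    have h3 : Fintype.card α ≤ 2 * b * (P.part (v i)).card := by
      have m1 := Nat.div_add_mod (Fintype.card α) P.parts.card
      have m2 := Nat.mod_lt (Fintype.card α) hpp
      have m3 : 1 ≤ Fintype.card α / P.parts.card := (Nat.one_le_div_iff hpp).2 h2
      calc Fintype.card α ≤ 2 * (P.parts.card * (Fintype.card α / P.parts.card)) := by nlinarith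
        _ ≤ 2 * (b * (P.part (v i)).card) := by gcongr
        _ = _ := by ring
    have h4 : (Fintype.card α : ℝ) ≤ 2 * b * ((P.part (v i)).card : ℝ) := by exact_mod_cast h3
    have hbp : (0:ℝ) < 2 * b := by positivity
    exact le_of_mul_le_mul_left (hN3.trans h4) hbp
  have hex : ∀ a c : α, ∃ T : Finset α, T.card ≤ s ∧
      ∀ B ∈ BB, a ≠ c → a ∈ B → c ∈ B → B = T := by
    intro a c
    by_cases h : a ≠ c ∧ ∃ B ∈ BB, a ∈ B ∧ c ∈ B
    · obtain ⟨hne, B, hB, h1, h2⟩ := h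
      exact ⟨B, (hcard B hB).le, fun B' hB' _ g1 g2 => hlin B' hB' B hB a c hne g1 g2 h1 h2⟩
    · exact ⟨∅, by simp, fun B hB hne h1 h2 => absurd ⟨hne, B, hB, h1, h2⟩ h⟩
  choose bad hbad1 hbad2 using hex
  obtain ⟨x, W, hx1, hx2, -⟩ := greedy_embed G s d η hd0 hd1 hη (fun i => P.part (v i)) bad hbad1
    (by
      intro i _
      have := hsize i
      rw [hM] at this
      have h2 : 2 * (s:ℝ)^3 / (d/2)^s < ((P.part (v i)).card : ℝ) := by linarith
      rw [div_lt_iff₀ hβ0] at h2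
      linarith)
    (fun i hi j hj hij => (hfacts i hi j hj hij).1)
    (fun i hi j hj hij => (hfacts i hi j hj hij).2) s le_rfl
  have hxadj : ∀ i < s, ∀ j < s, i ≠ j → G.Adj (x i) (x j) := by
    intro i hi j hj hij
    rcases lt_or_gt_of_ne hij with h | h
    · exact hx1 j hj i h
    · exact (hx1 i hi j h).symm
  refine ⟨(Finset.range s).image x, ?_, ?_, ?_⟩
  · rw [Finset.card_image_of_injOn, Finset.card_range]
    intro i hi j hj hij
    by_contra hne
    simp only [Finset.coe_range, Set.mem_Iio] at hi hj
    exact (hxadj i hi j hj hne).ne hij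
  · intro a ha c hc hac
    rw [Finset.mem_image] at ha hc
    obtain ⟨i, hi, rfl⟩ := ha
    obtain ⟨j, hj, rfl⟩ := hc
    rw [Finset.mem_range] at hi hj
    exact ((hadj _ _).1 (hxadj i hi j hj (fun h => hac (by rw [h])))).2
  · intro B hB a ha c hc e he hac hae hce haB hcB heB
    rw [Finset.mem_image] at ha hc he
    obtain ⟨i, hi, rfl⟩ := ha
    obtain ⟨j, hj, rfl⟩ := hc
    obtain ⟨k, hk, rfl⟩ := he
    rw [Finset.mem_range] at hi hj hk
    have claim : ∀ p q r, r < s → p < r → q < r → x p ≠ x q → x p ∈ B → x q ∈ B → x r ∈ B → False := by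
      intro p q r hr hp hq hne h1 h2 h3
      apply hx2 r hr p hp q hq
      rw [← hbad2 _ _ B hB hne h1 h2]
      exact h3
    have n1 : i ≠ j := fun h => hac (by rw [h])
    have n2 : i ≠ k := fun h => hae (by rw [h])
    have n3 : j ≠ k := fun h => hce (by rw [h])
    by_cases c1 : i < k ∧ j < k
    · exact claim i j k hk c1.1 c1.2 hac haB hcB heB
    by_cases c2 : i < j ∧ k < j
    · exact claim i k j hj c2.1 c2.2 hae haB heB hcB
    · exact claim j k i hi (by omega) (by omega) hce hcB heB haB

end Regularity2


section LemmaR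

lemma exists_blocks {β : Type*} (s : ℕ) (hs : 0 < s) (n : ℕ) : ∀ T : Finset β, T.card = n →
    ∃ F : Finset (Finset β), (∀ B ∈ F, B ⊆ T ∧ B.card = s) ∧
      (∀ B ∈ F, ∀ B' ∈ F, B ≠ B' → Disjoint B B') ∧ T.card ≤ s * F.card + s := by
  induction n using Nat.strong_induction_on with
  | _ n ih =>
    intro T hT
    by_cases h : T.card ≤ s
    · exact ⟨∅, by simp, by simp, by simpa using h⟩
    · push Not at h
      obtain ⟨B, hBT, hBc⟩ := Finset.exists_subset_card_eq h.le
      have hc : (T \ B).card = n - s := by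
        rw [Finset.card_sdiff_of_subset hBT, hT, hBc]
      obtain ⟨F, h1, h2, h3⟩ := ih (n - s) (by omega) (T \ B) hc
      have hBd : ∀ B' ∈ F, Disjoint B B' := by
        intro B' hB'
        exact Finset.disjoint_of_subset_right (h1 B' hB').1 Finset.disjoint_sdiff
      have hBF : B ∉ F := by
        intro hB
        have := hBd B hB
        rw [disjoint_self, Finset.bot_eq_empty] at this
        rw [this] at hBc
        simp at hBc
        omega
      refine ⟨insert B F, ?_, ?_, ?_⟩
      · intro B' hB'
        rcases Finset.mem_insert.1 hB' with rfl | hB'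
        · exact ⟨hBT, hBc⟩
        · exact ⟨(h1 B' hB').1.trans Finset.sdiff_subset, (h1 B' hB').2⟩
      · intro B1 hB1 B2 hB2 hne
        rcases Finset.mem_insert.1 hB1 with e1 | m1 <;>
        rcases Finset.mem_insert.1 hB2 with e2 | m2
        · exact absurd (e1.trans e2.symm) hne
        · rw [e1]; exact hBd _ m2
        · rw [e2]; exact (hBd _ m1).symm
        · exact h2 _ m1 _ m2 hne
      · rw [Finset.card_insert_of_notMem hBF, mul_add, mul_one]
        omega

lemma blocks_embed_finset (s : ℕ) (hs : 2 ≤ s) (δ : ℝ) (hδ : 0 < δ) :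
    ∃ N0 : ℕ, ∀ (Q : Finset (ℝ × ℝ)) (BB : Finset (Finset (ℝ × ℝ))),
      (∀ B ∈ BB, B ⊆ Q ∧ B.card = s) →
      (∀ B ∈ BB, ∀ B' ∈ BB, ∀ a b, a ≠ b → a ∈ B → b ∈ B → a ∈ B' → b ∈ B' → B = B') →
      N0 ≤ Q.card → δ * (Q.card : ℝ) ^ 2 ≤ BB.card →
      ∃ S : Finset (ℝ × ℝ), S ⊆ Q ∧ S.card = s ∧
        (∀ a ∈ S, ∀ b ∈ S, a ≠ b → ∃ B ∈ BB, a ∈ B ∧ b ∈ B) ∧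
        (∀ B ∈ BB, ∀ a ∈ S, ∀ b ∈ S, ∀ c ∈ S, a ≠ b → a ≠ c → b ≠ c →
          a ∈ B → b ∈ B → c ∉ B) := by
  obtain ⟨N0, hN0⟩ := blocks_embed s hs δ hδ
  refine ⟨N0, ?_⟩
  intro Q BB h1 h2 h3 h4
  have hinj : Set.InjOn (fun B : Finset (ℝ × ℝ) => B.subtype (· ∈ Q)) BB := by
    intro B hB B' hB' heq
    ext x
    have := Finset.ext_iff.1 heq
    simp only [Finset.mem_subtype, Subtype.forall] at this
    constructor
    · intro hx; exact (this x ((h1 B hB).1 hx)).1 hx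
    · intro hx; exact (this x ((h1 B' hB').1 hx)).2 hx
  obtain ⟨S, g1, g2, g3⟩ := hN0 Q (BB.image (fun B => B.subtype (· ∈ Q)))
    (by
      intro B1 hB1
      obtain ⟨B, hB, rfl⟩ := Finset.mem_image.1 hB1
      rw [Finset.card_subtype, Finset.filter_true_of_mem (fun x hx => (h1 B hB).1 hx)]
      exact (h1 B hB).2)
    (by
      intro B1 hB1 B2 hB2 a b hab ha hb ha' hb'
      obtain ⟨B, hB, rfl⟩ := Finset.mem_image.1 hB1
      obtain ⟨B', hB', rfl⟩ := Finset.mem_image.1 hB2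
      rw [Finset.mem_subtype] at ha hb ha' hb'
      rw [h2 B hB B' hB' a b (fun h => hab (Subtype.ext h)) ha hb ha' hb'])
    (by rw [Fintype.card_coe]; exact h3)
    (by rw [Fintype.card_coe, Finset.card_image_of_injOn hinj]; exact h4)
  have hmem : ∀ a, a ∈ S.map (Function.Embedding.subtype _) → ∃ h : a ∈ Q, (⟨a, h⟩ : Q) ∈ S := by
    intro a ha
    simp only [Finset.mem_map, Function.Embedding.subtype_apply, Subtype.exists, exists_and_right,
      exists_eq_right] at ha
    exact ha
  refine ⟨S.map (Function.Embedding.subtype _), ?_, by rw [Finset.card_map, g1], ?_, ?_⟩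
  · intro a ha
    exact (hmem a ha).1
  · intro a ha b hb hab
    obtain ⟨qa, ha⟩ := hmem a ha
    obtain ⟨qb, hb⟩ := hmem b hb
    obtain ⟨B1, hB1, k1, k2⟩ := g2 _ ha _ hb (fun h => hab (congrArg Subtype.val h))
    obtain ⟨B, hB, rfl⟩ := Finset.mem_image.1 hB1
    rw [Finset.mem_subtype] at k1 k2
    exact ⟨B, hB, k1, k2⟩
  · intro B hB a ha b hb c hc hab hac hbc k1 k2 k3
    obtain ⟨qa, ha⟩ := hmem a ha
    obtain ⟨qb, hb⟩ := hmem b hb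
    obtain ⟨qc, hc⟩ := hmem c hc
    refine g3 _ (Finset.mem_image_of_mem _ hB) _ ha _ hb _ hc (fun h => hab (congrArg Subtype.val h))
      (fun h => hac (congrArg Subtype.val h)) (fun h => hbc (congrArg Subtype.val h)) ?_ ?_ ?_ <;>
    rw [Finset.mem_subtype] <;> assumption

lemma curve_unique {C : Finset (Set (ℝ × ℝ))}
    (hC : ∀ γ ∈ C, ∀ γ' ∈ C, γ ≠ γ' → (γ ∩ γ').Finite ∧ (γ ∩ γ').ncard ≤ 1)
    {γ γ' : Set (ℝ × ℝ)} (h : γ ∈ C) (h' : γ' ∈ C) {a b : ℝ × ℝ} (hab : a ≠ b)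
    (ha : a ∈ γ) (hb : b ∈ γ) (ha' : a ∈ γ') (hb' : b ∈ γ') : γ = γ' := by
  by_contra hne
  obtain ⟨h1, h2⟩ := hC γ h γ' h' hne
  exact hab ((Set.ncard_le_one h1).1 h2 a ⟨ha, ha'⟩ b ⟨hb, hb'⟩)

theorem lemmaR (s : ℕ) (hs : 2 < s) (δ : ℝ) (hδ : 0 < δ) :
    ∃ m0 : ℕ, ∀ (Q : Finset (ℝ × ℝ)) (C : Finset (Set (ℝ × ℝ))),
      (∀ γ ∈ C, ∀ γ' ∈ C, γ ≠ γ' → (γ ∩ γ').Finite ∧ (γ ∩ γ').ncard ≤ 1) →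
      ¬ ContainsConfig Q C s 1 →
      ((∑ γ ∈ C, (Q.filter (fun p => p ∈ γ)).card : ℕ) : ℝ) ≤
        s * ((C.filter (fun γ => ∃ x ∈ Q, x ∈ γ)).card : ℝ) + δ * (Q.card : ℝ)^2 + m0 * Q.card := by
  have hs0 : (0:ℝ) < s := by exact_mod_cast (by omega : 0 < s)
  obtain ⟨N0, hN0⟩ := blocks_embed_finset s (by omega) (δ / s) (by positivity)
  refine ⟨s * N0, ?_⟩
  intro Q C hC hno
  choose F hF1 hF2 hF3 using fun γ : Set (ℝ × ℝ) =>
    exists_blocks s (by omega) _ (Q.filter (fun p => p ∈ γ)) rfl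
  have hFQ : ∀ γ, ∀ B ∈ F γ, ∀ x ∈ B, x ∈ Q ∧ x ∈ γ := fun γ B hB x hx =>
    Finset.mem_filter.1 ((hF1 γ B hB).1 hx)
  have hlin : ∀ γ ∈ C, ∀ B ∈ F γ, ∀ γ' ∈ C, ∀ B' ∈ F γ', ∀ a b, a ≠ b → a ∈ B → b ∈ B →
      a ∈ B' → b ∈ B' → γ = γ' ∧ B = B' := by
    intro γ hγ B hB γ' hγ' B' hB' a b hab ha hb ha' hb'
    have : γ = γ' := curve_unique hC hγ hγ' hab (hFQ γ B hB a ha).2 (hFQ γ B hB b hb).2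
      (hFQ γ' B' hB' a ha').2 (hFQ γ' B' hB' b hb').2
    subst this
    refine ⟨rfl, ?_⟩
    by_contra hne
    exact Finset.disjoint_left.1 (hF2 γ B hB B' hB' hne) ha ha'
  have htwo : ∀ γ, ∀ B ∈ F γ, ∃ a ∈ B, ∃ b ∈ B, a ≠ b := fun γ B hB =>
    Finset.one_lt_card.1 (by rw [(hF1 γ B hB).2]; omega)
  set BB := C.biUnion F with hBB
  have hBBc : BB.card = ∑ γ ∈ C, (F γ).card := by
    apply Finset.card_biUnion
    intro γ hγ γ' hγ' hne
    rw [Function.onFun, Finset.disjoint_left]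
    intro B hB hB'
    obtain ⟨a, ha, b, hb, hab⟩ := htwo γ B hB
    exact hne (hlin γ hγ B hB γ' hγ' B hB' a b hab ha hb ha hb).1
  have hBBs : BB.card ≤ Q.card ^ 2 := by
    have htwo' : ∀ B ∈ BB, ∃ a ∈ B, ∃ b ∈ B, a ≠ b := by
      intro B hB
      obtain ⟨γ, _, hB⟩ := Finset.mem_biUnion.1 hB
      exact htwo γ B hB
    choose! f h1 g h2 h3 using htwo'
    rw [sq, ← Finset.card_product]
    apply Finset.card_le_card_of_injOn (fun B => (f B, g B))
    · intro B hB
      obtain ⟨γ, _, hB'⟩ := Finset.mem_biUnion.1 hB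
      exact Finset.mem_product.2 ⟨(hFQ γ B hB' _ (h1 B hB)).1, (hFQ γ B hB' _ (h2 B hB)).1⟩
    · intro B hB B' hB' heq
      simp only [Prod.mk.injEq] at heq
      obtain ⟨γ, hγ, hBγ⟩ := Finset.mem_biUnion.1 hB
      obtain ⟨γ', hγ', hBγ'⟩ := Finset.mem_biUnion.1 hB'
      exact (hlin γ hγ B hBγ γ' hγ' B' hBγ' (f B) (g B) (h3 B hB) (h1 B hB) (h2 B hB)
        (heq.1 ▸ h1 B' hB') (heq.2 ▸ h2 B' hB')).2
  have hbound : (BB.card : ℝ) ≤ δ / s * (Q.card:ℝ)^2 + N0 * Q.card := by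
    by_cases hQ : N0 ≤ Q.card
    · by_contra hcon
      push Not at hcon
      have hpos : (0:ℝ) ≤ N0 * Q.card := by positivity
      obtain ⟨S, hSQ, hSc, hS1, hS2⟩ := hN0 Q BB
        (by
          intro B hB
          obtain ⟨γ, _, hB'⟩ := Finset.mem_biUnion.1 hB
          exact ⟨fun x hx => (hFQ γ B hB' x hx).1, (hF1 γ B hB').2⟩)
        (by
          intro B hB B' hB' a b hab ha hb ha' hb'
          obtain ⟨γ, hγ, hBγ⟩ := Finset.mem_biUnion.1 hB
          obtain ⟨γ', hγ', hBγ'⟩ := Finset.mem_biUnion.1 hB'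
          exact (hlin γ hγ B hBγ γ' hγ' B' hBγ' a b hab ha hb ha' hb').2)
        hQ (by linarith)
      apply hno
      have hφ : ∀ T ∈ S.powersetCard 2, ∃ γ ∈ C, ∃ B ∈ F γ, T ⊆ B := by
        intro T hT
        rw [Finset.mem_powersetCard] at hT
        obtain ⟨a, b, hab, rfl⟩ := Finset.card_eq_two.1 hT.2
        obtain ⟨B, hB, h1, h2⟩ := hS1 a (hT.1 (by simp)) b (hT.1 (by simp)) hab
        obtain ⟨γ, hγ, hB'⟩ := Finset.mem_biUnion.1 hB
        refine ⟨γ, hγ, B, hB', ?_⟩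
        intro x hx
        rcases Finset.mem_insert.1 hx with rfl | hx
        · exact h1
        · rw [Finset.mem_singleton] at hx; subst hx; exact h2
      choose! φ p1 B p2 p3 using hφ
      refine ⟨S, hSQ, hSc, φ, ?_, ?_⟩
      · intro T hT T' hT' heq
        by_contra hne
        have hT := Finset.mem_coe.1 hT
        have hT' := Finset.mem_coe.1 hT'
        have mT := Finset.mem_powersetCard.1 hT
        have mT' := Finset.mem_powersetCard.1 hT'
        have hnsub : ∃ c ∈ T', c ∉ T := by
          by_contra hcon
          push Not at hcon
          exact hne (Finset.eq_of_subset_of_card_le hcon (by rw [mT.2, mT'.2])).symm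
        obtain ⟨c, hc, hcT⟩ := hnsub
        obtain ⟨a, b, hab, hTab⟩ := Finset.card_eq_two.1 mT.2
        have haT : a ∈ T := by rw [hTab]; simp
        have hbT : b ∈ T := by rw [hTab]; simp
        have hac : a ≠ c := fun h => hcT (h ▸ haT)
        have hbc : b ≠ c := fun h => hcT (h ▸ hbT)
        by_cases hBB' : B T = B T'
        · exact hS2 (B T) (Finset.mem_biUnion.2 ⟨φ T, p1 T hT, p2 T hT⟩) a (mT.1 haT) b (mT.1 hbT)
            c (mT'.1 hc) hab hac hbc (p3 T hT haT) (p3 T hT hbT) (hBB' ▸ p3 T' hT' hc)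
        · obtain ⟨B2, hB2, k1, k2⟩ := hS1 a (mT.1 haT) c (mT'.1 hc) hac
          obtain ⟨γ, hγ, hB2⟩ := Finset.mem_biUnion.1 hB2
          have hγe : γ = φ T := by
            refine curve_unique hC hγ (p1 T hT) hac (hFQ γ B2 hB2 a k1).2 (hFQ γ B2 hB2 c k2).2
              (hFQ _ _ (p2 T hT) a (p3 T hT haT)).2 ?_
            rw [heq]
            exact (hFQ _ _ (p2 T' hT') c (p3 T' hT' hc)).2
          subst hγe
          have e1 : B2 = B T := by
            by_contra hh
            exact Finset.disjoint_left.1 (hF2 _ _ hB2 _ (p2 T hT) hh) k1 (p3 T hT haT)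
          have e2 : B2 = B T' := by
            by_contra hh
            exact Finset.disjoint_left.1 (hF2 _ _ hB2 _ (heq ▸ p2 T' hT') hh) k2 (p3 T' hT' hc)
          exact hBB' (e1.symm.trans e2)
      · intro T hT
        refine ⟨p1 T hT, ?_⟩
        intro x hx
        exact (hFQ _ _ (p2 T hT) x (p3 T hT hx)).2
    · push Not at hQ
      have h1 : (BB.card : ℝ) ≤ (Q.card : ℝ)^2 := by exact_mod_cast hBBs
      have h2 : (Q.card : ℝ) ≤ N0 := by exact_mod_cast hQ.le
      have h3 : (0:ℝ) ≤ δ / s * (Q.card:ℝ)^2 := by positivity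
      have h4 : (0:ℝ) ≤ Q.card := Nat.cast_nonneg _
      nlinarith
  have hsum : ∑ γ ∈ C, (Q.filter (fun p => p ∈ γ)).card ≤
      s * BB.card + s * (C.filter (fun γ => ∃ x ∈ Q, x ∈ γ)).card := by
    rw [hBBc, Finset.card_filter, Finset.mul_sum, Finset.mul_sum, ← Finset.sum_add_distrib]
    apply Finset.sum_le_sum
    intro γ _
    split_ifs with h
    · rw [mul_one]; exact hF3 γ
    · have : Q.filter (fun p => p ∈ γ) = ∅ := by
        rw [Finset.filter_eq_empty_iff]
        intro x hx hxγ
        exact h ⟨x, hx, hxγ⟩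
      rw [this]; simp
  have hsum' : ((∑ γ ∈ C, (Q.filter (fun p => p ∈ γ)).card : ℕ) : ℝ) ≤
      s * (BB.card:ℝ) + s * ((C.filter (fun γ => ∃ x ∈ Q, x ∈ γ)).card : ℝ) := by exact_mod_cast hsum
  have h5 : s * (BB.card : ℝ) ≤ δ * (Q.card:ℝ)^2 + s * N0 * Q.card := by
    calc s * (BB.card : ℝ) ≤ s * (δ / s * (Q.card:ℝ)^2 + N0 * Q.card) := by gcongr
      _ = _ := by field_simp
  push_cast at *
  linarith

end LemmaR


section Drawing

/-- A family of parametrised curves together with a finite vertex set containing all crossings. -/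
structure Drawing (C : Finset (Set (ℝ × ℝ))) (V : Finset (ℝ × ℝ))
    (f : Set (ℝ × ℝ) → ℝ → ℝ × ℝ) : Prop where
  cont : ∀ γ ∈ C, Continuous (f γ)
  inj : ∀ γ ∈ C, Set.InjOn (f γ) (Set.Icc 0 1)
  img : ∀ γ ∈ C, f γ '' Set.Icc 0 1 = γ
  cross : ∀ γ ∈ C, ∀ γ' ∈ C, γ ≠ γ' → ∀ p ∈ γ, p ∈ γ' → p ∈ V

/-- `[a,b]` is a piece of the curve `g` between two consecutive vertices. -/
structure Piece (V : Finset (ℝ × ℝ)) (g : ℝ → ℝ × ℝ) (a b : ℝ) : Prop where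
  h0 : 0 ≤ a
  hab : a < b
  h1 : b ≤ 1
  clean : ∀ r, a < r → r < b → g r ∉ V

variable {C : Finset (Set (ℝ × ℝ))} {V : Finset (ℝ × ℝ)} {f : Set (ℝ × ℝ) → ℝ → ℝ × ℝ}

/-- Adjacency in the arrangement graph. -/
def arrAdj (C : Finset (Set (ℝ × ℝ))) (V : Finset (ℝ × ℝ)) (f : Set (ℝ × ℝ) → ℝ → ℝ × ℝ)
    (u v : V) : Prop :=
  ∃ γ ∈ C, ∃ a b, Piece V (f γ) a b ∧
    ((f γ a = u ∧ f γ b = v) ∨ (f γ a = v ∧ f γ b = u))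

lemma arrAdj_symm (u v : V) (h : arrAdj C V f u v) : arrAdj C V f v u := by
  obtain ⟨γ, hγ, a, b, hp, h⟩ := h
  exact ⟨γ, hγ, a, b, hp, h.symm⟩

/-- The subset of the plane realising a set of vertices. -/
def realiz (C : Finset (Set (ℝ × ℝ))) (f : Set (ℝ × ℝ) → ℝ → ℝ × ℝ) (K : Finset V) :
    Set (ℝ × ℝ) :=
  {p | (∃ u ∈ K, p = (u : ℝ × ℝ)) ∨ ∃ γ ∈ C, ∃ a b, Piece V (f γ) a b ∧
    (∃ u ∈ K, f γ a = (u : ℝ × ℝ)) ∧ (∃ u ∈ K, f γ b = (u : ℝ × ℝ)) ∧ p ∈ f γ '' Set.Icc a b}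

lemma Piece.endpoint {g : ℝ → ℝ × ℝ} {a b r : ℝ} (h : Piece V g a b) (hr : r ∈ Set.Icc a b)
    (hv : g r ∈ V) : r = a ∨ r = b := by
  by_contra hcon
  push Not at hcon
  exact h.clean r (lt_of_le_of_ne hr.1 (Ne.symm hcon.1)) (lt_of_le_of_ne hr.2 hcon.2) hv

lemma realiz_vertex {K : Finset V} {p : ℝ × ℝ} (hp : p ∈ realiz C f K) (hv : p ∈ V) :
    (⟨p, hv⟩ : V) ∈ K := by
  rcases hp with ⟨u, hu, rfl⟩ | ⟨γ, hγ, a, b, hpc, ⟨u, hu, hau⟩, ⟨v, hv', hbv⟩, r, hr, rfl⟩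
  · exact hu
  · rcases hpc.endpoint hr hv with rfl | rfl
    · have : (⟨f γ r, hv⟩ : V) = u := Subtype.ext hau
      rw [this]; exact hu
    · have : (⟨f γ r, hv⟩ : V) = v := Subtype.ext hbv
      rw [this]; exact hv'

lemma realiz_disj (hD : Drawing C V f) {K K' : Finset V} (hd : Disjoint K K') {p : ℝ × ℝ}
    (hp : p ∈ realiz C f K) (hp' : p ∈ realiz C f K') : False := by
  by_cases hv : p ∈ V
  · exact Finset.disjoint_left.1 hd (realiz_vertex hp hv) (realiz_vertex hp' hv)
  · rcases hp with ⟨u, hu, rfl⟩ | ⟨γ, hγ, a, b, hpc, ⟨u, hu, hau⟩, ⟨v, hv', hbv⟩, r, hr, hrp⟩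
    · exact hv u.2
    rcases hp' with ⟨u', hu', rfl⟩ | ⟨γ', hγ', a', b', hpc', ⟨u', hu', hau'⟩, ⟨w, hw, hbw⟩, r', hr', hrp'⟩
    · exact hv u'.2
    have i1 : r ∈ Set.Icc (0:ℝ) 1 := ⟨hpc.h0.trans hr.1, hr.2.trans hpc.h1⟩
    have i2 : r' ∈ Set.Icc (0:ℝ) 1 := ⟨hpc'.h0.trans hr'.1, hr'.2.trans hpc'.h1⟩
    by_cases hγγ : γ = γ'
    · subst hγγ
      have hrr : r = r' := hD.inj γ hγ i1 i2 (hrp.trans hrp'.symm)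
      subst hrr
      rcases le_total a a' with h | h
      · -- the point a' lies in [a,b]
        have hm : a' ∈ Set.Icc a b := ⟨h, hr'.1.trans hr.2⟩
        rcases hpc.endpoint hm (by rw [hau']; exact u'.2) with e | e
        · rw [e, hau] at hau'
          exact Finset.disjoint_left.1 hd hu ((Subtype.ext hau') ▸ hu')
        · rw [e, hbv] at hau'
          exact Finset.disjoint_left.1 hd hv' ((Subtype.ext hau') ▸ hu')
      · have hm : a ∈ Set.Icc a' b' := ⟨h, hr.1.trans hr'.2⟩
        rcases hpc'.endpoint hm (by rw [hau]; exact u.2) with e | e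
        · rw [e, hau'] at hau
          exact Finset.disjoint_left.1 hd hu ((Subtype.ext hau) ▸ hu')
        · rw [e, hbw] at hau
          exact Finset.disjoint_left.1 hd hu ((Subtype.ext hau) ▸ hw)
    · apply hv
      apply hD.cross γ hγ γ' hγ' hγγ
      · rw [← hD.img γ hγ]; exact ⟨r, i1, hrp⟩
      · rw [← hD.img γ' hγ']; exact ⟨r', i2, hrp'⟩

lemma realiz_joined (hD : Drawing C V f) {K : Finset V} (hK : ConnS (arrAdj C V f) K)
    {u v : V} (hu : u ∈ K) (hv : v ∈ K) : JoinedIn (realiz C f K) (u : ℝ × ℝ) v := by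
  have hmem : ∀ w ∈ K, (w : ℝ × ℝ) ∈ realiz C f K := fun w hw => Or.inl ⟨w, hw, rfl⟩
  have := hK.2 (K.filter (fun w => JoinedIn (realiz C f K) (u : ℝ × ℝ) w))
    (Finset.filter_subset _ _) ⟨u, Finset.mem_filter.2 ⟨hu, JoinedIn.refl (hmem u hu)⟩⟩ (by
      intro x hx y hy hxy
      rw [Finset.mem_filter] at hx ⊢
      refine ⟨hy, hx.2.trans ?_⟩
      obtain ⟨γ, hγ, a, b, hp, h⟩ := hxy
      have hpc : IsPathConnected (f γ '' Set.Icc a b) :=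
        ((convex_Icc a b).isPathConnected ⟨a, le_rfl, hp.hab.le⟩).image (hD.cont γ hγ)
      have ha : f γ a ∈ f γ '' Set.Icc a b := ⟨a, ⟨le_rfl, hp.hab.le⟩, rfl⟩
      have hb : f γ b ∈ f γ '' Set.Icc a b := ⟨b, ⟨hp.hab.le, le_rfl⟩, rfl⟩
      rcases h with ⟨h1, h2⟩ | ⟨h1, h2⟩
      · rw [← h1, ← h2]
        exact (hpc.joinedIn _ ha _ hb).mono
          (fun p hpp => Or.inr ⟨γ, hγ, a, b, hp, ⟨x, hx.1, h1⟩, ⟨y, hy, h2⟩, hpp⟩)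
      · rw [← h1, ← h2]
        exact (hpc.joinedIn _ hb _ ha).mono
          (fun p hpp => Or.inr ⟨γ, hγ, a, b, hp, ⟨y, hy, h1⟩, ⟨x, hx.1, h2⟩, hpp⟩))
  rw [← this] at hv
  exact (Finset.mem_filter.1 hv).2

theorem arr_noK5 (hD : Drawing C V f) : NoK5 (arrAdj C V f) := by
  rintro ⟨K, hK1, hK2, hK3⟩
  choose v hv using fun i => (hK1 i).1
  have hconn : ∀ i j, i < j → ConnS (arrAdj C V f) (K i ∪ K j) := by
    intro i j hij
    obtain ⟨a, ha, b, hb, hab⟩ := hK3 i j hij.ne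
    convert ConnS.union arrAdj_symm (hK1 i) (hK1 j) ⟨a, ha, b, hb, Or.inl hab⟩
  have hj : ∀ i j, i < j → JoinedIn (realiz C f (K i ∪ K j)) (v i : ℝ × ℝ) (v j) := fun i j hij =>
    realiz_joined hD (hconn i j hij) (Finset.mem_union_left _ (hv i)) (Finset.mem_union_right _ (hv j))
  have hex : ∀ i j, ∃ e : ℝ → ℝ × ℝ, i < j → Continuous e ∧ e 0 = v i ∧ e 1 = v j ∧
      ∀ x, e x ∈ realiz C f (K i ∪ K j) := by
    intro i j
    by_cases hij : i < j
    · refine ⟨(hj i j hij).somePath.extend, fun _ => ⟨Path.continuous_extend _, by simp, by simp, ?_⟩⟩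
      intro x
      exact (hj i j hij).somePath_mem _
    · exact ⟨fun _ => 0, fun h => absurd h hij⟩
  choose e he using hex
  refine K5_nonplanar (fun i => Complex.equivRealProdCLM.symm (v i))
    (fun i j x => Complex.equivRealProdCLM.symm (e i j x)) ?_ ?_ ?_ ?_
  · intro i j hij
    exact Complex.equivRealProdCLM.symm.continuous.comp (he i j hij).1
  · intro i j hij
    simp only [(he i j hij).2.1]
  · intro i j hij
    simp only [(he i j hij).2.2.1]
  · intro i j k l hij hkl h1 h2 h3 h4 x y hxy
    have := Complex.equivRealProdCLM.symm.injective hxy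
    have m1 := (he i j hij).2.2.2 x
    have m2 := (he k l hkl).2.2.2 y
    rw [← this] at m2
    refine realiz_disj hD ?_ m1 m2
    rw [Finset.disjoint_union_left, Finset.disjoint_union_right, Finset.disjoint_union_right]
    exact ⟨⟨hK2 _ _ h1, hK2 _ _ h2⟩, ⟨hK2 _ _ h3, hK2 _ _ h4⟩⟩

lemma times_exist (hD : Drawing C V f) {γ : Set (ℝ × ℝ)} (hγ : γ ∈ C) :
    ∃ T : Finset ℝ, ∀ t, t ∈ T ↔ t ∈ Set.Icc (0:ℝ) 1 ∧ f γ t ∈ V := by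
  have hfin : (Set.Icc (0:ℝ) 1 ∩ f γ ⁻¹' (V : Set (ℝ × ℝ))).Finite := by
    apply Set.Finite.of_finite_image (f := f γ)
    · apply V.finite_toSet.subset
      rintro _ ⟨t, ht, rfl⟩
      exact ht.2
    · exact (hD.inj γ hγ).mono Set.inter_subset_left
  refine ⟨hfin.toFinset, fun t => ?_⟩
  simp

theorem comps_meet (hD : Drawing C V f) (X F : Finset V) (hF : ∀ x, x ∉ X → x ∈ F) {γ : Set (ℝ × ℝ)} (hγ : γ ∈ C) :
    ((comps (arrAdj C V f) F).filter (fun M : Finset V => ∃ u ∈ M, (u : ℝ × ℝ) ∈ γ)).card ≤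
      (X.filter (fun u : V => (u : ℝ × ℝ) ∈ γ)).card + 1 := by
  obtain ⟨T, hT⟩ := times_exist hD hγ
  -- the last time at which the curve visits a component
  have hlast : ∀ M ∈ (comps (arrAdj C V f) F).filter (fun M : Finset V => ∃ u ∈ M, (u : ℝ × ℝ) ∈ γ),
      ∃ t ∈ T, (∃ u ∈ M, f γ t = (u : ℝ × ℝ)) ∧ ∀ t' ∈ T, t < t' → ∀ u' ∈ M, f γ t' ≠ (u' : ℝ × ℝ) := by
    intro M hM
    obtain ⟨hM1, u, hu, huγ⟩ := Finset.mem_filter.1 hM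
    rw [← hD.img γ hγ] at huγ
    obtain ⟨t0, ht0, ht0u⟩ := huγ
    have hne : (T.filter (fun t => ∃ u ∈ M, f γ t = (u : ℝ × ℝ))).Nonempty :=
      ⟨t0, Finset.mem_filter.2 ⟨(hT t0).2 ⟨ht0, ht0u ▸ u.2⟩, u, hu, ht0u⟩⟩
    obtain ⟨t, ht, hmax⟩ := Finset.exists_max_image _ id hne
    obtain ⟨htT, w, hw, htw⟩ := Finset.mem_filter.1 ht
    refine ⟨t, htT, ⟨w, hw, htw⟩, ?_⟩
    intro t' ht' hlt u' hu' h
    exact absurd (hmax t' (Finset.mem_filter.2 ⟨ht', u', hu', h⟩)) (not_le.2 hlt)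
  choose! t htT htu htl using hlast
  -- the successor
  have hnext : ∀ M ∈ (comps (arrAdj C V f) F).filter (fun M : Finset V => ∃ u ∈ M, (u : ℝ × ℝ) ∈ γ),
      ∃ o : Option V, o ∈ insert none ((X.filter (fun u : V => (u : ℝ × ℝ) ∈ γ)).image some) ∧
        ((o = none ∧ ∀ t' ∈ T, t' ≤ t M) ∨ ∃ x, o = some x ∧ ∃ t1 ∈ T, f γ t1 = (x : ℝ × ℝ) ∧
          t M < t1 ∧ ∀ t' ∈ T, t M < t' → t1 ≤ t') := by
    intro M hM
    by_cases hne : (T.filter (fun t' => t M < t')).Nonempty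
    · obtain ⟨t1, ht1, hmin⟩ := Finset.exists_min_image _ id hne
      obtain ⟨ht1T, hlt⟩ := Finset.mem_filter.1 ht1
      have hmin' : ∀ t' ∈ T, t M < t' → t1 ≤ t' := fun t' h1 h2 =>
        hmin t' (Finset.mem_filter.2 ⟨h1, h2⟩)
      have g1 := (hT t1).1 ht1T
      have g0 := (hT (t M)).1 (htT M hM)
      set x : V := ⟨f γ t1, g1.2⟩ with hx
      have hxM : x ∉ M := by
        intro h
        exact htl M hM t1 ht1T hlt x h rfl
      obtain ⟨uM, huM, htu⟩ := htu M hM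
      have hadj : arrAdj C V f uM x := by
        refine ⟨γ, hγ, t M, t1, ⟨g0.1.1, hlt, g1.1.2, ?_⟩, Or.inl ⟨htu, rfl⟩⟩
        intro r hr1 hr2 hrV
        have : r ∈ T := (hT r).2 ⟨⟨g0.1.1.trans hr1.le, hr2.le.trans g1.1.2⟩, hrV⟩
        exact absurd (hmin' r this hr1) (not_le.2 hr2)
      have hxX : x ∈ X := by
        by_contra hxX
        exact hxM ((mem_comps.1 (Finset.mem_filter.1 hM).1).2.2 _ huM x
          (hF x hxX) hadj)
      refine ⟨some x, ?_, Or.inr ⟨x, rfl, t1, ht1T, rfl, hlt, hmin'⟩⟩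
      apply Finset.mem_insert_of_mem
      apply Finset.mem_image_of_mem
      refine Finset.mem_filter.2 ⟨hxX, ?_⟩
      have : (x : ℝ × ℝ) ∈ f γ '' Set.Icc 0 1 := ⟨t1, g1.1, rfl⟩
      rwa [hD.img γ hγ] at this
    · refine ⟨none, Finset.mem_insert_self _ _, Or.inl ⟨rfl, ?_⟩⟩
      intro t' ht'
      by_contra hcon
      push Not at hcon
      exact hne ⟨t', Finset.mem_filter.2 ⟨ht', hcon⟩⟩
  choose! o ho1 ho2 using hnext
  have hcard : (insert none ((X.filter (fun u : V => (u : ℝ × ℝ) ∈ γ)).image some)).card ≤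
      (X.filter (fun u : V => (u : ℝ × ℝ) ∈ γ)).card + 1 :=
    (Finset.card_insert_le _ _).trans (Nat.add_le_add_right Finset.card_image_le 1)
  refine le_trans (Finset.card_le_card_of_injOn o ho1 ?_) hcard
  intro M hM M' hM' heq
  rw [Finset.mem_coe] at hM hM'
  have htt : t M = t M' := by
    rcases ho2 M hM with ⟨e1, h1⟩ | ⟨x, e1, t1, k1, k2, k3, k4⟩ <;>
    rcases ho2 M' hM' with ⟨e2, h2⟩ | ⟨x', e2, t2, l1, l2, l3, l4⟩
    · exact le_antisymm (h2 _ (htT M hM)) (h1 _ (htT M' hM'))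
    · rw [heq, e2] at e1; cases e1
    · rw [← heq, e1] at e2; cases e2
    · rw [heq, e2] at e1
      have hxx : x' = x := Option.some.inj e1
      have h12 : t1 = t2 := hD.inj γ hγ ((hT _).1 k1).1 ((hT _).1 l1).1 (by rw [k2, l2, hxx])
      subst h12
      rcases lt_trichotomy (t M) (t M') with h | h | h
      · exact absurd (k4 _ (htT M' hM') h) (not_le.2 l3)
      · exact h
      · exact absurd (l4 _ (htT M hM) h) (not_le.2 k3)
  by_contra hne
  obtain ⟨a, haM, hta⟩ := htu M hM
  obtain ⟨b, hbM, htb⟩ := htu M' hM'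
  have huu : a = b := Subtype.ext (by rw [← hta, ← htb, htt])
  exact Finset.disjoint_left.1 (comps_disj (Finset.mem_filter.1 hM).1 (Finset.mem_filter.1 hM').1 hne)
    haM (huu ▸ hbM)

end Drawing


section Final

lemma exists_drawing (P : Finset (ℝ × ℝ)) (C : Finset (Set (ℝ × ℝ))) (hC : KIntersecting C 1) :
    ∃ (V : Finset (ℝ × ℝ)) (f : Set (ℝ × ℝ) → ℝ → ℝ × ℝ), Drawing C V f ∧ P ⊆ V ∧
      ∀ γ ∈ C, (V.filter (fun p => p ∈ γ)).card ≤ P.card + C.card := by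
  obtain ⟨hC1, hC2⟩ := hC
  have hf : ∀ γ : Set (ℝ × ℝ), ∃ g : ℝ → ℝ × ℝ, γ ∈ C → Continuous g ∧
      Set.InjOn g (Set.Icc 0 1) ∧ g '' Set.Icc 0 1 = γ := by
    intro γ
    by_cases hγ : γ ∈ C
    · obtain ⟨g, g1, g2, g3⟩ := hC1 γ hγ
      refine ⟨Set.IccExtend zero_le_one g, fun _ => ⟨g1.Icc_extend', ?_, ?_⟩⟩
      · intro a ha b hb hab
        rw [Set.IccExtend_of_mem _ _ ha, Set.IccExtend_of_mem _ _ hb] at hab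
        exact congrArg Subtype.val (g2 hab)
      · rw [g3]
        ext p
        constructor
        · rintro ⟨a, ha, rfl⟩
          rw [Set.IccExtend_of_mem _ _ ha]
          exact ⟨_, rfl⟩
        · rintro ⟨a, rfl⟩
          exact ⟨a, a.2, by rw [Set.IccExtend_of_mem _ _ a.2]⟩
    · exact ⟨fun _ => 0, fun h => absurd h hγ⟩
  choose f hf using hf
  have hI : ∀ γ γ' : Set (ℝ × ℝ), ∃ T : Finset (ℝ × ℝ), γ ∈ C → γ' ∈ C → γ ≠ γ' →
      T.card ≤ 1 ∧ ∀ p, p ∈ T ↔ p ∈ γ ∧ p ∈ γ' := by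
    intro γ γ'
    by_cases h : γ ∈ C ∧ γ' ∈ C ∧ γ ≠ γ'
    · obtain ⟨h1, h2⟩ := hC2 γ h.1 γ' h.2.1 h.2.2
      refine ⟨h1.toFinset, fun _ _ _ => ⟨?_, fun p => ?_⟩⟩
      · rw [← Set.ncard_eq_toFinset_card _ h1]; exact h2
      · simp
    · exact ⟨∅, fun h1 h2 h3 => absurd ⟨h1, h2, h3⟩ h⟩
  choose T hT using hI
  refine ⟨P ∪ C.offDiag.biUnion (fun q => T q.1 q.2), f, ⟨fun γ hγ => (hf γ hγ).1,
    fun γ hγ => (hf γ hγ).2.1, fun γ hγ => (hf γ hγ).2.2, ?_⟩, Finset.subset_union_left, ?_⟩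
  · intro γ hγ γ' hγ' hne p hp hp'
    apply Finset.mem_union_right
    rw [Finset.mem_biUnion]
    exact ⟨(γ, γ'), Finset.mem_offDiag.2 ⟨hγ, hγ', hne⟩, ((hT γ γ' hγ hγ' hne).2 p).2 ⟨hp, hp'⟩⟩
  · intro γ hγ
    have hsub : (P ∪ C.offDiag.biUnion (fun q => T q.1 q.2)).filter (fun p => p ∈ γ) ⊆
        P ∪ (C.erase γ).biUnion (fun γ' => T γ γ') := by
      intro p hp
      rw [Finset.mem_filter, Finset.mem_union] at hp
      obtain ⟨hp | hp, hpγ⟩ := hp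
      · exact Finset.mem_union_left _ hp
      · apply Finset.mem_union_right
        rw [Finset.mem_biUnion] at hp ⊢
        obtain ⟨⟨a, b⟩, hab, hpT⟩ := hp
        obtain ⟨ha, hb, hne⟩ := Finset.mem_offDiag.1 hab
        have hpab := ((hT a b ha hb hne).2 p).1 hpT
        by_cases haγ : a = γ
        · have hbγ : b ≠ γ := fun h => hne (haγ.trans h.symm)
          exact ⟨b, Finset.mem_erase.2 ⟨hbγ, hb⟩, ((hT γ b hγ hb hbγ.symm).2 p).2 ⟨hpγ, hpab.2⟩⟩
        · exact ⟨a, Finset.mem_erase.2 ⟨haγ, ha⟩,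
            ((hT γ a hγ ha (Ne.symm haγ)).2 p).2 ⟨hpγ, hpab.1⟩⟩
    refine (Finset.card_le_card hsub).trans ((Finset.card_union_le _ _).trans ?_)
    apply Nat.add_le_add_left
    have := Finset.card_biUnion_le_card_mul (C.erase γ) (fun γ' => T γ γ') 1 (by
      intro γ' hγ'
      obtain ⟨h1, h2⟩ := Finset.mem_erase.1 hγ'
      exact (hT γ γ' hγ h2 h1.symm).1)
    rw [mul_one] at this
    exact this.trans (Finset.card_le_card (Finset.erase_subset _ _))

lemma sum_incid {α : Type*} (X : Finset α) (C : Finset (Set (ℝ × ℝ))) (g : α → ℝ × ℝ) :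
    ∑ v ∈ X, (C.filter (fun γ => g v ∈ γ)).card = ∑ γ ∈ C, (X.filter (fun v => g v ∈ γ)).card := by
  simp_rw [Finset.card_filter]
  exact Finset.sum_comm

lemma sum_sq_le (C : Finset (Set (ℝ × ℝ))) (V : Finset (ℝ × ℝ)) (n : ℕ) (hn : C.card = n)
    (hC : ∀ γ ∈ C, ∀ γ' ∈ C, γ ≠ γ' → (γ ∩ γ').Finite ∧ (γ ∩ γ').ncard ≤ 1)
    (hV : ∀ γ ∈ C, (V.filter (fun p => p ∈ γ)).card ≤ n + n) :
    ∑ v : V, (C.filter (fun γ => (v : ℝ × ℝ) ∈ γ)).card ^ 2 ≤ 3 * n ^ 2 := by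
  have h1 : ∀ v : V, (C.filter (fun γ => (v : ℝ × ℝ) ∈ γ)).card ^ 2 =
      ∑ q ∈ C ×ˢ C, if (v : ℝ × ℝ) ∈ q.1 ∧ (v : ℝ × ℝ) ∈ q.2 then 1 else 0 := by
    intro v
    rw [sq, ← Finset.card_product, ← Finset.card_filter]
    congr 1
    ext ⟨a, b⟩
    simp only [Finset.mem_product, Finset.mem_filter]
    tauto
  rw [Finset.sum_congr rfl (fun v _ => h1 v), Finset.sum_comm, Finset.sum_product]
  have h2 : ∀ γ ∈ C, ∀ γ' ∈ C, (∑ v : V, if (v : ℝ × ℝ) ∈ γ ∧ (v : ℝ × ℝ) ∈ γ' then 1 else 0) ≤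
      (if γ = γ' then n + n else 0) + 1 := by
    intro γ hγ γ' hγ'
    rw [Finset.sum_coe_sort V (fun v => if v ∈ γ ∧ v ∈ γ' then 1 else 0), ← Finset.card_filter]
    split_ifs with h
    · subst h
      simp only [and_self]
      exact (hV γ hγ).trans (Nat.le_succ _)
    · rw [zero_add]
      apply Finset.card_le_one.2
      intro a ha b hb
      obtain ⟨g1, g2⟩ := hC γ hγ γ' hγ' h
      exact (Set.ncard_le_one g1).1 g2 a (Finset.mem_filter.1 ha).2 b (Finset.mem_filter.1 hb).2
  calc _ ≤ ∑ γ ∈ C, ∑ γ' ∈ C, ((if γ = γ' then n + n else 0) + 1) :=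
        Finset.sum_le_sum (fun γ hγ => Finset.sum_le_sum (fun γ' hγ' => h2 γ hγ γ' hγ'))
    _ = ∑ γ ∈ C, (n + n + n) := by
        apply Finset.sum_congr rfl
        intro γ hγ
        rw [Finset.sum_add_distrib, Finset.sum_ite_eq, if_pos hγ, Finset.sum_const, hn]
        simp
    _ = 3 * n ^ 2 := by
        rw [Finset.sum_const, hn, smul_eq_mul]; ring

theorem incid_bound (s : ℕ) (δ : ℝ) (hδ : 0 < δ) (m0 : ℕ)
    (hR : ∀ (Q : Finset (ℝ × ℝ)) (C : Finset (Set (ℝ × ℝ))),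
      (∀ γ ∈ C, ∀ γ' ∈ C, γ ≠ γ' → (γ ∩ γ').Finite ∧ (γ ∩ γ').ncard ≤ 1) →
      ¬ ContainsConfig Q C s 1 →
      ((∑ γ ∈ C, (Q.filter (fun p => p ∈ γ)).card : ℕ) : ℝ) ≤
        s * ((C.filter (fun γ => ∃ x ∈ Q, x ∈ γ)).card : ℝ) + δ * (Q.card : ℝ)^2 + m0 * Q.card)
    (n j : ℕ) (P : Finset (ℝ × ℝ)) (C : Finset (Set (ℝ × ℝ))) (hP : P.card = n) (hCn : C.card = n)
    (hC : KIntersecting C 1) (hno : ¬ ContainsConfig P C s 1) :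
    (incidences P C : ℝ) ≤ (1 + s) * (100 * √(2 ^ j * (3 * (n:ℝ) ^ 2))) + s * n +
      δ * ((n:ℝ) / 2 ^ j * n) + m0 * n := by
  obtain ⟨V, f, hD, hPV, hVγ⟩ := exists_drawing P C hC
  rw [hP, hCn] at hVγ
  set c : V → ℕ := fun v => (C.filter (fun γ => (v : ℝ × ℝ) ∈ γ)).card with hc
  set w : V → ℕ := fun v => if (v : ℝ × ℝ) ∈ P then 1 else 0 with hw
  obtain ⟨X, hX1, hX2⟩ := division arrAdj_symm (arr_noK5 hD) c w j
  have hDD : ∑ v, c v ^ 2 ≤ 3 * n ^ 2 := sum_sq_le C V n hCn hC.2 hVγ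
  have hXc : ((∑ v ∈ X, c v : ℕ) : ℝ) ≤ 100 * √(2 ^ j * (3 * (n:ℝ) ^ 2)) := by
    refine hX1.trans ?_
    gcongr
    exact_mod_cast hDD
  have hwP : ∑ v, w v ≤ n := by
    rw [hw, ← Finset.card_filter, ← hP]
    apply Finset.card_le_card_of_injOn (fun v : V => (v : ℝ × ℝ))
    · intro v hv
      exact (Finset.mem_filter.1 hv).2
    · intro a _ b _ h
      exact Subtype.ext h
  set F : Finset V := Finset.univ.filter (fun v => v ∉ X) with hF
  have hFX : ∀ v, v ∉ X → v ∈ F := fun v hv => Finset.mem_filter.2 ⟨Finset.mem_univ _, hv⟩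
  set K := comps (arrAdj C V f) F with hK
  set Q : Finset V → Finset (ℝ × ℝ) := fun M => P.filter (fun p => ∃ u ∈ M, (u : ℝ × ℝ) = p) with hQ
  have hQc : ∀ M, (Q M).card ≤ ∑ v ∈ M, w v := by
    intro M
    rw [hw, ← Finset.card_filter]
    have : Q M ⊆ (M.filter (fun v : V => (v : ℝ × ℝ) ∈ P)).image (fun v : V => (v : ℝ × ℝ)) := by
      intro p hp
      obtain ⟨h1, u, hu, rfl⟩ := Finset.mem_filter.1 hp
      exact Finset.mem_image.2 ⟨u, Finset.mem_filter.2 ⟨hu, h1⟩, rfl⟩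
    exact (Finset.card_le_card this).trans Finset.card_image_le
  have hQsum : ∑ M ∈ K, (Q M).card ≤ n := by
    calc ∑ M ∈ K, (Q M).card ≤ ∑ M ∈ K, ∑ v ∈ M, w v := Finset.sum_le_sum (fun M _ => hQc M)
      _ ≤ ∑ v ∈ F, w v := comps_sum_le K le_rfl w
      _ ≤ ∑ v, w v := Finset.sum_le_sum_of_subset (Finset.subset_univ _)
      _ ≤ n := hwP
  have hQmax : ∀ M ∈ K, ((Q M).card : ℝ) ≤ (n:ℝ) / 2 ^ j := by
    intro M hM
    have h1 := hX2 M (mem_comps.1 hM).1 (by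
      rw [Finset.disjoint_left]
      intro a ha
      exact (Finset.mem_filter.1 ((mem_comps.1 hM).2.1 ha)).2)
    have h2 : 2 ^ j * (Q M).card ≤ n := (Nat.mul_le_mul_left _ (hQc M)).trans (h1.trans hwP)
    rw [le_div_iff₀ (by positivity), mul_comm]
    exact_mod_cast h2
  -- splitting the incidences
  have hsplit : incidences P C ≤ ∑ v ∈ X, c v + ∑ M ∈ K, ∑ γ ∈ C, ((Q M).filter (fun p => p ∈ γ)).card := by
    rw [hc, sum_incid X C (fun v : V => (v : ℝ × ℝ)), Finset.sum_comm, ← Finset.sum_add_distrib]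
    apply Finset.sum_le_sum
    intro γ _
    have hsub : P.filter (fun p => p ∈ γ) ⊆
        (X.filter (fun v : V => (v : ℝ × ℝ) ∈ γ)).image (fun v : V => (v : ℝ × ℝ)) ∪
          K.biUnion (fun M => (Q M).filter (fun p => p ∈ γ)) := by
      intro p hp
      obtain ⟨hpP, hpγ⟩ := Finset.mem_filter.1 hp
      set v : V := ⟨p, hPV hpP⟩ with hv
      by_cases hvX : v ∈ X
      · apply Finset.mem_union_left
        exact Finset.mem_image.2 ⟨v, Finset.mem_filter.2 ⟨hvX, hpγ⟩, rfl⟩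
      · apply Finset.mem_union_right
        obtain ⟨M, hM, hvM⟩ := exists_comp (adj := arrAdj C V f) arrAdj_symm
          (ConnS.singleton v) (F := F) (by
            rw [Finset.singleton_subset_iff]; exact hFX v hvX)
        rw [Finset.singleton_subset_iff] at hvM
        exact Finset.mem_biUnion.2 ⟨M, hM, Finset.mem_filter.2
          ⟨Finset.mem_filter.2 ⟨hpP, v, hvM, rfl⟩, hpγ⟩⟩
    refine (Finset.card_le_card hsub).trans ((Finset.card_union_le _ _).trans ?_)
    exact Nat.add_le_add Finset.card_image_le Finset.card_biUnion_le
  have hmeet : ∑ M ∈ K, (C.filter (fun γ => ∃ x ∈ Q M, x ∈ γ)).card ≤ ∑ v ∈ X, c v + n := by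
    have e1 : ∑ M ∈ K, (C.filter (fun γ => ∃ x ∈ Q M, x ∈ γ)).card =
        ∑ γ ∈ C, (K.filter (fun M => ∃ x ∈ Q M, x ∈ γ)).card := by
      simp_rw [Finset.card_filter]
      exact Finset.sum_comm
    rw [e1, hc, sum_incid X C (fun v : V => (v : ℝ × ℝ)), ← hCn, Finset.card_eq_sum_ones,
      ← Finset.sum_add_distrib]
    apply Finset.sum_le_sum
    intro γ hγ
    refine le_trans (Finset.card_le_card ?_) (comps_meet hD X F hFX hγ)
    intro M hM
    obtain ⟨hM1, x, hx, hxγ⟩ := Finset.mem_filter.1 hM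
    obtain ⟨hxP, u, hu, rfl⟩ := Finset.mem_filter.1 hx
    exact Finset.mem_filter.2 ⟨hM1, u, hu, hxγ⟩
  have hRM : ∀ M ∈ K, ((∑ γ ∈ C, ((Q M).filter (fun p => p ∈ γ)).card : ℕ) : ℝ) ≤
      s * ((C.filter (fun γ => ∃ x ∈ Q M, x ∈ γ)).card : ℝ) + δ * ((n:ℝ) / 2 ^ j * (Q M).card)
        + m0 * (Q M).card := by
    intro M hM
    refine (hR (Q M) C hC.2 ?_).trans ?_
    · rintro ⟨S, hS, h⟩
      exact hno ⟨S, hS.trans (Finset.filter_subset _ _), h⟩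
    · have := hQmax M hM
      rw [sq]
      gcongr
  have hfin : ((∑ M ∈ K, ∑ γ ∈ C, ((Q M).filter (fun p => p ∈ γ)).card : ℕ) : ℝ) ≤
      s * ((∑ M ∈ K, (C.filter (fun γ => ∃ x ∈ Q M, x ∈ γ)).card : ℕ) : ℝ) +
      δ * ((n:ℝ) / 2 ^ j * ((∑ M ∈ K, (Q M).card : ℕ) : ℝ)) + m0 * ((∑ M ∈ K, (Q M).card : ℕ) : ℝ) := by
    have := Finset.sum_le_sum hRM
    rw [Finset.sum_add_distrib, Finset.sum_add_distrib, ← Finset.mul_sum, ← Finset.mul_sum,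
      ← Finset.mul_sum, ← Finset.mul_sum] at this
    exact_mod_cast this
  have hsplit' : (incidences P C : ℝ) ≤ ((∑ v ∈ X, c v : ℕ) : ℝ) +
      ((∑ M ∈ K, ∑ γ ∈ C, ((Q M).filter (fun p => p ∈ γ)).card : ℕ) : ℝ) := by exact_mod_cast hsplit
  have hmeet' : ((∑ M ∈ K, (C.filter (fun γ => ∃ x ∈ Q M, x ∈ γ)).card : ℕ) : ℝ) ≤
      ((∑ v ∈ X, c v : ℕ) : ℝ) + n := by exact_mod_cast hmeet
  have hQsum' : ((∑ M ∈ K, (Q M).card : ℕ) : ℝ) ≤ n := by exact_mod_cast hQsum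
  have b1 : (s:ℝ) * ((∑ M ∈ K, (C.filter (fun γ => ∃ x ∈ Q M, x ∈ γ)).card : ℕ) : ℝ) ≤
      s * (((∑ v ∈ X, c v : ℕ) : ℝ) + n) := by gcongr
  have b2 : δ * ((n:ℝ) / 2 ^ j * ((∑ M ∈ K, (Q M).card : ℕ) : ℝ)) ≤ δ * ((n:ℝ) / 2 ^ j * n) := by
    gcongr
  have b3 : (m0:ℝ) * ((∑ M ∈ K, (Q M).card : ℕ) : ℝ) ≤ m0 * n := by gcongr
  have b4 : (1 + (s:ℝ)) * ((∑ v ∈ X, c v : ℕ) : ℝ) ≤ (1 + s) * (100 * √(2 ^ j * (3 * (n:ℝ) ^ 2))) := by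
    gcongr
  linarith

end Final

theorem solymosi_type_pseudosegments (s : ℕ) (hs : 2 < s) :
    ∀ ε : ℝ, 0 < ε → ∃ n₀ : ℕ, ∀ n : ℕ, n₀ ≤ n →
      ∀ P : Finset (ℝ × ℝ), ∀ C : Finset (Set (ℝ × ℝ)),
        P.card = n → C.card = n → KIntersecting C 1 →
        ¬ ContainsConfig P C s 1 →
        (incidences P C : ℝ) < ε * (n : ℝ) ^ ((4:ℝ) / 3) := by
  intro ε hε
  set E : ℝ := (1 + s) * 100 with hE
  have hE0 : 0 < E := by positivity
  set K : ℝ := 48 * E ^ 2 / ε ^ 2 with hK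
  have hK0 : 0 < K := by positivity
  set δ : ℝ := ε / (8 * K) with hδ
  have hδ0 : 0 < δ := by positivity
  obtain ⟨m0, hR⟩ := lemmaR s hs δ hδ0
  set L : ℝ := max (K + 1) (4 * (s + m0) / ε + 1) with hL
  have hL1 : K + 1 ≤ L := le_max_left _ _
  have hL2 : 4 * (s + m0) / ε + 1 ≤ L := le_max_right _ _
  refine ⟨⌈L ^ 3⌉₊, ?_⟩
  intro n hn P C hP hCn hC hno
  have hnL : L ^ 3 ≤ n := (Nat.le_ceil _).trans (by exact_mod_cast hn)
  set x : ℝ := (n:ℝ) ^ ((1:ℝ) / 3) with hx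
  have hx0 : 0 ≤ x := Real.rpow_nonneg (Nat.cast_nonneg _) _
  have hx3 : x ^ 3 = n := by
    rw [hx, ← Real.rpow_natCast, ← Real.rpow_mul (Nat.cast_nonneg _)]
    norm_num
  have hx4 : (n:ℝ) ^ ((4:ℝ) / 3) = x ^ 4 := by
    rw [hx, ← Real.rpow_natCast, ← Real.rpow_mul (Nat.cast_nonneg _)]
    norm_num
  have hLx : L ≤ x := by
    rw [← hx3] at hnL
    exact le_of_pow_le_pow_left₀ (by norm_num) hx0 hnL
  have hx1 : 1 ≤ x := by linarith
  have hxK : 1 ≤ x ^ 2 / K := by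
    rw [le_div_iff₀ hK0]
    nlinarith
  obtain ⟨j, hj1, hj2⟩ := exists_nat_pow_near hxK (by norm_num : (1:ℝ) < 2)
  have hb := incid_bound s δ hδ0 m0 hR n j P C hP hCn hC hno
  rw [hx4]
  have t1 : √(2 ^ j * (3 * (n:ℝ) ^ 2)) ≤ ε / (4 * E) * x ^ 4 := by
    rw [Real.sqrt_le_left (by positivity), ← hx3]
    calc (2:ℝ) ^ j * (3 * (x ^ 3) ^ 2) ≤ x ^ 2 / K * (3 * (x ^ 3) ^ 2) := by gcongr
      _ = (ε / (4 * E) * x ^ 4) ^ 2 := by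
        rw [hK]; field_simp; ring
  have t1' : (1 + (s:ℝ)) * (100 * √(2 ^ j * (3 * (n:ℝ) ^ 2))) ≤ ε / 4 * x ^ 4 := by
    calc (1 + (s:ℝ)) * (100 * √(2 ^ j * (3 * (n:ℝ) ^ 2))) = E * √(2 ^ j * (3 * (n:ℝ) ^ 2)) := by
          rw [hE]; ring
      _ ≤ E * (ε / (4 * E) * x ^ 4) := by gcongr
      _ = _ := by field_simp
  have t2 : δ * ((n:ℝ) / 2 ^ j * n) ≤ ε / 4 * x ^ 4 := by
    have h2j : x ^ 2 ≤ 2 * K * 2 ^ j := by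
      rw [div_lt_iff₀ hK0, pow_succ (2:ℝ) j] at hj2
      linarith
    have : (n:ℝ) / 2 ^ j * n ≤ 2 * K * x ^ 4 := by
      rw [div_mul_eq_mul_div, div_le_iff₀ (by positivity), ← hx3]
      have hx4' : 0 ≤ x ^ 4 := by positivity
      calc x ^ 3 * x ^ 3 = x ^ 2 * x ^ 4 := by ring
        _ ≤ 2 * K * 2 ^ j * x ^ 4 := by gcongr
        _ = _ := by ring
    calc δ * ((n:ℝ) / 2 ^ j * n) ≤ δ * (2 * K * x ^ 4) := by gcongr
      _ = _ := by rw [hδ]; field_simp; ring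
  have t3 : (s:ℝ) * n + m0 * n ≤ ε / 4 * x ^ 4 := by
    have h1 : 4 * (s + m0) / ε ≤ x := by linarith
    rw [div_le_iff₀ hε] at h1
    rw [← hx3]
    have hx3' : 0 ≤ x ^ 3 := by positivity
    calc (s:ℝ) * x ^ 3 + m0 * x ^ 3 = (s + m0) * x ^ 3 := by ring
      _ ≤ (x * ε / 4) * x ^ 3 := by gcongr; linarith
      _ = _ := by ring
  have hpos : 0 < ε * x ^ 4 := by positivity
  linarith
end

section
/- For every integer s ≥ 3 and every real ε > 0 there exists n₀ such that for every integer n ≥ n₀ there exist a finite set P of n points in ℝ² and a family C of n pseudo-segments with the following two properties: (1) there do not exist an s-element subset S of P and an injective map φ from the 2-element subsets of S to C with every 2-element subset T of S satisfying T ⊆ φ(T); and (2) I(P,C) ≥ n^(4/3 − (s−1)/(3(s²−s−1)) − ε). -/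
open scoped Classical

lemma divisor_bound (η : ℝ) (hη : 0 < η) : ∃ K : ℝ, 1 ≤ K ∧ ∀ n : ℕ, n ≠ 0 →
    ((n.divisors.card : ℕ) : ℝ) ≤ K * (n : ℝ) ^ η := by
  obtain ⟨A, hA⟩ := exists_nat_ge ((2:ℝ) ^ (1/η))
  have hl2 : 0 < Real.log 2 := Real.log_pos (by norm_num)
  have hηl : 0 < η * Real.log 2 := mul_pos hη hl2
  set c : ℝ := 1 + 1 / (η * Real.log 2) with hc
  have hc1 : 1 ≤ c := by
    have : 0 < 1 / (η * Real.log 2) := by positivity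
    linarith
  refine ⟨c ^ A, one_le_pow₀ hc1, ?_⟩
  intro n hn
  rw [Nat.card_divisors hn]
  have hn2 : (n : ℝ) ^ η = ∏ p ∈ n.primeFactors, ((p : ℝ) ^ (η)) ^ (n.factorization p) := by
    conv_lhs => rw [← Nat.prod_factorization_pow_eq_self hn]
    rw [Finsupp.prod, Nat.support_factorization]
    push_cast
    rw [← Real.finsetProd_rpow _ _ (fun i _ => by positivity)]
    refine Finset.prod_congr rfl fun p _ => ?_
    rw [← Real.rpow_natCast, ← Real.rpow_natCast, ← Real.rpow_mul (by positivity),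
      ← Real.rpow_mul (by positivity), mul_comm]
  rw [hn2]
  push_cast
  have key : ∀ p ∈ n.primeFactors, ((n.factorization p : ℝ) + 1) ≤
      (if p < A then c else 1) * ((p : ℝ) ^ (η)) ^ (n.factorization p) := by
    intro p hp
    have hp2 : 2 ≤ p := (Nat.prime_of_mem_primeFactors hp).two_le
    have hp2' : (2:ℝ) ≤ p := by exact_mod_cast hp2
    set k := n.factorization p
    split_ifs with h
    · have h1 : (2:ℝ) ^ (η * k) ≤ ((p : ℝ) ^ η) ^ k := by
        rw [← Real.rpow_natCast, ← Real.rpow_mul (by positivity)]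
        exact Real.rpow_le_rpow (by norm_num) hp2' (by positivity)
      have h2 : 1 + (η * Real.log 2) * k ≤ (2:ℝ) ^ (η * k) := by
        rw [Real.rpow_def_of_pos (by norm_num)]
        have := Real.add_one_le_exp (Real.log 2 * (η * k))
        linarith
      calc (k:ℝ) + 1 ≤ c * (1 + (η * Real.log 2) * k) := by
            rw [hc]
            have : (1 + 1 / (η * Real.log 2)) * (1 + (η * Real.log 2) * k)
              = 1 + k + η * Real.log 2 * k + 1 / (η * Real.log 2) := by
              field_simp
              ring
            rw [this]
            have h3 : 0 ≤ η * Real.log 2 * k := by positivity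
            have h4 : 0 ≤ 1 / (η * Real.log 2) := by positivity
            linarith
        _ ≤ _ := by gcongr; exact h2.trans h1
    · have h1 : (2:ℝ) ≤ (p:ℝ) ^ η := by
        have : (2:ℝ) ^ (1/η) ≤ p := hA.trans (by exact_mod_cast not_lt.mp h)
        calc (2:ℝ) = ((2:ℝ) ^ (1/η)) ^ η := by
              rw [← Real.rpow_mul (by norm_num)]; field_simp; simp
          _ ≤ _ := Real.rpow_le_rpow (by positivity) this hη.le
      rw [one_mul]
      calc (k:ℝ) + 1 ≤ 2 ^ k := by exact_mod_cast Nat.lt_two_pow_self (n := k)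
        _ ≤ _ := by gcongr
  refine (Finset.prod_le_prod (fun _ _ => by positivity) key).trans ?_
  rw [Finset.prod_mul_distrib]
  refine mul_le_mul_of_nonneg_right ?_ (Finset.prod_nonneg fun _ _ => by positivity)
  rw [Finset.prod_ite, Finset.prod_const, Finset.prod_const_one, mul_one]
  refine pow_le_pow_right₀ hc1 ?_
  calc _ ≤ (Finset.range A).card := Finset.card_le_card (by intro p; simp)
    _ = A := by simp

lemma hypergraph_indep {V ι : Type*} [Fintype V] [Fintype ι] (e : ι → Finset V) (r q : ℕ)
    (hq : 1 ≤ q) (hr : 1 ≤ r) (he : ∀ i, r ≤ (e i).card)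
    (hcard : 2 * Fintype.card ι ≤ Fintype.card V * q ^ (r - 1)) :
    ∃ I : Finset V, (∀ i, ¬ e i ⊆ I) ∧ Fintype.card V ≤ 2 * q * I.card := by
  classical
  have : NeZero q := ⟨by omega⟩
  set n := Fintype.card V
  -- number of colourings that vanish on a set
  have cnt : ∀ A : Finset V, (Finset.univ.filter (fun χ : V → Fin q => ∀ v ∈ A, χ v = 0)).card
      = q ^ (n - A.card) := by
    intro A
    have : Finset.univ.filter (fun χ : V → Fin q => ∀ v ∈ A, χ v = 0)
        = Fintype.piFinset (fun v => if v ∈ A then ({0} : Finset (Fin q)) else Finset.univ) := by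
      ext χ
      simp only [Finset.mem_filter, Finset.mem_univ, true_and, Fintype.mem_piFinset]
      refine forall_congr' fun v => ?_
      by_cases h : v ∈ A <;> simp [h]
    rw [this, Fintype.card_piFinset]
    have h2 : ∀ v, (if v ∈ A then ({0} : Finset (Fin q)) else Finset.univ).card
        = if v ∈ A then 1 else q := by
      intro v; split_ifs <;> simp
    simp_rw [h2]
    rw [Finset.prod_ite, Finset.prod_const_one, one_mul, Finset.prod_const]
    congr 1
    rw [← Finset.card_compl]
    congr 1
    ext; simp
  by_cases hV : n = 0
  · refine ⟨∅, ?_, by omega⟩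
    intro i h
    have h1 := he i
    have h2 := Finset.card_le_card h
    simp at h2
    rw [h2] at h1
    simp at h1
    omega
  -- sum over colourings
  have s1 : ∑ χ : V → Fin q, ((Finset.univ.filter (fun v => χ v = 0)).card : ℕ)
      = n * q ^ (n - 1) := by
    simp_rw [Finset.card_filter]
    rw [Finset.sum_comm]
    have : ∀ v : V, ∑ χ : V → Fin q, (if χ v = 0 then 1 else 0) = q ^ (n - 1) := by
      intro v
      rw [← Finset.card_filter]
      have := cnt {v}
      simpa using this
    simp [this, n]
  have s2 : ∑ χ : V → Fin q, ((Finset.univ.filter (fun i => ∀ v ∈ e i, χ v = 0)).card : ℕ) * (2 * q ^ (r-1))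
      ≤ 2 * Fintype.card ι * q ^ (n - 1) := by
    rw [← Finset.sum_mul]
    simp_rw [Finset.card_filter]
    rw [Finset.sum_comm]
    simp_rw [← Finset.card_filter, cnt]
    rw [Finset.sum_mul]
    calc _ ≤ ∑ i : ι, 2 * q ^ (n - 1) := by
          refine Finset.sum_le_sum fun i _ => ?_
          have h1 := he i
          have h2 : (e i).card ≤ n := Finset.card_le_univ _
          calc q ^ (n - (e i).card) * (2 * q ^ (r-1)) = 2 * q ^ (n - (e i).card + (r-1)) := by
                rw [pow_add]; ring
            _ ≤ _ := by
              gcongr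
              omega
      _ = _ := by simp; ring
  -- pick a good colouring
  have s3 : ∃ χ : V → Fin q, n + 2 * q * (Finset.univ.filter (fun i => ∀ v ∈ e i, χ v = 0)).card
      ≤ 2 * q * (Finset.univ.filter (fun v => χ v = 0)).card := by
    by_contra! hcon
    have h1 : ∑ χ : V → Fin q, 2 * q * (Finset.univ.filter (fun v => χ v = 0)).card <
        ∑ χ : V → Fin q, (n + 2 * q * (Finset.univ.filter (fun i => ∀ v ∈ e i, χ v = 0)).card) :=
      Finset.sum_lt_sum_of_nonempty Finset.univ_nonempty fun χ _ => hcon χ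
    rw [← Finset.mul_sum, s1, Finset.sum_add_distrib, ← Finset.mul_sum] at h1
    rw [← Finset.sum_mul] at s2
    set X := ∑ χ : V → Fin q, (Finset.univ.filter (fun i => ∀ v ∈ e i, χ v = 0)).card
    have h3 : X * 2 ≤ n * q ^ (n-1) := by
      have hpos : 0 < q ^ (r-1) := by positivity
      refine Nat.le_of_mul_le_mul_right ?_ hpos
      calc X * 2 * q ^ (r-1) = X * (2 * q^(r-1)) := by ring
        _ ≤ _ := s2
        _ ≤ n * q ^ (r-1) * q ^ (n-1) := by gcongr
        _ = _ := by ring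
    have h4 : q * q ^ (n-1) = q ^ n := by
      rw [← pow_succ']; congr 1; omega
    simp only [Finset.sum_const, Finset.card_univ, Fintype.card_pi, Fintype.card_fin,
      Finset.prod_const, smul_eq_mul] at h1
    have h5 : q ^ (Fintype.card V) = q ^ n := rfl
    rw [h5, ← h4] at h1
    have h6 := Nat.mul_le_mul_left q h3
    nlinarith
  obtain ⟨χ, hχ⟩ := s3
  have hne : ∀ i, (e i).Nonempty := fun i => Finset.card_pos.mp (lt_of_lt_of_le (by omega) (he i))
  choose w hw using hne
  set B := Finset.univ.filter (fun i => ∀ v ∈ e i, χ v = 0)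
  set Z := Finset.univ.filter (fun v => χ v = 0)
  refine ⟨Z \ B.image w, ?_, ?_⟩
  · intro i hi
    have hB : i ∈ B := by
      simp only [B, Finset.mem_filter, Finset.mem_univ, true_and]
      intro v hv
      have := hi hv
      simp [Z] at this
      exact this.1
    have := hi (hw i)
    simp only [Finset.mem_sdiff, Finset.mem_image, not_exists, not_and] at this
    exact this.2 i hB rfl
  · have h1 : Z.card ≤ (Z \ B.image w).card + B.card := by
      have := Finset.le_card_sdiff (B.image w) Z
      have h2 : (B.image w).card ≤ B.card := Finset.card_image_le
      omega
    have h2 := Nat.mul_le_mul_left (2*q) h1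
    rw [mul_add] at h2
    omega

/-- Function whose graph is the perturbed line with slope and intercept given by `l`. -/
noncomputable def pertFun (δ : ℝ) (K : Set ℝ) (l : ℕ × ℕ) (t : ℝ) : ℝ :=
  (l.1 : ℝ) * t + l.2 + δ * Metric.infDist t K

lemma geom_realization (P : Finset (ℕ × ℕ)) (I : Finset ((ℕ × ℕ) × (ℕ × ℕ)))
    (hI : ∀ i ∈ I, i.1.2 = i.2.1 * i.1.1 + i.2.2) :
    ∃ ψ : ℕ × ℕ → Set (ℝ × ℝ), (∀ l, IsSimpleCurve (ψ l)) ∧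
      (∀ l l', l ≠ l' → (ψ l ∩ ψ l').Subsingleton) ∧
      (∀ p ∈ P, ∀ l, (((p.1 : ℝ), (p.2 : ℝ)) ∈ ψ l ↔ (p, l) ∈ I)) := by
  obtain ⟨M, hM1, hM⟩ : ∃ M : ℝ, 1 ≤ M ∧ ∀ p ∈ P, (p.1 : ℝ) ≤ M := by
    refine ⟨((P.sup Prod.fst : ℕ) : ℝ) + 1, by simp, fun p hp => ?_⟩
    have : p.1 ≤ P.sup Prod.fst := Finset.le_sup (f := Prod.fst) hp
    have : (p.1 : ℝ) ≤ (P.sup Prod.fst : ℕ) := by exact_mod_cast this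
    linarith
  set K : ℕ × ℕ → Set ℝ := fun l =>
    insert (-1) ((fun i : (ℕ × ℕ) × (ℕ × ℕ) => (i.1.1 : ℝ)) '' {i | i ∈ I ∧ i.2 = l}) with hK
  have hKfin : ∀ l, (K l).Finite := fun l =>
    (((I.finite_toSet).subset (fun i hi => hi.1)).image _).insert _
  have hKne : ∀ l, (K l).Nonempty := fun l => ⟨-1, by simp [hK]⟩
  set δ : ℝ := 1 / (4 * (M + 1)) with hδ
  have hδ0 : 0 < δ := by positivity
  have hδM : δ * (M + 1) = 1 / 4 := by rw [hδ]; field_simp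
  have hδ4 : δ ≤ 1 / 4 := by nlinarith
  have hgb : ∀ l t, 0 ≤ t → t ≤ M → δ * Metric.infDist t (K l) ≤ 1 / 4 := by
    intro l t h0 h1
    rw [← hδM]
    refine mul_le_mul_of_nonneg_left ?_ hδ0.le
    refine (Metric.infDist_le_dist_of_mem (show (-1:ℝ) ∈ K l by simp [hK])).trans ?_
    rw [Real.dist_eq, abs_of_nonneg (by linarith)]
    linarith
  have hg0 : ∀ l t, 0 ≤ δ * Metric.infDist t (K l) := fun l t =>
    mul_nonneg hδ0.le Metric.infDist_nonneg
  have hlip : ∀ l t t', |Metric.infDist t (K l) - Metric.infDist t' (K l)| ≤ |t - t'| := by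
    intro l t t'
    have := (Metric.lipschitz_infDist_pt (K l)).dist_le_mul t t'
    simpa [Real.dist_eq] using this
  refine ⟨fun l => {z | 0 ≤ z.1 ∧ z.1 ≤ M ∧ z.2 = pertFun δ (K l) l z.1}, ?_, ?_, ?_⟩
  · intro l
    refine ⟨fun t => (M * t, pertFun δ (K l) l (M * t)), ?_, ?_, ?_⟩
    · unfold pertFun
      have := Metric.continuous_infDist_pt (K l)
      fun_prop
    · intro t t' h
      simp only [Prod.mk.injEq] at h
      have h1 := h.1
      have : (t : ℝ) = t' := mul_left_cancel₀ (by linarith) h1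
      exact Subtype.ext this
    · ext z
      simp only [Set.mem_ofPred_eq, Set.mem_range]
      constructor
      · rintro ⟨h0, h1, h2⟩
        refine ⟨⟨z.1 / M, by positivity, by rw [div_le_one (by linarith)]; exact h1⟩, ?_⟩
        have : M * (z.1 / M) = z.1 := by field_simp
        simp only [this]
        rw [← h2]
      · rintro ⟨⟨t, ht0, ht1⟩, rfl⟩
        refine ⟨by positivity, ?_, rfl⟩
        simp only
        nlinarith
  · intro l l' hll z hz z' hz'
    obtain ⟨⟨h0, h1, h2⟩, ⟨_, _, h3⟩⟩ := hz
    obtain ⟨⟨h0', h1', h2'⟩, ⟨_, _, h3'⟩⟩ := hz'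
    have e1 := h2.symm.trans h3
    have e2 := h2'.symm.trans h3'
    have hz1 : z.1 = z'.1 := by
      unfold pertFun at e1 e2
      by_cases ha : l.1 = l'.1
      · exfalso
        have hb : l.2 ≠ l'.2 := fun hb => hll (Prod.ext ha hb)
        rw [ha] at e1
        have a1 := hgb l z.1 h0 h1
        have a2 := hgb l' z.1 h0 h1
        have a3 := hg0 l z.1
        have a4 := hg0 l' z.1
        rcases lt_or_gt_of_ne hb with h | h
        · have : (l.2 : ℝ) + 1 ≤ l'.2 := by exact_mod_cast h
          linarith
        · have : (l'.2 : ℝ) + 1 ≤ l.2 := by exact_mod_cast h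
          linarith
      · by_contra hne
        have hpos : 0 < |z.1 - z'.1| := abs_pos.mpr (sub_ne_zero.mpr hne)
        have a1 := hlip l z.1 z'.1
        have a2 := hlip l' z.1 z'.1
        have a3 : 1 ≤ |(l.1 : ℝ) - l'.1| := by
          rcases lt_or_gt_of_ne ha with h | h
          · have : (l.1 : ℝ) + 1 ≤ l'.1 := by exact_mod_cast h
            rw [abs_sub_comm, abs_of_nonneg] <;> linarith
          · have : (l'.1 : ℝ) + 1 ≤ l.1 := by exact_mod_cast h
            rw [abs_of_nonneg] <;> linarith
        have a4 : ((l.1 : ℝ) - l'.1) * (z.1 - z'.1) =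
          δ * ((Metric.infDist z.1 (K l') - Metric.infDist z'.1 (K l'))
            - (Metric.infDist z.1 (K l) - Metric.infDist z'.1 (K l))) := by linarith
        have a5 := congrArg abs a4
        rw [abs_mul, abs_mul, abs_of_pos hδ0] at a5
        have a6 := abs_sub (Metric.infDist z.1 (K l') - Metric.infDist z'.1 (K l'))
          (Metric.infDist z.1 (K l) - Metric.infDist z'.1 (K l))
        have a7 : |(Metric.infDist z.1 (K l') - Metric.infDist z'.1 (K l'))
            - (Metric.infDist z.1 (K l) - Metric.infDist z'.1 (K l))| ≤ 2 * |z.1 - z'.1| := by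
          linarith
        nlinarith [mul_le_mul_of_nonneg_left a7 hδ0.le]
    refine Prod.ext hz1 ?_
    rw [h2, h2', hz1]
  · intro p hp l
    simp only [Set.mem_ofPred_eq]
    have hp0 : (0:ℝ) ≤ p.1 := by positivity
    have hpM := hM p hp
    unfold pertFun
    constructor
    · rintro ⟨-, -, h⟩
      have a1 := hgb l p.1 hp0 hpM
      have a2 := hg0 l p.1
      have b1 : l.1 * p.1 + l.2 ≤ p.2 := by
        have : (l.1 : ℝ) * p.1 + l.2 ≤ p.2 := by linarith
        exact_mod_cast this
      have b2 : p.2 < l.1 * p.1 + l.2 + 1 := by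
        have : (p.2 : ℝ) < l.1 * p.1 + l.2 + 1 := by linarith
        exact_mod_cast this
      have b3 : p.2 = l.1 * p.1 + l.2 := by omega
      have b4 : (p.2 : ℝ) = l.1 * p.1 + l.2 := by exact_mod_cast b3
      have b5 : Metric.infDist (p.1 : ℝ) (K l) = 0 := by
        have : δ * Metric.infDist (p.1 : ℝ) (K l) = 0 := by linarith
        exact (mul_eq_zero.mp this).resolve_left hδ0.ne'
      have b6 := ((hKfin l).isClosed.mem_iff_infDist_zero (hKne l)).mpr b5
      rcases b6 with h | ⟨i, ⟨hi, hil⟩, hix⟩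
      · linarith
      · have c1 : i.1.1 = p.1 := by
          have hix2 : (i.1.1 : ℝ) = p.1 := hix
          exact_mod_cast hix2
        have c2 := hI i hi
        have : i = (p, l) := by
          refine Prod.ext (Prod.ext c1 ?_) hil
          rw [c2, hil, c1, b3]
        rwa [← this]
    · intro h
      refine ⟨hp0, hpM, ?_⟩
      have h1 := hI _ h
      simp only at h1
      have : Metric.infDist (p.1 : ℝ) (K l) = 0 :=
        Metric.infDist_zero_of_mem (Or.inr ⟨(p, l), ⟨h, rfl⟩, rfl⟩)
      rw [this, h1]
      push_cast
      ring

lemma card_congr_class (A : Finset ℕ) (m k : ℕ) (hA : ∀ a ∈ A, a < m)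
    (hk : ∀ a ∈ A, ∀ a' ∈ A, (k : ℤ) ∣ (a : ℤ) - a') : A.card ≤ m / k + 1 := by
  calc A.card ≤ (Finset.range (m / k + 1)).card := by
        refine Finset.card_le_card_of_injOn (fun a => a / k) ?_ ?_
        · intro a ha
          simp only [Finset.coe_range, Set.mem_Iio]
          exact Nat.lt_succ_of_le (Nat.div_le_div_right (hA a ha).le)
        · intro a ha a' ha' h
          simp only at h
          have h1 := hk a ha a' ha'
          have h2 : a' % k = a % k := (Nat.modEq_iff_dvd.mpr h1)
          rw [← Nat.div_add_mod a k, ← Nat.div_add_mod a' k, h, h2]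
    _ = _ := by simp

lemma dvd_reduced (d D A : ℕ) (hd : d ≠ 0) (h : d ∣ A * D) : d / d.gcd D ∣ A := by
  have hg : 0 < d.gcd D := Nat.gcd_pos_of_pos_left _ (Nat.pos_of_ne_zero hd)
  have hc : (d / d.gcd D).Coprime (D / d.gcd D) := Nat.coprime_div_gcd_div_gcd hg
  refine hc.dvd_of_dvd_mul_right ?_
  have h1 : d / d.gcd D * d.gcd D = d := Nat.div_mul_cancel (Nat.gcd_dvd_left _ _)
  have h2 : D / d.gcd D * d.gcd D = D := Nat.div_mul_cancel (Nat.gcd_dvd_right _ _)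
  refine Nat.dvd_of_mul_dvd_mul_right hg ?_
  rw [h1, mul_assoc, h2]
  exact h

lemma sum_gcd_bound (m x2 D : ℕ) (hx2 : x2 < m) (hD : D ≠ 0) :
    ∑ x ∈ (Finset.range m).erase x2,
      ((m / (((x : ℤ) - x2).natAbs / (((x : ℤ) - x2).natAbs).gcd D) : ℕ) : ℝ)
      ≤ 2 * (D.divisors.card : ℝ) * (m * (1 + Real.log m)) := by
  set d : ℕ → ℕ := fun x => ((x : ℤ) - x2).natAbs with hd
  set h : ℕ → Bool × ℕ × ℕ := fun x => (decide (x < x2), (d x).gcd D, d x / (d x).gcd D) with hh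
  have hd0 : ∀ x ∈ (Finset.range m).erase x2, 0 < d x ∧ d x ≤ m := by
    intro x hx
    simp only [Finset.mem_erase, Finset.mem_range] at hx
    simp only [hd]
    omega
  have hinj : Set.InjOn h ((Finset.range m).erase x2 : Finset ℕ) := by
    intro x hx y hy hxy
    simp only [hh, Prod.mk.injEq, decide_eq_decide] at hxy
    obtain ⟨h1, h2, h3⟩ := hxy
    have e1 : d x / (d x).gcd D * (d x).gcd D = d x := Nat.div_mul_cancel (Nat.gcd_dvd_left _ _)
    have e2 : d y / (d y).gcd D * (d y).gcd D = d y := Nat.div_mul_cancel (Nat.gcd_dvd_left _ _)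
    have e3 : d x = d y := by rw [← e1, ← e2, h3, h2]
    simp only [hd] at e3
    omega
  have hsub : ((Finset.range m).erase x2).image h ⊆
      (Finset.univ : Finset Bool) ×ˢ (D.divisors ×ˢ Finset.Icc 1 m) := by
    intro z hz
    obtain ⟨x, hx, rfl⟩ := Finset.mem_image.mp hz
    obtain ⟨h0, h1⟩ := hd0 x hx
    simp only [hh, Finset.mem_product, Finset.mem_univ, true_and, Nat.mem_divisors, Finset.mem_Icc]
    refine ⟨⟨Nat.gcd_dvd_right _ _, hD⟩, ?_, (Nat.div_le_self _ _).trans h1⟩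
    exact Nat.div_pos (Nat.gcd_le_left _ h0) (Nat.gcd_pos_of_pos_left _ h0)
  have hharm : ∑ k ∈ Finset.Icc 1 m, ((m / k : ℕ) : ℝ) ≤ m * (1 + Real.log m) := by
    have h1 := harmonic_le_one_add_log m
    rw [harmonic_eq_sum_Icc] at h1
    push_cast at h1
    calc _ ≤ ∑ k ∈ Finset.Icc 1 m, (m : ℝ) * ((k : ℝ)⁻¹) := by
          refine Finset.sum_le_sum fun k _ => ?_
          rw [← div_eq_mul_inv]
          exact Nat.cast_div_le
      _ = m * ∑ k ∈ Finset.Icc 1 m, ((k : ℝ)⁻¹) := by rw [Finset.mul_sum]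
      _ ≤ _ := by gcongr
  calc _ = ∑ x ∈ (Finset.range m).erase x2, (fun z : Bool × ℕ × ℕ => ((m / z.2.2 : ℕ) : ℝ)) (h x) := rfl
    _ = ∑ z ∈ ((Finset.range m).erase x2).image h, ((m / z.2.2 : ℕ) : ℝ) :=
        (Finset.sum_image (f := fun z : Bool × ℕ × ℕ => ((m / z.2.2 : ℕ) : ℝ)) hinj).symm
    _ ≤ ∑ z ∈ (Finset.univ : Finset Bool) ×ˢ (D.divisors ×ˢ Finset.Icc 1 m),
          ((m / z.2.2 : ℕ) : ℝ) :=
        Finset.sum_le_sum_of_subset_of_nonneg hsub fun _ _ _ => by positivity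
    _ = 2 * (D.divisors.card : ℝ) * ∑ k ∈ Finset.Icc 1 m, ((m / k : ℕ) : ℝ) := by
        rw [Finset.sum_product]
        simp only [Finset.sum_product, Finset.sum_const, Finset.card_univ, Fintype.card_bool,
          nsmul_eq_mul]
        push_cast
        ring
    _ ≤ _ := by gcongr

lemma common_nbrs_card (m : ℕ) (p1 p2 : ℕ × ℕ) (h2 : p2.1 < m)
    (W : Finset (ℕ × ℕ))
    (hW : ∀ p ∈ W, p.1 < m ∧ p.1 ≠ p2.1 ∧
      (∃ a < m, p1.2 + a * p.1 = p.2 + a * p1.1) ∧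
      (∃ a < m, p2.2 + a * p.1 = p.2 + a * p2.1)) :
    W.card ≤ ∑ x ∈ (Finset.range m).erase p2.1,
      (m / (((x : ℤ) - p2.1).natAbs / (((x : ℤ) - p2.1).natAbs).gcd ((p1.1 : ℤ) - p2.1).natAbs) + 1) := by
  set A : ℕ → Finset ℕ := fun x => (Finset.range m).filter (fun a => ∃ y : ℕ,
    p1.2 + a * x = y + a * p1.1 ∧ ∃ a' < m, p2.2 + a' * x = y + a' * p2.1) with hA
  have hsub : W ⊆ ((Finset.range m).erase p2.1).biUnion
      (fun x => (A x).image (fun a => (x, p1.2 + a * x - a * p1.1))) := by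
    intro p hp
    obtain ⟨h1, h3, ⟨a, ha, h4⟩, ⟨a', ha', h5⟩⟩ := hW p hp
    simp only [Finset.mem_biUnion, Finset.mem_erase, Finset.mem_range, Finset.mem_image]
    refine ⟨p.1, ⟨h3, h1⟩, a, ?_, ?_⟩
    · simp only [hA, Finset.mem_filter, Finset.mem_range]
      exact ⟨ha, p.2, h4, a', ha', h5⟩
    · refine Prod.ext rfl ?_
      simp only
      rw [h4]; simp
  refine (Finset.card_le_card hsub).trans (Finset.card_biUnion_le.trans ?_)
  refine Finset.sum_le_sum fun x hx => Finset.card_image_le.trans ?_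
  simp only [Finset.mem_erase, Finset.mem_range] at hx
  refine card_congr_class _ _ _ (fun a ha => ?_) ?_
  · simp only [hA, Finset.mem_filter, Finset.mem_range] at ha
    exact ha.1
  · intro a ha b hb
    simp only [hA, Finset.mem_filter, Finset.mem_range] at ha hb
    obtain ⟨-, y, hy1, a', -, hy2⟩ := ha
    obtain ⟨-, z, hz1, b', -, hz2⟩ := hb
    zify at hy1 hy2 hz1 hz2
    have hdvd : ((x : ℤ) - p2.1) ∣ ((a : ℤ) - b) * ((p1.1 : ℤ) - p2.1) := by
      refine ⟨(a : ℤ) - b - (a' - b'), ?_⟩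
      linear_combination (-1) * hy1 + hy2 + hz1 - hz2
    have h3 := Int.natAbs_dvd_natAbs.mpr hdvd
    rw [Int.natAbs_mul] at h3
    have := dvd_reduced _ _ _ (by omega) h3
    exact Int.natCast_dvd.mpr this

lemma common_nbrs (η : ℝ) (hη : 0 < η) : ∃ K : ℝ, 1 ≤ K ∧ ∀ (m : ℕ) (p1 p2 : ℕ × ℕ)
    (W : Finset (ℕ × ℕ)), p1.1 < m → p2.1 < m → p1.1 ≠ p2.1 →
    (∀ p ∈ W, p.1 < m ∧ p.1 ≠ p2.1 ∧
      (∃ a < m, p1.2 + a * p.1 = p.2 + a * p1.1) ∧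
      (∃ a < m, p2.2 + a * p.1 = p.2 + a * p2.1)) →
    (W.card : ℝ) ≤ K * (m : ℝ) ^ (1 + η) := by
  obtain ⟨K, hK1, hK⟩ := divisor_bound (η / 2) (by positivity)
  refine ⟨1 + 2 * K * (1 + 1 / (η / 2)), ?_, ?_⟩
  · have : 0 ≤ 2 * K * (1 + 1 / (η / 2)) := by positivity
    linarith
  intro m p1 p2 W h1 h2 hne hW
  have hm : (1 : ℝ) ≤ m := by exact_mod_cast (by omega : 1 ≤ m)
  set D := ((p1.1 : ℤ) - p2.1).natAbs with hD
  have hD0 : D ≠ 0 := by omega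
  have hDm : D ≤ m := by omega
  have c1 : (W.card : ℝ) ≤ _ := Nat.cast_le.mpr (common_nbrs_card m p1 p2 h2 W hW)
  rw [← hD] at c1
  push_cast at c1
  rw [Finset.sum_add_distrib] at c1
  have c2 := sum_gcd_bound m p2.1 D h2 hD0
  have c3 : ∑ x ∈ (Finset.range m).erase p2.1, (1:ℝ) ≤ m := by
    simp only [Finset.sum_const, nsmul_eq_mul, mul_one]
    exact_mod_cast (Finset.card_erase_le.trans (by simp))
  have c4 : (D.divisors.card : ℝ) ≤ K * (m : ℝ) ^ (η / 2) := by
    refine (hK D hD0).trans ?_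
    gcongr
  have c5 : 1 + Real.log m ≤ (1 + 1 / (η / 2)) * (m : ℝ) ^ (η / 2) := by
    have d1 := Real.log_le_rpow_div (x := (m : ℝ)) (by positivity) (half_pos hη)
    have d2 : 1 ≤ (m : ℝ) ^ (η / 2) := Real.one_le_rpow hm (by positivity)
    have : (1 + 1 / (η / 2)) * (m : ℝ) ^ (η / 2) = (m : ℝ) ^ (η / 2) + (m : ℝ) ^ (η / 2) / (η / 2) := by
      ring
    linarith
  have c6 : 0 ≤ 1 + Real.log m := by
    have := Real.log_nonneg hm
    linarith
  have e1 : (m : ℝ) ^ (1 + η) = m * ((m : ℝ) ^ (η / 2) * (m : ℝ) ^ (η / 2)) := by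
    rw [← Real.rpow_add (by positivity), Real.rpow_add (by positivity), Real.rpow_one]
    congr 2; ring
  have c7 : 2 * (D.divisors.card : ℝ) * (m * (1 + Real.log m)) ≤
      2 * (K * (m : ℝ) ^ (η / 2)) * (m * ((1 + 1 / (η / 2)) * (m : ℝ) ^ (η / 2))) := by
    gcongr
  have c8 : (m : ℝ) ≤ (m : ℝ) ^ (1 + η) := by
    conv_lhs => rw [← Real.rpow_one (m : ℝ)]
    exact Real.rpow_le_rpow_of_exponent_le hm (by linarith)
  have c9 : 2 * (K * (m : ℝ) ^ (η / 2)) * (m * ((1 + 1 / (η / 2)) * (m : ℝ) ^ (η / 2)))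
      = 2 * K * (1 + 1 / (η / 2)) * (m : ℝ) ^ (1 + η) := by
    rw [e1]; ring
  have c10 : (W.card : ℝ) ≤ 2 * K * (1 + 1 / (η / 2)) * (m : ℝ) ^ (1 + η) + m := by
    linarith
  linarith

/-- The grid of points. -/
def gridPts (m : ℕ) : Finset (ℕ × ℕ) := Finset.range m ×ˢ Finset.range (2 * m ^ 2)

/-- The lines, given by slope and intercept. -/
def gridLines (m : ℕ) : Finset (ℕ × ℕ) := Finset.range m ×ˢ Finset.range (m ^ 2)

/-- A point lies on a line. -/
def onLine (p l : ℕ × ℕ) : Prop := p.2 = l.1 * p.1 + l.2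

/-- All incidences in the grid. -/
noncomputable def gridInc (m : ℕ) : Finset ((ℕ × ℕ) × (ℕ × ℕ)) :=
  (Finset.range m ×ˢ gridLines m).image (fun z => ((z.1, z.2.1 * z.1 + z.2.2), z.2))

/-- Two points with distinct abscissae on a common line. -/
def gridAdj (m : ℕ) (p p' : ℕ × ℕ) : Prop :=
  p.1 ≠ p'.1 ∧ ∃ l ∈ gridLines m, onLine p l ∧ onLine p' l

noncomputable def gridCliques (m s : ℕ) : Finset (Finset (ℕ × ℕ)) :=
  ((gridPts m).powersetCard s).filter (fun S => ∀ p ∈ S, ∀ p' ∈ S, p ≠ p' → gridAdj m p p')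

lemma card_gridInc (m : ℕ) : (gridInc m).card = m ^ 4 := by
  unfold gridInc
  rw [Finset.card_image_of_injective]
  · simp [gridLines]; ring
  · rintro ⟨x, l⟩ ⟨x', l'⟩ h
    simp only [Prod.mk.injEq] at h
    exact Prod.ext h.1.1 h.2

lemma mem_gridInc {m : ℕ} {p l : ℕ × ℕ} (h : (p, l) ∈ gridInc m) :
    p ∈ gridPts m ∧ l ∈ gridLines m ∧ onLine p l := by
  simp only [gridInc, Finset.mem_image, Finset.mem_product, gridLines, Finset.mem_range,
    Prod.exists, Prod.mk.injEq] at h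
  obtain ⟨x, a, b, ⟨hx, ha, hb⟩, rfl, rfl⟩ := h
  simp only [gridPts, gridLines, onLine, Finset.mem_product, Finset.mem_range]
  refine ⟨⟨hx, ?_⟩, ⟨ha, hb⟩, trivial⟩
  have : a * x ≤ m * m := Nat.mul_le_mul ha.le hx.le
  nlinarith

lemma card_adj_pairs (m : ℕ) : ((gridPts m ×ˢ gridPts m).filter
    (fun z => gridAdj m z.1 z.2)).card ≤ m ^ 5 := by
  have hsub : (gridPts m ×ˢ gridPts m).filter (fun z => gridAdj m z.1 z.2) ⊆
      (gridLines m ×ˢ (Finset.range m ×ˢ Finset.range m)).image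
        (fun w => ((w.2.1, w.1.1 * w.2.1 + w.1.2), (w.2.2, w.1.1 * w.2.2 + w.1.2))) := by
    rintro ⟨p, p'⟩ hz
    simp only [Finset.mem_filter, Finset.mem_product, gridPts, Finset.mem_range] at hz
    obtain ⟨⟨⟨hp, -⟩, hp', -⟩, -, l, hl, h1, h2⟩ := hz
    refine Finset.mem_image.mpr ⟨(l, p.1, p'.1), ?_, ?_⟩
    · simp [hl, hp, hp']
    · unfold onLine at h1 h2
      exact Prod.ext (Prod.ext rfl h1.symm) (Prod.ext rfl h2.symm)
  refine (Finset.card_le_card hsub).trans (Finset.card_image_le.trans ?_)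
  simp [gridLines]
  apply le_of_eq; ring

lemma adj_slope {m : ℕ} {p p' : ℕ × ℕ} (h : gridAdj m p p') :
    ∃ a < m, p.2 + a * p'.1 = p'.2 + a * p.1 := by
  obtain ⟨-, l, hl, h1, h2⟩ := h
  simp only [gridLines, Finset.mem_product, Finset.mem_range] at hl
  refine ⟨l.1, hl.1, ?_⟩
  unfold onLine at h1 h2
  rw [h1, h2]; ring

lemma card_cliques (s : ℕ) (hs : 3 ≤ s) (η : ℝ) (hη : 0 < η) : ∃ K : ℝ, 1 ≤ K ∧ ∀ m : ℕ,
    ((gridCliques m s).card : ℝ) ≤ (m : ℝ) ^ 5 * (K * (m : ℝ) ^ (1 + η)) ^ (s - 2) := by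
  obtain ⟨K, hK1, hK⟩ := common_nbrs η hη
  refine ⟨K, hK1, fun m => ?_⟩
  set Q := (gridPts m ×ˢ gridPts m).filter (fun z => gridAdj m z.1 z.2) with hQ
  set W : (ℕ × ℕ) × (ℕ × ℕ) → Finset (ℕ × ℕ) := fun z =>
    (gridPts m).filter (fun p => gridAdj m z.1 p ∧ gridAdj m z.2 p) with hW
  have hsub : gridCliques m s ⊆ Q.biUnion (fun z =>
      ((W z).powersetCard (s - 2)).image (fun T => insert z.1 (insert z.2 T))) := by
    intro S hS
    simp only [gridCliques, Finset.mem_filter, Finset.mem_powersetCard] at hS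
    obtain ⟨⟨hSP, hSc⟩, hadj⟩ := hS
    obtain ⟨p1, h1, p2, h2, hne⟩ := Finset.one_lt_card.mp (by omega : 1 < S.card)
    simp only [Finset.mem_biUnion, Finset.mem_image, Finset.mem_powersetCard]
    refine ⟨(p1, p2), ?_, (S.erase p1).erase p2, ⟨?_, ?_⟩, ?_⟩
    · simp only [hQ, Finset.mem_filter, Finset.mem_product]
      exact ⟨⟨hSP h1, hSP h2⟩, hadj _ h1 _ h2 hne⟩
    · intro p hp
      simp only [Finset.mem_erase] at hp
      simp only [hW, Finset.mem_filter]
      exact ⟨hSP hp.2.2, hadj _ h1 _ hp.2.2 hp.2.1.symm, hadj _ h2 _ hp.2.2 hp.1.symm⟩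
    · rw [Finset.card_erase_of_mem (Finset.mem_erase.mpr ⟨hne.symm, h2⟩),
        Finset.card_erase_of_mem h1]
      omega
    · simp only
      rw [Finset.insert_erase (Finset.mem_erase.mpr ⟨hne.symm, h2⟩), Finset.insert_erase h1]
  have h1 : ((gridCliques m s).card : ℝ) ≤ ∑ z ∈ Q, ((W z).card : ℝ) ^ (s - 2) := by
    have : (gridCliques m s).card ≤ ∑ z ∈ Q, (W z).card ^ (s - 2) := by
      refine (Finset.card_le_card hsub).trans (Finset.card_biUnion_le.trans ?_)
      refine Finset.sum_le_sum fun z _ => Finset.card_image_le.trans ?_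
      rw [Finset.card_powersetCard]
      exact Nat.choose_le_pow _ _
    exact_mod_cast this
  refine h1.trans ?_
  calc _ ≤ ∑ z ∈ Q, (K * (m : ℝ) ^ (1 + η)) ^ (s - 2) := by
        refine Finset.sum_le_sum fun z hz => ?_
        refine pow_le_pow_left₀ (by positivity) ?_ _
        simp only [hQ, Finset.mem_filter, Finset.mem_product, gridPts, Finset.mem_range] at hz
        refine hK m z.1 z.2 (W z) hz.1.1.1 hz.1.2.1 hz.2.1 ?_
        intro p hp
        simp only [hW, Finset.mem_filter, gridPts, Finset.mem_product, Finset.mem_range] at hp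
        exact ⟨hp.1.1, hp.2.2.1.symm, adj_slope hp.2.1, adj_slope hp.2.2⟩
    _ = (Q.card : ℝ) * (K * (m : ℝ) ^ (1 + η)) ^ (s - 2) := by simp
    _ ≤ _ := by
        gcongr
        exact_mod_cast card_adj_pairs m

lemma line_unique {p p' l l' : ℕ × ℕ} (hne : p.1 ≠ p'.1) (h1 : onLine p l) (h2 : onLine p' l)
    (h3 : onLine p l') (h4 : onLine p' l') : l = l' := by
  unfold onLine at *
  have e1 : l.1 = l'.1 := by
    zify at *
    have : ((l.1 : ℤ) - l'.1) * ((p.1 : ℤ) - p'.1) = 0 := by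
      linear_combination h3 - h1 + h2 - h4
    rcases mul_eq_zero.mp this with h | h
    · linarith
    · exact absurd (by linarith) hne
  refine Prod.ext e1 ?_
  rw [e1] at h1
  omega

lemma comb_core (s m q : ℕ) (hs : 3 ≤ s) (hq : 1 ≤ q)
    (hcard : 2 * (gridCliques m s).card ≤ m ^ 4 * q ^ (s * s - s - 1)) :
    ∃ I ⊆ gridInc m, m ^ 4 ≤ 2 * q * I.card ∧
      ∀ (S : Finset (ℕ × ℕ)) (lam : ℕ × ℕ → ℕ × ℕ → ℕ × ℕ), S.card = s →
        (∀ p ∈ S, ∀ p' ∈ S, p ≠ p' → (p, lam p p') ∈ I ∧ (p', lam p p') ∈ I) →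
        ¬ (∀ p ∈ S, ∀ p' ∈ S, ∀ p'' ∈ S, p ≠ p' → p ≠ p'' → lam p p' = lam p p'' → p' = p'') := by
  set e : Finset (ℕ × ℕ) → Finset (gridInc m) := fun S =>
    Finset.univ.filter (fun v => v.1.1 ∈ S ∧ ∃ p' ∈ S, p' ≠ v.1.1 ∧ onLine p' v.1.2) with he
  set Q := (gridCliques m s).filter (fun S => s * s - s ≤ (e S).card) with hQ
  have hss : 1 ≤ s * s - s := by
    have : s * 2 ≤ s * s := Nat.mul_le_mul_left s (by omega)
    omega
  obtain ⟨I0, hI0, hI0c⟩ := hypergraph_indep (V := gridInc m) (ι := Q) (fun S => e S.1)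
    (s * s - s) q hq hss
    (fun S => (Finset.mem_filter.mp S.2).2) (by
      rw [Fintype.card_coe, Fintype.card_coe, card_gridInc]
      refine le_trans ?_ hcard
      gcongr
      exact Finset.filter_subset _ _)
  rw [Fintype.card_coe, card_gridInc] at hI0c
  have hmem : ∀ i, i ∈ I0.map (Function.Embedding.subtype _) ↔ ∃ h : i ∈ gridInc m, ⟨i, h⟩ ∈ I0 := by
    intro i; simp
  refine ⟨I0.map (Function.Embedding.subtype _), ?_, by simpa using hI0c, ?_⟩
  · intro i hi
    exact ((hmem i).mp hi).1
  intro S lam hSc hlam hinj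
  have hJ : ∀ p ∈ S, ∀ p' ∈ S, p ≠ p' →
      (p, lam p p') ∈ gridInc m ∧ (p', lam p p') ∈ gridInc m := fun p hp p' hp' hne =>
    ⟨((hmem _).mp (hlam p hp p' hp' hne).1).1, ((hmem _).mp (hlam p hp p' hp' hne).2).1⟩
  have hadj : ∀ p ∈ S, ∀ p' ∈ S, p ≠ p' → gridAdj m p p' := by
    intro p hp p' hp' hne
    obtain ⟨h1, h2⟩ := hJ p hp p' hp' hne
    obtain ⟨-, h4, h5⟩ := mem_gridInc h1
    obtain ⟨-, -, h6⟩ := mem_gridInc h2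
    refine ⟨?_, _, h4, h5, h6⟩
    intro hx
    refine hne (Prod.ext hx ?_)
    unfold onLine at h5 h6
    rw [h5, h6, hx]
  have hSP : S ⊆ gridPts m := by
    intro p hp
    obtain ⟨p', hp', hne⟩ := Finset.exists_mem_ne (by omega : 1 < S.card) p
    exact (mem_gridInc (hJ p hp p' hp' hne.symm).1).1
  have hScl : S ∈ gridCliques m s := by
    simp only [gridCliques, Finset.mem_filter, Finset.mem_powersetCard]
    exact ⟨⟨hSP, hSc⟩, hadj⟩
  have hecard : s * s - s ≤ (e S).card := by
    rw [← hSc, ← Finset.offDiag_card, ← Finset.card_map (Function.Embedding.subtype _)]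
    refine Finset.card_le_card_of_injOn (fun z => (z.1, lam z.1 z.2)) ?_ ?_
    · rintro ⟨p, p'⟩ hz
      simp only [Finset.coe_offDiag, Set.mem_offDiag, Finset.mem_coe] at hz
      obtain ⟨hp, hp', hne⟩ := hz
      obtain ⟨h1, h2⟩ := hJ p hp p' hp' hne
      simp only [Finset.coe_map, Set.mem_image, Finset.mem_coe, Function.Embedding.subtype_apply]
      refine ⟨⟨(p, lam p p'), h1⟩, ?_, rfl⟩
      simp only [he, Finset.mem_filter, Finset.mem_univ, true_and]
      exact ⟨hp, p', hp', hne.symm, (mem_gridInc h2).2.2⟩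
    · rintro ⟨p, p'⟩ hz ⟨r, r'⟩ hw h
      simp only [Finset.coe_offDiag, Set.mem_offDiag, Finset.mem_coe] at hz hw
      simp only [Prod.mk.injEq] at h
      obtain ⟨rfl, h⟩ := h
      exact Prod.ext rfl (hinj p hz.1 p' hz.2.1 r' hw.2.1 hz.2.2 hw.2.2 h)
  have hSQ : S ∈ Q := Finset.mem_filter.mpr ⟨hScl, hecard⟩
  refine hI0 ⟨S, hSQ⟩ ?_
  rintro ⟨⟨p, l⟩, hv⟩ hvS
  simp only [he, Finset.mem_filter, Finset.mem_univ, true_and] at hvS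
  obtain ⟨hp, p', hp', hne, hon⟩ := hvS
  obtain ⟨h1, h2⟩ := hJ p hp p' hp' hne.symm
  have hl : l = lam p p' := line_unique (hadj p hp p' hp' hne.symm).1 (mem_gridInc hv).2.2 hon
    (mem_gridInc h1).2.2 (mem_gridInc h2).2.2
  subst hl
  obtain ⟨_, h⟩ := (hmem _).mp (hlam p hp p' hp' hne.symm).1
  exact h

/-- Embedding of the integer grid in the plane. -/
def toPlane (p : ℕ × ℕ) : ℝ × ℝ := ((p.1 : ℝ), (p.2 : ℝ))

lemma toPlane_inj : Function.Injective toPlane := by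
  intro p p' h
  simp only [toPlane, Prod.mk.injEq, Nat.cast_inj] at h
  exact Prod.ext h.1 h.2

lemma realize (s m q n : ℕ) (hs : 3 ≤ s) (hq : 1 ≤ q)
    (hcard : 2 * (gridCliques m s).card ≤ m ^ 4 * q ^ (s * s - s - 1)) (hn : 2 * m ^ 3 ≤ n) :
    ∃ P : Finset (ℝ × ℝ), ∃ C : Finset (Set (ℝ × ℝ)),
        P.card = n ∧ C.card = n ∧ KIntersecting C 1 ∧
        ¬ ContainsConfig P C s 1 ∧ m ^ 4 ≤ 2 * q * incidences P C := by
  obtain ⟨I, hIJ, hIc, hI⟩ := comb_core s m q hs hq hcard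
  have hPc : (gridPts m).card ≤ n := by
    simp only [gridPts, Finset.card_product, Finset.card_range]
    refine le_trans (le_of_eq ?_) hn; ring
  have hLc : (gridLines m).card ≤ n := by
    simp only [gridLines, Finset.card_product, Finset.card_range]
    refine le_trans (le_of_eq ?_) ((Nat.le_mul_of_pos_left (m ^ 3) two_pos).trans hn); ring
  obtain ⟨P, hP, hPn⟩ := Infinite.exists_superset_card_eq (gridPts m) n hPc
  obtain ⟨L, hL, hLn⟩ := Infinite.exists_superset_card_eq (gridLines m) n hLc
  obtain ⟨ψ, hψs, hψi, hψm⟩ := geom_realization P I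
    (fun i hi => (mem_gridInc (p := i.1) (l := i.2) (hIJ hi)).2.2)
  have hψinj : Function.Injective ψ := by
    intro l l' h
    by_contra hne
    have h1 := hψi l l' hne
    rw [← h, Set.inter_self] at h1
    obtain ⟨f, -, hf, hfr⟩ := hψs l
    rw [hfr] at h1
    have h2 := hf (h1 ⟨⟨0, by simp⟩, rfl⟩ ⟨⟨1, by simp⟩, rfl⟩)
    simp at h2
  refine ⟨P.image toPlane, L.image ψ, ?_, ?_, ⟨?_, ?_⟩, ?_, ?_⟩
  · rw [Finset.card_image_of_injective _ toPlane_inj, hPn]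
  · rw [Finset.card_image_of_injective _ hψinj, hLn]
  · intro γ hγ
    obtain ⟨l, -, rfl⟩ := Finset.mem_image.mp hγ
    exact hψs l
  · intro γ hγ γ' hγ' hne
    obtain ⟨l, -, rfl⟩ := Finset.mem_image.mp hγ
    obtain ⟨l', -, rfl⟩ := Finset.mem_image.mp hγ'
    have h1 := hψi l l' (fun h => hne (by rw [h]))
    refine ⟨h1.finite, ?_⟩
    rw [Set.ncard_le_one h1.finite]
    exact fun a ha b hb => h1 ha hb
  · rintro ⟨S', hS', hS'c, φ, hφi, hφ⟩
    set S := P.filter (fun p => toPlane p ∈ S') with hS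
    have hSS : S.image toPlane = S' := by
      ext z
      simp only [hS, Finset.mem_image, Finset.mem_filter]
      constructor
      · rintro ⟨p, hp, rfl⟩
        exact hp.2
      · intro hz
        obtain ⟨p, hp, rfl⟩ := Finset.mem_image.mp (hS' hz)
        exact ⟨p, ⟨hp, hz⟩, rfl⟩
    have hSc : S.card = s := by
      rw [← hS'c, ← hSS, Finset.card_image_of_injective _ toPlane_inj]
    have hpair : ∀ p ∈ S, ∀ p' ∈ S, p ≠ p' →
        ({toPlane p, toPlane p'} : Finset (ℝ × ℝ)) ∈ S'.powersetCard (1 + 1) := by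
      intro p hp p' hp' hne
      rw [Finset.mem_powersetCard]
      refine ⟨?_, Finset.card_pair (fun h => hne (toPlane_inj h))⟩
      intro z hz
      simp only [Finset.mem_insert, Finset.mem_singleton] at hz
      rcases hz with rfl | rfl
      · exact (Finset.mem_filter.mp hp).2
      · exact (Finset.mem_filter.mp hp').2
    have hex : ∀ p p', ∃ l, p ∈ S → p' ∈ S → p ≠ p' → ψ l = φ {toPlane p, toPlane p'} := by
      intro p p'
      by_cases h : p ∈ S ∧ p' ∈ S ∧ p ≠ p'
      · obtain ⟨l, -, hl⟩ := Finset.mem_image.mp (hφ _ (hpair p h.1 p' h.2.1 h.2.2)).1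
        exact ⟨l, fun _ _ _ => hl⟩
      · exact ⟨p, fun h1 h2 h3 => absurd ⟨h1, h2, h3⟩ h⟩
    choose lam hlam using hex
    refine hI S lam hSc ?_ ?_
    · intro p hp p' hp' hne
      have h1 := (hφ _ (hpair p hp p' hp' hne)).2
      rw [← hlam p p' hp hp' hne] at h1
      refine ⟨(hψm p (Finset.mem_filter.mp hp).1 _).mp (h1 ?_),
        (hψm p' (Finset.mem_filter.mp hp').1 _).mp (h1 ?_)⟩
      · simp [toPlane]
      · simp [toPlane]
    · intro p hp p' hp' p'' hp'' h1 h2 h3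
      have h4 := hlam p p' hp hp' h1
      rw [h3, hlam p p'' hp hp'' h2] at h4
      have h5 := hφi (hpair p hp p'' hp'' h2) (hpair p hp p' hp' h1) h4
      have h6 : toPlane p' ∈ ({toPlane p, toPlane p''} : Finset (ℝ × ℝ)) := by
        rw [h5]; simp
      simp only [Finset.mem_insert, Finset.mem_singleton] at h6
      rcases h6 with h | h
      · exact absurd (toPlane_inj h).symm h1
      · exact toPlane_inj h
  · refine hIc.trans (Nat.mul_le_mul_left _ ?_)
    unfold incidences
    rw [Finset.sum_image (fun _ _ _ _ h => hψinj h), ← Finset.card_sigma]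
    refine Finset.card_le_card_of_injOn (fun i => ⟨i.2, toPlane i.1⟩) ?_ ?_
    · rintro ⟨p, l⟩ hi
      have h1 := mem_gridInc (hIJ hi)
      simp only [Finset.coe_sigma, Set.mem_sigma_iff, Finset.mem_coe, Finset.mem_filter]
      exact ⟨hL h1.2.1, Finset.mem_image_of_mem _ (hP h1.1), (hψm p (hP h1.1) l).mpr hi⟩
    · rintro ⟨p, l⟩ - ⟨p', l'⟩ - h
      simp only [Sigma.mk.injEq, heq_eq_eq] at h
      exact Prod.ext (toPlane_inj h.2) h.1

theorem lower_bound_construction (s : ℕ) (hs : 3 ≤ s) (ε : ℝ) (hε : 0 < ε) :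
    ∃ n₀ : ℕ, ∀ n : ℕ, n₀ ≤ n →
      ∃ P : Finset (ℝ × ℝ), ∃ C : Finset (Set (ℝ × ℝ)),
        P.card = n ∧ C.card = n ∧ KIntersecting C 1 ∧
        ¬ ContainsConfig P C s 1 ∧
        (n : ℝ) ^ ((4:ℝ)/3 - ((s:ℝ) - 1) / (3 * ((s:ℝ)^2 - (s:ℝ) - 1)) - ε)
          ≤ (incidences P C : ℝ) := by
  obtain ⟨K, hK1, hK⟩ := card_cliques s hs ε hε
  have hK0 : 0 < K := by linarith
  have hs3 : (3:ℝ) ≤ s := by exact_mod_cast hs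
  set R : ℝ := (s:ℝ)^2 - s - 1 with hR
  have hRs : (s:ℝ) - 1 ≤ R := by nlinarith
  have hR0 : 0 < R := by linarith
  have hRnat : ((s * s - s - 1 : ℕ) : ℝ) = R := by
    have h1 : s * 2 ≤ s * s := Nat.mul_le_mul_left s (by omega)
    rw [Nat.cast_sub (by omega), Nat.cast_sub (by omega)]
    push_cast
    rw [hR]; ring
  set β : ℝ := 4 - (s - 1) / R with hβ
  have hβ0 : 0 ≤ β := by
    have : (s - 1) / R ≤ 1 := (div_le_one hR0).mpr hRs
    linarith
  -- the constant in the bound for q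
  set A : ℝ := (2 * K ^ (s - 2)) ^ (1 / R) with hA
  have hA1 : 1 ≤ A := by
    refine Real.one_le_rpow ?_ (by positivity)
    have : 1 ≤ K ^ (s - 2) := one_le_pow₀ hK1
    linarith
  have hlarge : ∃ m0 : ℕ, ∀ m : ℕ, m0 ≤ m → 4 * A * (16:ℝ) ^ (β / 3) ≤ (m : ℝ) ^ (2 * ε) := by
    have h1 := (tendsto_rpow_atTop (show 0 < 2 * ε by positivity)).comp
      (tendsto_natCast_atTop_atTop (R := ℝ))
    obtain ⟨m0, hm0⟩ := Filter.eventually_atTop.mp (h1.eventually_ge_atTop (4 * A * (16:ℝ) ^ (β / 3)))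
    exact ⟨m0, hm0⟩
  obtain ⟨m0, hm0⟩ := hlarge
  refine ⟨2 * (m0 + 1) ^ 3, fun n hn => ?_⟩
  have hexm : ∃ m : ℕ, n < 2 * (m + 1) ^ 3 := ⟨n, by nlinarith [Nat.zero_le (n^3), Nat.zero_le (n^2)]⟩
  obtain ⟨m, hmn, hmn'⟩ : ∃ m : ℕ, 2 * m ^ 3 ≤ n ∧ n < 2 * (m + 1) ^ 3 := by
    refine ⟨Nat.find hexm, ?_, Nat.find_spec hexm⟩
    rcases Nat.eq_zero_or_pos (Nat.find hexm) with h | h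
    · rw [h]; simp
    · have h1 := Nat.find_min hexm (Nat.sub_lt h one_pos)
      rw [show Nat.find hexm - 1 + 1 = Nat.find hexm by omega] at h1
      omega
  have hmm : m0 + 1 ≤ m := by
    by_contra hcon
    have h1 : m + 1 ≤ m0 + 1 := by omega
    have h2 := Nat.pow_le_pow_left h1 3
    omega
  have hm1 : (1:ℝ) ≤ m := by exact_mod_cast (by omega : 1 ≤ m)
  have hmpos : (0:ℝ) < m := by linarith
  have hml := hm0 m (by omega)
  -- choice of q
  set X : ℝ := A * (m : ℝ) ^ ((s - 1) / R + ε) with hX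
  have hX1 : 1 ≤ X := by
    have h1 : 1 ≤ (m : ℝ) ^ ((s - 1) / R + ε) := by
      refine Real.one_le_rpow hm1 ?_
      have : 0 ≤ ((s:ℝ) - 1) / R := div_nonneg (by linarith) hR0.le
      linarith
    exact one_le_mul_of_one_le_of_one_le hA1 h1
  set q : ℕ := ⌈X⌉₊ with hq
  have hqX : X ≤ q := Nat.le_ceil X
  have hq1 : 1 ≤ q := Nat.one_le_ceil_iff.mpr (by linarith)
  have hq2 : (q : ℝ) ≤ 2 * X := by
    have := Nat.ceil_lt_add_one (by linarith : 0 ≤ X)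
    linarith
  have hcard : 2 * (gridCliques m s).card ≤ m ^ 4 * q ^ (s * s - s - 1) := by
    have h1 := hK m
    have hXR : X ^ R = 2 * K ^ (s - 2) * (m : ℝ) ^ ((s - 1) + ε * R) := by
      rw [hX, Real.mul_rpow (by positivity) (by positivity), hA, ← Real.rpow_mul (by positivity),
        ← Real.rpow_mul (by positivity)]
      congr 1
      · rw [one_div_mul_cancel hR0.ne', Real.rpow_one]
      · congr 1; field_simp
    have h2 : (m : ℝ) ^ 5 * (K * (m : ℝ) ^ (1 + ε)) ^ (s - 2)
        ≤ K ^ (s - 2) * (m : ℝ) ^ 4 * (m : ℝ) ^ ((s - 1) + ε * R) := by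
      have h3 : (m : ℝ) * ((m : ℝ) ^ (1 + ε)) ^ (s - 2) ≤ (m : ℝ) ^ ((s - 1) + ε * R) := by
        rw [← Real.rpow_natCast, ← Real.rpow_mul hmpos.le, Nat.cast_sub (by omega)]
        nth_rewrite 1 [← Real.rpow_one (m : ℝ)]
        rw [← Real.rpow_add hmpos]
        refine Real.rpow_le_rpow_of_exponent_le hm1 ?_
        push_cast
        nlinarith
      calc _ = K ^ (s - 2) * (m : ℝ) ^ 4 * ((m : ℝ) * ((m : ℝ) ^ (1 + ε)) ^ (s - 2)) := by
            rw [mul_pow]; ring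
        _ ≤ _ := by gcongr
    have h4 : X ^ R ≤ (q : ℝ) ^ (s * s - s - 1) := by
      rw [← Real.rpow_natCast, hRnat]
      exact Real.rpow_le_rpow (by linarith) hqX hR0.le
    have h5 : (2 : ℝ) * (gridCliques m s).card ≤ (m : ℝ) ^ 4 * (q : ℝ) ^ (s * s - s - 1) := by
      calc (2 : ℝ) * (gridCliques m s).card
          ≤ 2 * (K ^ (s - 2) * (m : ℝ) ^ 4 * (m : ℝ) ^ ((s - 1) + ε * R)) := by linarith
        _ = (m : ℝ) ^ 4 * X ^ R := by rw [hXR]; ring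
        _ ≤ _ := by gcongr
    exact_mod_cast h5
  obtain ⟨P, C, hP, hC, hint, hcfg, hinc⟩ := realize s m q n hs hq1 hcard hmn
  refine ⟨P, C, hP, hC, hint, hcfg, ?_⟩
  have hinc' : (m : ℝ) ^ 4 ≤ 2 * q * incidences P C := by exact_mod_cast hinc
  have hnlow : (m : ℝ) ^ 3 ≤ n := by
    have : (2:ℝ) * m ^ 3 ≤ n := by exact_mod_cast hmn
    have : (0:ℝ) ≤ m ^ 3 := by positivity
    linarith
  have hnup : (n : ℝ) ≤ 16 * m ^ 3 := by
    have h1 : (n : ℝ) ≤ 2 * (m + 1) ^ 3 := by exact_mod_cast hmn'.le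
    have h2 : ((m : ℝ) + 1) ^ 3 ≤ (2 * m) ^ 3 := by gcongr; linarith
    rw [mul_pow] at h2
    linarith
  have hnpos : (0:ℝ) < n := lt_of_lt_of_le (by positivity) hnlow
  have e0 : (4:ℝ)/3 - ((s:ℝ) - 1) / (3 * R) - ε = β / 3 + (-ε) := by
    rw [hβ]; field_simp; ring
  have hm3 : ∀ t : ℝ, ((m : ℝ) ^ 3) ^ t = (m : ℝ) ^ (3 * t) := by
    intro t
    rw [← Real.rpow_natCast, ← Real.rpow_mul hmpos.le]; norm_num
  have b1 : (n : ℝ) ^ (β / 3) ≤ (16:ℝ) ^ (β / 3) * (m : ℝ) ^ β := by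
    calc (n : ℝ) ^ (β / 3) ≤ (16 * (m : ℝ) ^ 3) ^ (β / 3) :=
          Real.rpow_le_rpow hnpos.le hnup (by positivity)
      _ = _ := by
          rw [Real.mul_rpow (by norm_num) (by positivity), hm3]
          congr 2; ring
  have b2 : (n : ℝ) ^ (-ε) ≤ (m : ℝ) ^ (-(3 * ε)) := by
    calc (n : ℝ) ^ (-ε) ≤ ((m : ℝ) ^ 3) ^ (-ε) :=
          Real.rpow_le_rpow_of_nonpos (by positivity) hnlow (by linarith)
      _ = _ := by rw [hm3]; congr 1; ring
  rw [e0, Real.rpow_add hnpos]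
  have hXpos : 0 < X := by linarith
  have b3 : (m : ℝ) ^ 4 ≤ 4 * X * incidences P C := by
    refine hinc'.trans ?_
    have : (0:ℝ) ≤ incidences P C := by positivity
    nlinarith
  have b4 : (n : ℝ) ^ (β / 3) * (n : ℝ) ^ (-ε) ≤ (16:ℝ) ^ (β / 3) * (m : ℝ) ^ β * (m : ℝ) ^ (-(3 * ε)) := by
    gcongr
  refine b4.trans ?_
  refine le_of_mul_le_mul_left (le_trans ?_ b3) (by positivity : 0 < 4 * X)
  calc 4 * X * ((16:ℝ) ^ (β / 3) * (m : ℝ) ^ β * (m : ℝ) ^ (-(3 * ε)))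
      = (4 * A * (16:ℝ) ^ (β / 3)) *
        ((m : ℝ) ^ ((s - 1) / R + ε) * (m : ℝ) ^ β * (m : ℝ) ^ (-(3 * ε))) := by rw [hX]; ring
    _ ≤ (m : ℝ) ^ (2 * ε) *
        ((m : ℝ) ^ ((s - 1) / R + ε) * (m : ℝ) ^ β * (m : ℝ) ^ (-(3 * ε))) := by gcongr
    _ = (m : ℝ) ^ (4 : ℝ) := by
        rw [← Real.rpow_add hmpos, ← Real.rpow_add hmpos, ← Real.rpow_add hmpos]
        congr 1
        rw [hβ]; ring
    _ = (m : ℝ) ^ 4 := by norm_cast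
end
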